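/- Let G be a 3-connected graph. Then G is K_{2,4}-minor-free if and only if G is isomorphic to a graph in 𝒢 or G is isomorphic to one of the nine graphs K_5, K_{3,3}, A, A⁺, B, B⁺, C, C⁺, D. -/

import Mathlib

namespace K24Paper

open SimpleGraph

/-- `H` is a minor of `G`: branch sets indexed by vertices of `H`, pairwise disjoint,
each inducing a connected subgraph of `G`, with every edge of `H` realized by an edge
of `G` between the corresponding branch sets. -/
def IsMinor {W V : Type*} (H : SimpleGraph W) (G : SimpleGraph V) : Prop :=
  ∃ B : W → Set V,
    (∀ w, (G.induce (B w)).Connected) ∧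
    (∀ w₁ w₂, w₁ ≠ w₂ → Disjoint (B w₁) (B w₂)) ∧
    (∀ w₁ w₂, H.Adj w₁ w₂ → ∃ v₁ ∈ B w₁, ∃ v₂ ∈ B w₂, G.Adj v₁ v₂)

/-- `G` is `H`-minor-free. -/
def MinorFree {W V : Type*} (H : SimpleGraph W) (G : SimpleGraph V) : Prop :=
  ¬ IsMinor H G

/-- The complete bipartite graph `K_{2,4}`. -/
def K24 : SimpleGraph (Fin 2 ⊕ Fin 4) := completeBipartiteGraph (Fin 2) (Fin 4)

/-- `G` is `k`-connected: more than `k` vertices, and removing fewer than `k`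
vertices leaves a connected graph. -/
def KConnected {V : Type*} (k : ℕ) (G : SimpleGraph V) : Prop :=
  k < Nat.card V ∧ ∀ S : Set V, S.ncard < k → (G.induce Sᶜ).Connected

/-- The graph `G_{n,r,s}` (with the plus edge if `plus = true`), on vertices
`0, …, n-1` corresponding to `v_1, …, v_n`:  the spine `v_1 v_2 ⋯ v_n`, the edges
`v_1 v_{n-i}` for `1 ≤ i ≤ r`, the edges `v_n v_{1+j}` for `1 ≤ j ≤ s`, and
(if `plus`) the plus edge `v_1 v_n`. -/
def Gnrs (n r s : ℕ) (plus : Bool) : SimpleGraph (Fin n) :=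
  SimpleGraph.fromRel (fun a b =>
    b.val = a.val + 1 ∨
    (a.val = 0 ∧ n - 1 - r ≤ b.val ∧ b.val ≤ n - 2) ∨
    (b.val = n - 1 ∧ 1 ≤ a.val ∧ a.val ≤ s) ∨
    (plus = true ∧ a.val = 0 ∧ b.val = n - 1))

/-- The parameter conditions describing membership in the class `𝒢`. -/
def Gparams (n r s : ℕ) (plus : Bool) : Prop :=
  (plus = true ∧ 4 ≤ n ∧ ((r = 1 ∧ s = n - 3) ∨ (r = n - 3 ∧ s = 1))) ∨
  (5 ≤ n ∧ 2 ≤ r ∧ r ≤ n - 3 ∧ 2 ≤ s ∧ s ≤ n - 3 ∧ (r + s = n - 2 ∨ r + s = n - 1))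

/-- `G` belongs to `𝒢̃`, i.e. `G` is isomorphic to a graph of the class `𝒢`. -/
def InGtilde {V : Type*} (G : SimpleGraph V) : Prop :=
  ∃ n r s plus, Gparams n r s plus ∧ Nonempty (G ≃g Gnrs n r s plus)

/-- The graph obtained from `G` by subdividing every edge in `F` once:
new vertices are the members of `F`. -/
def SubdivideEdges {V : Type*} (G : SimpleGraph V) (F : Set (Sym2 V)) :
    SimpleGraph (V ⊕ F) :=
  SimpleGraph.fromRel (fun a b =>
    match a, b with
    | Sum.inl u, Sum.inl v => G.Adj u v ∧ s(u, v) ∉ F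
    | Sum.inl u, Sum.inr e => u ∈ (e : Sym2 V)
    | Sum.inr e, Sum.inl u => u ∈ (e : Sym2 V)
    | Sum.inr _, Sum.inr _ => False)

/-- A set `F` of edges of a graph `G` is subdividable if subdividing every edge
of `F` once yields a `K_{2,4}`-minor-free graph. -/
def Subdividable {V : Type*} (G : SimpleGraph V) (F : Set (Sym2 V)) : Prop :=
  F ⊆ G.edgeSet ∧ MinorFree K24 (SubdivideEdges G F)

/-- `F` is a maximal subdividable set of edges of `G`. -/
def MaxSubdividable {V : Type*} (G : SimpleGraph V) (F : Set (Sym2 V)) : Prop :=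
  Subdividable G F ∧ ∀ F', Subdividable G F' → F ⊆ F' → F' = F

/-- `l` lists vertices along a path of `G` (consecutive entries adjacent, no repeats)
such that no two edges of `G` cross with respect to this ordering. -/
def OuterListing {U : Type*} (G : SimpleGraph U) (l : List U) : Prop :=
  l.Nodup ∧ l.Chain' G.Adj ∧
  ∀ (i k j m : ℕ) (h1 : i < k) (h2 : k < j) (h3 : j < m) (hm : m < l.length),
    ¬(G.Adj (l.get ⟨i, by omega⟩) (l.get ⟨j, by omega⟩) ∧
      G.Adj (l.get ⟨k, by omega⟩) (l.get ⟨m, by omega⟩))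

/-- The graph `G` restricted to the vertex set `A` is `xy`-outerplanar: it has a
hamilton `xy`-path (listing exactly the vertices of `A`) such that no two edges
cross with respect to it. -/
def XYOuterplanar {U : Type*} (G : SimpleGraph U) (A : Set U) (x y : U) : Prop :=
  ∃ l : List U, (∀ v, v ∈ l ↔ v ∈ A) ∧ l.head? = some x ∧ l.getLast? = some y ∧
    OuterListing G l

/-- A block: a connected graph with no cutvertex. -/
def IsBlock {V : Type*} (G : SimpleGraph V) : Prop :=
  G.Connected ∧ ∀ v : V, (G.induce {u | u ≠ v}).Preconnected

/-- `G + xy`: the graph `G` with the edge `xy` added (if not already present). -/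
def AddEdge {U : Type*} (G : SimpleGraph U) (x y : U) : SimpleGraph U :=
  G ⊔ SimpleGraph.fromRel (fun a b => a = x ∧ b = y)

/-- A standard `K_{2,t}` minor `(R₁, R₂; S)` of `G`. -/
def StdK2tMinor {V : Type*} (G : SimpleGraph V) (t : ℕ) (R₁ R₂ S : Set V) : Prop :=
  Disjoint R₁ R₂ ∧ Disjoint (R₁ ∪ R₂) S ∧
  (G.induce R₁).Connected ∧ (G.induce R₂).Connected ∧
  S.Finite ∧ S.ncard = t ∧
  ∀ v ∈ S, (∃ w ∈ R₁, G.Adj v w) ∧ (∃ w ∈ R₂, G.Adj v w)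

/-- `K_{3,3}` with parts `{0,1,2}` and `{3,4,5}`. -/
def K33 : SimpleGraph (Fin 6) :=
  SimpleGraph.fromRel (fun a b => a.val < 3 ∧ 3 ≤ b.val)

/-- The graph `A = K_{3,3} + v₂v₃`. -/
def GA : SimpleGraph (Fin 6) := AddEdge K33 1 2

/-- The graph `A⁺ = K_{3,3} + v₂v₃ + v₅v₆`. -/
def GAplus : SimpleGraph (Fin 6) := AddEdge GA 4 5

/-- The graph `B`, on vertices `h, r₁, r₂, r₃, r₄, g₁, g₂ = 0, …, 6`. -/
def GB : SimpleGraph (Fin 7) :=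
  SimpleGraph.fromRel (fun a b => (a.val, b.val) ∈
    [(0,3),(0,4),(1,4),(2,3),(3,4),(5,0),(5,1),(5,2),(6,0),(6,1),(6,2)])

/-- The graph `B⁺ = B + g₁g₂`. -/
def GBplus : SimpleGraph (Fin 7) := AddEdge GB 5 6

/-- The graph `C⁺`, on vertices `v₁, …, v₈ = 0, …, 7`. -/
def GCplus : SimpleGraph (Fin 8) :=
  SimpleGraph.fromRel (fun a b => (a.val, b.val) ∈
    [(0,1),(0,2),(1,2),(3,4),(3,5),(3,6),(3,7),(4,5),(4,6),(4,7),(2,5),(1,7),(0,6)])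

/-- The graph `C = C⁺ ∖ v₄v₅`. -/
def GC : SimpleGraph (Fin 8) := GCplus.deleteEdges {s(3, 4)}

/-- The graph `D`, on vertices `t₁, t₂, t₃, d₁, d₂, d₃, g = 0, …, 6`. -/
def GD : SimpleGraph (Fin 7) :=
  SimpleGraph.fromRel (fun a b => (a.val, b.val) ∈
    [(0,1),(0,2),(1,2),(3,4),(3,5),(4,5),(0,3),(1,4),(2,5),(6,0),(6,1),(6,2)])

/-- The complete graph `K₅`. -/
def GK5 : SimpleGraph (Fin 5) := completeGraph (Fin 5)

end K24Paper

namespace K24Paper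
open SimpleGraph

/-! ### Connected sets, contraction and minors -/

/-- Connectedness of a vertex set in terms of closed subsets. -/
def ConnSet {V : Type*} (G : SimpleGraph V) (R : Set V) : Prop :=
  R.Nonempty ∧ ∀ A : Set V, A ⊆ R → A.Nonempty →
    (∀ a ∈ A, ∀ b ∈ R, G.Adj a b → b ∈ A) → R ⊆ A

lemma connSet_iff {V : Type*} (G : SimpleGraph V) (R : Set V) :
    (G.induce R).Connected ↔ ConnSet G R := by
  constructor
  · intro h
    refine ⟨?_, ?_⟩
    · obtain ⟨x⟩ := h.nonempty
      exact ⟨x.1, x.2⟩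
    · rintro A hA ⟨a, ha⟩ hcl r hr
      have hreach := h.preconnected ⟨a, hA ha⟩ ⟨r, hr⟩
      rw [SimpleGraph.reachable_iff_reflTransGen] at hreach
      have : ∀ y : R, Relation.ReflTransGen (G.induce R).Adj ⟨a, hA ha⟩ y → y.1 ∈ A := by
        intro y hy
        induction hy with
        | refl => exact ha
        | tail _ hadj ih => exact hcl _ ih _ (Subtype.property _) hadj
      exact this _ hreach
  · rintro ⟨⟨a, ha⟩, hcl⟩
    have key : ∀ r : R, (G.induce R).Reachable ⟨a, ha⟩ r := by
      have hsub := hcl {x | ∃ h : x ∈ R, (G.induce R).Reachable ⟨a, ha⟩ ⟨x, h⟩}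
        (fun x hx => hx.1) ⟨a, ha, SimpleGraph.Reachable.refl _⟩ (by
          rintro x ⟨hx, hr⟩ b hb hadj
          refine ⟨hb, hr.trans (SimpleGraph.Adj.reachable ?_)⟩
          exact hadj)
      intro r
      obtain ⟨h, hr⟩ := hsub r.2
      exact hr
    have : Nonempty R := ⟨⟨a, ha⟩⟩
    exact ⟨fun x y => (key x).symm.trans (key y)⟩

/-- `K_{2,4}` minor with closed-set connectedness. -/
lemma isMinor_iff {W V : Type*} (H : SimpleGraph W) (G : SimpleGraph V) :
    IsMinor H G ↔ ∃ B : W → Set V, (∀ w, ConnSet G (B w)) ∧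
      (∀ w₁ w₂, w₁ ≠ w₂ → Disjoint (B w₁) (B w₂)) ∧
      (∀ w₁ w₂, H.Adj w₁ w₂ → ∃ v₁ ∈ B w₁, ∃ v₂ ∈ B w₂, G.Adj v₁ v₂) := by
  unfold IsMinor
  simp only [connSet_iff]

/-- Contraction of the edge `wu` onto `u`. -/
def contr {V : Type*} (G : SimpleGraph V) (w u : V) : SimpleGraph {x : V // x ≠ w} where
  Adj a b := a ≠ b ∧ (G.Adj a.1 b.1 ∨ (a.1 = u ∧ G.Adj w b.1) ∨ (b.1 = u ∧ G.Adj w a.1))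
  symm := ⟨by
    rintro a b ⟨h, h1⟩
    refine ⟨h.symm, ?_⟩
    rcases h1 with h1 | h1 | h1
    · exact Or.inl h1.symm
    · exact Or.inr (Or.inr h1)
    · exact Or.inr (Or.inl h1)⟩
  loopless := ⟨fun a h => h.1 rfl⟩

lemma contr_adj_of {V : Type*} {G : SimpleGraph V} {w u : V} {a b : V} (ha : a ≠ w) (hb : b ≠ w)
    (h : G.Adj a b) : (contr G w u).Adj ⟨a, ha⟩ ⟨b, hb⟩ :=
  ⟨fun e => h.ne (congrArg Subtype.val e), Or.inl h⟩

lemma contr_adj_iff_of_ne {V : Type*} {G : SimpleGraph V} {w u : V} {a b : V} (ha : a ≠ w)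
    (hb : b ≠ w) (hau : a ≠ u) (hbu : b ≠ u) :
    (contr G w u).Adj ⟨a, ha⟩ ⟨b, hb⟩ ↔ G.Adj a b := by
  constructor
  · rintro ⟨_, h | h | h⟩
    · exact h
    · exact absurd h.1 hau
    · exact absurd h.1 hbu
  · exact contr_adj_of ha hb

lemma contr_adj_u {V : Type*} {G : SimpleGraph V} {w u : V} (hwu : G.Adj w u) {b : V}
    (hb : b ≠ w) (hbu : b ≠ u) :
    (contr G w u).Adj ⟨u, hwu.ne'⟩ ⟨b, hb⟩ ↔ G.Adj u b ∨ G.Adj w b := by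
  constructor
  · rintro ⟨_, h | h | h⟩
    · exact Or.inl h
    · exact Or.inr h.2
    · exact absurd h.1 hbu
  · rintro (h | h)
    · exact contr_adj_of _ _ h
    · exact ⟨fun e => hbu (congrArg Subtype.val e).symm, Or.inr (Or.inl ⟨rfl, h⟩)⟩

lemma isMinor_of_contr {W V : Type*} {H : SimpleGraph W} {G : SimpleGraph V} {w u : V}
    (hwu : G.Adj w u) (h : IsMinor H (contr G w u)) : IsMinor H G := by
  rw [isMinor_iff] at h ⊢
  obtain ⟨B, hc, hd, he⟩ := h
  set P : W → Set V := fun t => {x | (∃ h : x ≠ w, (⟨x, h⟩ : {x : V // x ≠ w}) ∈ B t) ∨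
    (x = w ∧ (⟨u, hwu.ne'⟩ : {x : V // x ≠ w}) ∈ B t)} with hP
  have memne : ∀ t (x : V) (hx : x ≠ w), x ∈ P t ↔ (⟨x, hx⟩ : {x : V // x ≠ w}) ∈ B t := by
    intro t x hx
    constructor
    · rintro (⟨_, h⟩ | ⟨h, _⟩)
      · exact h
      · exact absurd h hx
    · intro h
      exact Or.inl ⟨hx, h⟩
  have memw : ∀ t, w ∈ P t ↔ (⟨u, hwu.ne'⟩ : {x : V // x ≠ w}) ∈ B t := by
    intro t
    constructor
    · rintro (⟨h, _⟩ | ⟨_, h⟩)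
      · exact absurd rfl h
      · exact h
    · intro h
      exact Or.inr ⟨rfl, h⟩
  refine ⟨P, ?_, ?_, ?_⟩
  · intro t
    obtain ⟨⟨b0, hb0⟩, hcl⟩ := hc t
    refine ⟨⟨b0.1, (memne t b0.1 b0.2).2 hb0⟩, ?_⟩
    intro A hA hne hclA
    have hwA : w ∈ P t → (w ∈ A ↔ u ∈ A) := by
      intro hw
      have hu : u ∈ P t := (memne t u hwu.ne').2 ((memw t).1 hw)
      exact ⟨fun h => hclA w h u hu hwu, fun h => hclA u h w hw hwu.symm⟩
    have hsub := hcl {x | x ∈ B t ∧ x.1 ∈ A} (fun x hx => hx.1) (by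
      obtain ⟨a, ha⟩ := hne
      by_cases haw : a = w
      · subst haw
        have hw := hA ha
        exact ⟨⟨u, hwu.ne'⟩, (memw t).1 hw, (hwA hw).1 ha⟩
      · exact ⟨⟨a, haw⟩, (memne t a haw).1 (hA ha), ha⟩) (by
      rintro a ⟨haB, haA⟩ b hb hab
      refine ⟨hb, ?_⟩
      have hbP : b.1 ∈ P t := (memne t b.1 b.2).2 hb
      rcases hab.2 with h | ⟨h1, h2⟩ | ⟨h1, h2⟩
      · exact hclA _ haA _ hbP h
      · have hw : w ∈ P t := (memw t).2 (by convert haB using 1; exact Subtype.ext h1.symm)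
        have : w ∈ A := (hwA hw).2 (h1 ▸ haA)
        exact hclA _ this _ hbP h2
      · have hw : w ∈ P t := (memw t).2 (by convert hb using 1; exact Subtype.ext h1.symm)
        have : w ∈ A := hclA _ haA _ hw h2.symm
        rw [h1]
        exact (hwA hw).1 this)
    intro x hx
    by_cases hxw : x = w
    · subst hxw
      exact (hwA hx).2 (hsub ((memw t).1 hx)).2
    · exact (hsub ((memne t x hxw).1 hx)).2
  · intro t1 t2 hne
    rw [Set.disjoint_left]
    intro x h1 h2
    have := Set.disjoint_left.1 (hd t1 t2 hne)
    by_cases hxw : x = w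
    · subst hxw
      exact this ((memw t1).1 h1) ((memw t2).1 h2)
    · exact this ((memne t1 x hxw).1 h1) ((memne t2 x hxw).1 h2)
  · intro t1 t2 hadj
    obtain ⟨a, ha, b, hb, hab⟩ := he t1 t2 hadj
    rcases hab.2 with h | ⟨h1, h2⟩ | ⟨h1, h2⟩
    · exact ⟨a.1, (memne _ _ a.2).2 ha, b.1, (memne _ _ b.2).2 hb, h⟩
    · refine ⟨w, (memw t1).2 ?_, b.1, (memne _ _ b.2).2 hb, h2⟩
      convert ha using 1
      exact Subtype.ext h1.symm
    · refine ⟨a.1, (memne _ _ a.2).2 ha, w, (memw t2).2 ?_, h2.symm⟩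
      convert hb using 1
      exact Subtype.ext h1.symm

/-! ### 3-connectedness via separations -/

def Sep3 {V : Type*} (G : SimpleGraph V) : Prop :=
  ∀ (A : Set V) (x y : V), A.Nonempty → x ∉ A → y ∉ A →
    (∀ a ∈ A, ∀ b, G.Adj a b → b ∈ A ∨ b = x ∨ b = y) → ∀ z, z ∈ A ∨ z = x ∨ z = y

lemma sep3_of_kconn {V : Type*} [Finite V] {G : SimpleGraph V} (h : KConnected 3 G) : Sep3 G := by
  intro A x y hne hx hy hcl z
  have h1 := h.2 {x, y} (lt_of_le_of_lt (Set.ncard_insert_le _ _) (by simp))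
  rw [connSet_iff] at h1
  by_contra hz
  push Not at hz
  refine hz.1 (h1.2 A ?_ hne ?_ ?_)
  · intro a ha
    simp only [Set.mem_compl_iff, Set.mem_insert_iff, Set.mem_singleton_iff, not_or]
    exact ⟨fun e => hx (e ▸ ha), fun e => hy (e ▸ ha)⟩
  · intro a ha b hb hab
    simp only [Set.mem_compl_iff, Set.mem_insert_iff, Set.mem_singleton_iff, not_or] at hb
    rcases hcl a ha b hab with h | h | h
    · exact h
    · exact absurd h hb.1
    · exact absurd h hb.2
  · simp only [Set.mem_compl_iff, Set.mem_insert_iff, Set.mem_singleton_iff, not_or]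
    exact ⟨hz.2.1, hz.2.2⟩

lemma exists_ne3 {V : Type*} [Finite V] (hc : 3 < Nat.card V) (x y z : V) :
    ∃ t, t ≠ x ∧ t ≠ y ∧ t ≠ z := by
  by_contra h
  push Not at h
  have hu : (Set.univ : Set V) ⊆ {x, y, z} := by
    intro t _
    by_cases h1 : t = x
    · simp [h1]
    · by_cases h2 : t = y
      · simp [h2]
      · simp [h t h1 h2]
  have h2 := Set.ncard_le_ncard hu (Set.toFinite _)
  rw [Set.ncard_univ] at h2
  have h3 : ({x, y, z} : Set V).ncard ≤ 3 := by
    refine (Set.ncard_insert_le _ _).trans ?_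
    have := Set.ncard_insert_le y ({z} : Set V)
    simp at this
    omega
  omega

lemma sep3_closed {V : Type*} [Finite V] {G : SimpleGraph V} (hc : 3 < Nat.card V) (h : Sep3 G)
    (A : Set V) (hne : A.Nonempty) (hcl : ∀ a ∈ A, ∀ b, G.Adj a b → b ∈ A) (z : V) : z ∈ A := by
  by_contra hz
  have h1 := h A z z hne hz hz (fun a ha b hab => Or.inl (hcl a ha b hab))
  obtain ⟨a, ha⟩ := hne
  have haz : a ≠ z := fun e => hz (e ▸ ha)
  have h2 := h {z} a a ⟨z, rfl⟩ (by simpa using haz) (by simpa using haz) (by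
    intro b hb c hbc
    rw [Set.mem_singleton_iff] at hb
    subst hb
    rcases h1 c with h3 | h3 | h3
    · exact absurd (hcl c h3 _ hbc.symm) hz
    · exact absurd h3 hbc.ne'
    · exact absurd h3 hbc.ne')
  obtain ⟨t, ht1, ht2, _⟩ := exists_ne3 hc a z z
  rcases h2 t with h3 | h3 | h3
  · exact ht2 h3
  · exact ht1 h3
  · exact ht1 h3

lemma kconn_of_sep3 {V : Type*} [Finite V] {G : SimpleGraph V} (hc : 3 < Nat.card V)
    (h : Sep3 G) : KConnected 3 G := by
  refine ⟨hc, fun S hS => ?_⟩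
  rw [connSet_iff]
  have hcases : S = ∅ ∨ (∃ x y, S = {x, y}) := by
    have : S.ncard = 0 ∨ S.ncard = 1 ∨ S.ncard = 2 := by omega
    rcases this with h | h | h
    · left
      exact (Set.ncard_eq_zero (Set.toFinite _)).1 h
    · right
      obtain ⟨x, hx⟩ := Set.ncard_eq_one.1 h
      exact ⟨x, x, by simp [hx]⟩
    · right
      obtain ⟨x, y, _, hx⟩ := Set.ncard_eq_two.1 h
      exact ⟨x, y, hx⟩
  rcases hcases with rfl | ⟨x, y, rfl⟩
  · have : Nonempty V := (Nat.card_pos_iff.1 (by omega)).1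
    obtain ⟨v⟩ := this
    refine ⟨⟨v, by simp⟩, ?_⟩
    intro A _ hne hcl z _
    exact sep3_closed hc h A hne (fun a ha b hab => hcl a ha b (by simp) hab) z
  · obtain ⟨t, ht1, ht2, _⟩ := exists_ne3 hc x y y
    refine ⟨⟨t, by simp [ht1, ht2]⟩, ?_⟩
    intro A hA hne hcl z hz
    simp only [Set.mem_compl_iff, Set.mem_insert_iff, Set.mem_singleton_iff, not_or] at hz
    have := h A x y hne (fun hx => by simpa using hA hx) (fun hx => by simpa using hA hx) (by
      intro a ha b hab
      by_cases hb : b = x ∨ b = y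
      · exact Or.inr hb
      · exact Or.inl (hcl a ha b (by simpa using hb) hab)) z
    rcases this with h | h | h
    · exact h
    · exact absurd h hz.1
    · exact absurd h hz.2

lemma exists_nbr_ne {V : Type*} [Finite V] {G : SimpleGraph V} (hc : 3 < Nat.card V)
    (h : Sep3 G) (p x y : V) : ∃ b, G.Adj p b ∧ b ≠ x ∧ b ≠ y := by
  have main : ∀ x y, p ≠ x → p ≠ y → ∃ b, G.Adj p b ∧ b ≠ x ∧ b ≠ y := by
    intro x y hx hy
    by_contra hcon
    push Not at hcon
    have h1 := h {p} x y ⟨p, rfl⟩ (by simpa using hx.symm) (by simpa using hy.symm) (by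
      intro a ha b hab
      rw [Set.mem_singleton_iff] at ha
      subst ha
      by_cases hb : b = x
      · exact Or.inr (Or.inl hb)
      · exact Or.inr (Or.inr (hcon b hab hb)))
    obtain ⟨t, ht1, ht2, ht3⟩ := exists_ne3 hc p x y
    rcases h1 t with h3 | h3 | h3
    · exact ht1 h3
    · exact ht2 h3
    · exact ht3 h3
  obtain ⟨q, hq, _, _⟩ := exists_ne3 hc p p p
  by_cases hx : p = x
  · by_cases hy : p = y
    · obtain ⟨b, hb, _⟩ := main q q hq.symm hq.symm
      exact ⟨b, hb, hx ▸ hb.ne', hy ▸ hb.ne'⟩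
    · obtain ⟨b, hb, h1, _⟩ := main y y hy hy
      exact ⟨b, hb, hx ▸ hb.ne', h1⟩
  · by_cases hy : p = y
    · obtain ⟨b, hb, h1, _⟩ := main x x hx hx
      exact ⟨b, hb, h1, hy ▸ hb.ne'⟩
    · exact main x y hx hy

/-- `A` is one side of a 3-cut `{w, u, z}`. -/
def Cut {V : Type*} (G : SimpleGraph V) (w u z : V) (A : Set V) : Prop :=
  A.Nonempty ∧ w ∉ A ∧ u ∉ A ∧ z ∉ A ∧
    (∀ a ∈ A, ∀ b, G.Adj a b → b ∈ A ∨ b = w ∨ b = u ∨ b = z) ∧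
    ∃ t, t ∉ A ∧ t ≠ w ∧ t ≠ u ∧ t ≠ z

lemma Cut.compl {V : Type*} {G : SimpleGraph V} {w u z : V} {A : Set V} (h : Cut G w u z A) :
    Cut G w u z {t | t ∉ A ∧ t ≠ w ∧ t ≠ u ∧ t ≠ z} := by
  obtain ⟨⟨a, ha⟩, hw, hu, hz, hcl, t, ht⟩ := h
  refine ⟨⟨t, ht⟩, by simp, by simp, by simp, ?_, a, by simp [ha], fun e => hw (e ▸ ha),
    fun e => hu (e ▸ ha), fun e => hz (e ▸ ha)⟩
  rintro x ⟨hx, h1, h2, h3⟩ b hxb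
  by_contra hcon
  push Not at hcon
  obtain ⟨hb, h4, h5, h6⟩ := hcon
  have hbA : b ∈ A := by
    by_contra hbA
    exact hb ⟨hbA, h4, h5, h6⟩
  rcases hcl b hbA x hxb.symm with h | h | h | h
  · exact hx h
  · exact h1 h
  · exact h2 h
  · exact h3 h

lemma Cut.rot {V : Type*} {G : SimpleGraph V} {w u z : V} {A : Set V} (h : Cut G w u z A) :
    Cut G u z w A := by
  obtain ⟨h1, hw, hu, hz, hcl, t, ht1, ht2, ht3, ht4⟩ := h
  refine ⟨h1, hu, hz, hw, ?_, t, ht1, ht3, ht4, ht2⟩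
  intro a ha b hab
  rcases hcl a ha b hab with h | h | h | h <;> simp [h]

lemma Cut.exists_nbr {V : Type*} {G : SimpleGraph V} {w u z : V} {A : Set V} (h : Cut G w u z A)
    (hs : Sep3 G) : ∃ a ∈ A, G.Adj w a := by
  obtain ⟨h1, hw, hu, hz, hcl, t, ht1, ht2, ht3, ht4⟩ := h
  by_contra hcon
  push Not at hcon
  rcases hs A u z h1 hu hz (by
    intro a ha b hab
    rcases hcl a ha b hab with h | h | h | h
    · exact Or.inl h
    · subst h
      exact absurd hab.symm (hcon a ha)
    · exact Or.inr (Or.inl h)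
    · exact Or.inr (Or.inr h)) t with h | h | h
  · exact ht1 h
  · exact ht3 h
  · exact ht4 h

/-- If contraction destroys 3-connectedness there is a 3-cut through the edge. -/
lemma exists_cut {V : Type*} {G : SimpleGraph V} (hs : Sep3 G) {w u : V} (hwu : G.Adj w u)
    (h : ¬ Sep3 (contr G w u)) : ∃ z A, z ≠ w ∧ z ≠ u ∧ Cut G w u z A := by
  unfold Sep3 at h
  push Not at h
  obtain ⟨A, x, y, hne, hx, hy, hcl, t, htA, htx, hty⟩ := h
  set B : Set V := Subtype.val '' A with hB
  have memB : ∀ a (ha : a ≠ w), a ∈ B ↔ (⟨a, ha⟩ : {x : V // x ≠ w}) ∈ A := by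
    intro a ha
    constructor
    · rintro ⟨b, hb, rfl⟩
      exact hb
    · intro h
      exact ⟨_, h, rfl⟩
  have hwB : w ∉ B := by
    rintro ⟨b, _, hb⟩
    exact b.2 hb
  have hBne : B.Nonempty := hne.image _
  have htB : t.1 ∉ B := fun h => htA ((memB _ t.2).1 h)
  have hxB : x.1 ∉ B := fun h => hx ((memB _ x.2).1 h)
  have hyB : y.1 ∉ B := fun h => hy ((memB _ y.2).1 h)
  have htx' : t.1 ≠ x.1 := fun e => htx (Subtype.ext e)
  have hty' : t.1 ≠ y.1 := fun e => hty (Subtype.ext e)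
  have hclB : ∀ a ∈ B, ∀ b, G.Adj a b → b ∈ B ∨ b = w ∨ b = x.1 ∨ b = y.1 := by
    rintro a ha b hab
    by_cases hbw : b = w
    · exact Or.inr (Or.inl hbw)
    have haw : a ≠ w := fun e => hwB (e ▸ ha)
    rcases hcl ⟨a, haw⟩ ((memB a haw).1 ha) ⟨b, hbw⟩ (contr_adj_of _ _ hab) with h | h | h
    · exact Or.inl ((memB b hbw).2 h)
    · exact Or.inr (Or.inr (Or.inl (congrArg Subtype.val h)))
    · exact Or.inr (Or.inr (Or.inr (congrArg Subtype.val h)))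
  have hclw : ∀ a ∈ B, G.Adj a w → a ≠ u → u ∈ B ∨ u = x.1 ∨ u = y.1 := by
    rintro a ha haw' hau
    have haw : a ≠ w := haw'.ne
    rcases hcl ⟨a, haw⟩ ((memB a haw).1 ha) ⟨u, hwu.ne'⟩
      (((contr_adj_u hwu haw hau).2 (Or.inr haw'.symm)).symm) with h | h | h
    · exact Or.inl ((memB u hwu.ne').2 h)
    · exact Or.inr (Or.inl (congrArg Subtype.val h))
    · exact Or.inr (Or.inr (congrArg Subtype.val h))
  have hclu : u ∈ B → ∀ b, G.Adj w b → b ≠ u → b ∈ B ∨ b = x.1 ∨ b = y.1 := by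
    intro hu b hwb hbu
    have hbw := hwb.ne'
    rcases hcl ⟨u, hwu.ne'⟩ ((memB u hwu.ne').1 hu) ⟨b, hbw⟩
      ((contr_adj_u hwu hbw hbu).2 (Or.inr hwb)) with h | h | h
    · exact Or.inl ((memB b hbw).2 h)
    · exact Or.inr (Or.inl (congrArg Subtype.val h))
    · exact Or.inr (Or.inr (congrArg Subtype.val h))
  by_cases hux : u = x.1
  · by_cases hyu : y.1 = u
    · exfalso
      rcases hs B w u hBne hwB (hux ▸ hxB) (by
        intro a ha b hab
        rcases hclB a ha b hab with h | h | h | h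
        · exact Or.inl h
        · exact Or.inr (Or.inl h)
        · exact Or.inr (Or.inr (h.trans hux.symm))
        · exact Or.inr (Or.inr (h.trans hyu))) t.1 with h | h | h
      · exact htB h
      · exact t.2 h
      · exact htx' (h.trans hux)
    · refine ⟨y.1, B, y.2, hyu, hBne, hwB, hux ▸ hxB, hyB, ?_, t.1, htB, t.2, ?_, hty'⟩
      · intro a ha b hab
        rcases hclB a ha b hab with h | h | h | h
        · exact Or.inl h
        · exact Or.inr (Or.inl h)
        · exact Or.inr (Or.inr (Or.inl (h.trans hux.symm)))
        · exact Or.inr (Or.inr (Or.inr h))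
      · rw [hux]
        exact htx'
  · by_cases huy : u = y.1
    · refine ⟨x.1, B, x.2, fun e => hux e.symm, hBne, hwB, huy ▸ hyB, hxB, ?_, t.1, htB, t.2, ?_,
        htx'⟩
      · intro a ha b hab
        rcases hclB a ha b hab with h | h | h | h
        · exact Or.inl h
        · exact Or.inr (Or.inl h)
        · exact Or.inr (Or.inr (Or.inr h))
        · exact Or.inr (Or.inr (Or.inl (h.trans huy.symm)))
      · rw [huy]
        exact hty'
    · exfalso
      by_cases huB : u ∈ B
      · rcases hs (insert w B) x.1 y.1 ⟨w, Or.inl rfl⟩ (by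
          rintro (h | h)
          · exact x.2 h
          · exact hxB h) (by
          rintro (h | h)
          · exact y.2 h
          · exact hyB h) (by
          rintro a (rfl | ha) b hab
          · by_cases hbu : b = u
            · subst hbu
              exact Or.inl (Or.inr huB)
            · rcases hclu huB b hab hbu with h | h
              · exact Or.inl (Or.inr h)
              · exact Or.inr h
          · rcases hclB a ha b hab with h | h | h
            · exact Or.inl (Or.inr h)
            · exact Or.inl (Or.inl h)
            · exact Or.inr h) t.1 with h | h | h
        · rcases h with h | h
          · exact t.2 h
          · exact htB h
        · exact htx' h
        · exact hty' h
      · rcases hs B x.1 y.1 hBne hxB hyB (by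
          intro a ha b hab
          rcases hclB a ha b hab with h | h | h
          · exact Or.inl h
          · subst h
            rcases hclw a ha hab (fun e => huB (e ▸ ha)) with h | h | h
            · exact absurd h huB
            · exact absurd h hux
            · exact absurd h huy
          · exact Or.inr h) t.1 with h | h | h
        · exact htB h
        · exact htx' h
        · exact hty' h

lemma exists_contractible {V : Type*} [Finite V] {G : SimpleGraph V} (hc : 3 < Nat.card V)
    (hs : Sep3 G) : ∃ w u, G.Adj w u ∧ Sep3 (contr G w u) := by
  by_contra hcon
  push Not at hcon
  have hex : ∃ k, ∃ x y z A, G.Adj x y ∧ Cut G x y z A ∧ A.ncard = k := by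
    have : Nonempty V := (Nat.card_pos_iff.1 (by omega)).1
    obtain ⟨p⟩ := this
    obtain ⟨b, hb, _⟩ := exists_nbr_ne hc hs p p p
    obtain ⟨z, A, _, _, h⟩ := exists_cut hs hb (hcon _ _ hb)
    exact ⟨_, p, b, z, A, hb, h, rfl⟩
  classical
  obtain ⟨x, y, z, A, hxy, hcut, hk⟩ := Nat.find_spec hex
  have hmin := fun m (hm : m < Nat.find hex) => Nat.find_min hex hm
  rw [← hk] at hmin
  obtain ⟨v, hvA, hzv⟩ := hcut.rot.rot.exists_nbr hs
  obtain ⟨t, D, htz, htv, hD⟩ := exists_cut hs hzv (hcon _ _ hzv)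
  have hex2 : ∃ D, Cut G z v t D ∧ x ∉ D ∧ y ∉ D := by
    by_cases h : x ∈ D ∨ y ∈ D
    · refine ⟨_, hD.compl, ?_, ?_⟩
      · rintro ⟨h1, h2, h3, h4⟩
        rcases h with h | h
        · exact h1 h
        · rcases hD.2.2.2.2.1 y h x hxy.symm with h | h | h | h
          · exact h1 h
          · exact h2 h
          · exact h3 h
          · exact h4 h
      · rintro ⟨h1, h2, h3, h4⟩
        rcases h with h | h
        · rcases hD.2.2.2.2.1 x h y hxy with h | h | h | h
          · exact h1 h
          · exact h2 h
          · exact h3 h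
          · exact h4 h
        · exact h1 h
    · push Not at h
      exact ⟨D, hD, h⟩
  obtain ⟨E, hE, hxE, hyE⟩ := hex2
  obtain ⟨q, hqE, hvq⟩ := hE.rot.exists_nbr hs
  have hqA : q ∈ A := by
    rcases hcut.2.2.2.2.1 v hvA q hvq with h | h | h | h
    · exact h
    · exact absurd (h ▸ hqE) hxE
    · exact absurd (h ▸ hqE) hyE
    · exact absurd (h ▸ hqE) hE.2.1
  refine hmin (E ∩ A).ncard (Set.ncard_lt_ncard ⟨Set.inter_subset_right, fun h => ?_⟩
    (Set.toFinite _)) ⟨z, v, t, E ∩ A, hzv, ?_, rfl⟩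
  · exact hE.2.2.1 (h hvA).1
  · obtain ⟨s, hs1, hs2⟩ := hE.2.2.2.2.2
    refine ⟨⟨q, hqE, hqA⟩, fun h => hE.2.1 h.1, fun h => hE.2.2.1 h.1, fun h => hE.2.2.2.1 h.1, ?_,
      s, fun h => hs1 h.1, hs2⟩
    rintro a ⟨haE, haA⟩ b hab
    rcases hE.2.2.2.2.1 a haE b hab with h | h
    · rcases hcut.2.2.2.2.1 a haA b hab with h' | h' | h' | h'
      · exact Or.inl ⟨h, h'⟩
      · exact absurd (h' ▸ h) hxE
      · exact absurd (h' ▸ h) hyE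
      · exact Or.inr (Or.inl h')
    · exact Or.inr h

end K24Paper

namespace K24Paper
open SimpleGraph

/-- `w` has exactly the three neighbours `a, b, c`. -/
def Deg3 {V : Type*} (G : SimpleGraph V) (w a b c : V) : Prop :=
  G.Adj w a ∧ G.Adj w b ∧ G.Adj w c ∧ a ≠ b ∧ a ≠ c ∧ b ≠ c ∧
    ∀ t, G.Adj w t → t = a ∨ t = b ∨ t = c

lemma Deg3.swap {V : Type*} {G : SimpleGraph V} {w a b c : V} (h : Deg3 G w a b c) :
    Deg3 G w a c b := by
  obtain ⟨h1, h2, h3, h4, h5, h6, h7⟩ := h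
  exact ⟨h1, h3, h2, h5, h4, h6.symm, fun t ht => by have := h7 t ht; tauto⟩

lemma Deg3.rot {V : Type*} {G : SimpleGraph V} {w a b c : V} (h : Deg3 G w a b c) :
    Deg3 G w b c a := by
  obtain ⟨h1, h2, h3, h4, h5, h6, h7⟩ := h
  exact ⟨h2, h3, h1, h6, h4.symm, h5.symm, fun t ht => by have := h7 t ht; tauto⟩

lemma Cut.cases {V : Type*} {G : SimpleGraph V} {w u z : V} {A : Set V} (h : Cut G w u z A)
    {a b : V} (ha : a ∈ A) (hab : G.Adj a b) : b ∈ A ∨ b = w ∨ b = u ∨ b = z :=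
  h.2.2.2.2.1 a ha b hab

/-- A cut through `w u₁` where `w` has degree 3 separates the other two neighbours. -/
lemma cut_split {V : Type*} {G : SimpleGraph V} (hs : Sep3 G) {w u1 u2 u3 z : V}
    (hd : Deg3 G w u1 u2 u3) {A : Set V} (h : Cut G w u1 z A) :
    (u2 ∈ A ∧ u3 ∉ A ∧ u3 ≠ z) ∨ (u3 ∈ A ∧ u2 ∉ A ∧ u2 ≠ z) := by
  obtain ⟨a, haA, hwa⟩ := h.exists_nbr hs
  obtain ⟨b, ⟨hb1, hb2, hb3, hb4⟩, hwb⟩ := h.compl.exists_nbr hs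
  obtain ⟨d1, d2, d3, d4, d5, d6, d7⟩ := hd
  have h3 := h.2.2.1
  have h4 := h.2.2.2.1
  rcases d7 a hwa with rfl | rfl | rfl
  · exact absurd haA h3
  · rcases d7 b hwb with rfl | rfl | rfl
    · exact absurd rfl hb3
    · exact absurd haA hb1
    · exact Or.inl ⟨haA, hb1, hb4⟩
  · rcases d7 b hwb with rfl | rfl | rfl
    · exact absurd rfl hb3
    · exact Or.inr ⟨haA, hb1, hb4⟩
    · exact absurd haA hb1

set_option maxHeartbeats 2000000 in
/-- Halin: a vertex of degree three of a 3-connected graph is on a contractible edge. -/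
lemma halin {V : Type*} [Finite V] {G : SimpleGraph V} (hc : 3 < Nat.card V) (hs : Sep3 G)
    {w v1 v2 v3 : V} (hd : Deg3 G w v1 v2 v3) : ∃ u a b, Deg3 G w u a b ∧ Sep3 (contr G w u) := by
  by_contra hcon
  push Not at hcon
  have hex : ∃ k, ∃ a b c z A, Deg3 G w a b c ∧ Cut G w a z A ∧ A.ncard = k := by
    obtain ⟨z, A, _, _, h⟩ := exists_cut hs hd.1 (hcon _ _ _ hd)
    exact ⟨_, v1, v2, v3, z, A, hd, h, rfl⟩
  classical
  obtain ⟨u1, x2, x3, z1, C, hdx, hcut, hk⟩ := Nat.find_spec hex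
  have hmin := fun m (hm : m < Nat.find hex) => Nat.find_min hex hm
  rw [← hk] at hmin
  obtain ⟨u2, u3, hd3, hu2, hu3, hu3z⟩ : ∃ u2 u3, Deg3 G w u1 u2 u3 ∧ u2 ∈ C ∧ u3 ∉ C ∧ u3 ≠ z1 := by
    rcases cut_split hs hdx hcut with h | h
    · exact ⟨x2, x3, hdx, h⟩
    · exact ⟨x3, x2, hdx.swap, h⟩
  clear hdx
  have hd3' := hd3
  obtain ⟨d1, d2, d3, d4, d5, d6, d7⟩ := hd3'
  obtain ⟨z2, C', hz2w, hz2u, hcut', hu1', hu3', hu3z'⟩ : ∃ z2 C', z2 ≠ w ∧ z2 ≠ u2 ∧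
      Cut G w u2 z2 C' ∧ u1 ∈ C' ∧ u3 ∉ C' ∧ u3 ≠ z2 := by
    obtain ⟨z, A, hz, hz', h⟩ := exists_cut hs d2 (hcon _ _ _ hd3.rot)
    rcases cut_split hs hd3.rot h with h' | h'
    · refine ⟨z, _, hz, hz', h.compl, ⟨h'.2.1, d1.ne', d4, h'.2.2⟩, fun hh => hh.1 h'.1, ?_⟩
      intro e
      exact h.2.2.2.1 (e ▸ h'.1)
    · exact ⟨z, A, hz, hz', h, h'⟩
  have hwC := hcut.2.1
  have hu1C := hcut.2.2.1
  have hz1C := hcut.2.2.2.1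
  have hwC' := hcut'.2.1
  have hu2C' := hcut'.2.2.1
  have hz2C' := hcut'.2.2.2.1
  have hz1w : z1 ≠ w := by
    rintro rfl
    rcases hs C z1 u1 hcut.1 hwC hu1C (by
      intro a ha b hab
      have := hcut.cases ha hab
      grind) u3 with h | h | h
    · exact hu3 h
    · exact hu3z h
    · exact d5 h.symm
  have hz1u1 : z1 ≠ u1 := by
    rintro rfl
    rcases hs C z1 w hcut.1 hz1C hwC (by
      intro a ha b hab
      have := hcut.cases ha hab
      grind) u3 with h | h | h
    · exact hu3 h
    · exact hu3z h
    · exact d3.ne' h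
  have ne_of_mem : ∀ {S : Set V} {a b : V}, a ∈ S → b ∉ S → a ≠ b := by
    intro S a b h1 h2 e
    exact h2 (e ▸ h1)
  have d1n := d1.ne
  have d2n := d2.ne
  have d3n := d3.ne
  -- cells with small boundary are empty
  have hcell : ∀ (P : Set V) (x y : V), w ∉ P → w ≠ x → w ≠ y → x ∉ P → y ∉ P →
      (∀ a ∈ P, ∀ b, G.Adj a b → b ∈ P ∨ b = x ∨ b = y) → ∀ a, a ∉ P := by
    intro P x y h1 h2 h3 h4 h5 h6 a ha
    rcases hs P x y ⟨a, ha⟩ h4 h5 h6 w with h | h | h <;> grind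
  have hwn : ∀ a, G.Adj a w → a = u1 ∨ a = u2 ∨ a = u3 := fun a ha => d7 a ha.symm
  by_cases hab : (z1 ∉ C' ∧ z1 ≠ z2) ∧ z2 ∈ C
  · obtain ⟨⟨ha1, ha2⟩, ha3⟩ := hab
    have hE := hcell {t | t ∉ C ∧ t ≠ u1 ∧ t ∈ C'} u1 u1 (by simp [hwC']) d1n d1n (by simp)
      (by simp) (by
      rintro a ⟨haC, hau, haC'⟩ b hb
      have e1 := hcut'.cases haC' hb
      have e2 : b ∉ C ∨ a = z1 ∨ a = w := by
        by_contra hcon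
        push Not at hcon
        have := hcut.cases hcon.1 hb.symm
        grind
      have e3 : a ≠ z1 := fun e => ha1 (e ▸ haC')
      have e4 : a ≠ w := fun e => hwC' (e ▸ haC')
      have e5 : b ∉ C := by grind
      by_cases hbu : b = u1
      · exact Or.inr (Or.inl hbu)
      rcases e1 with e | e | e | e
      · exact Or.inl ⟨e5, hbu, e⟩
      · subst e
        rcases hwn a hb with rfl | rfl | rfl <;> grind
      · exact absurd hu2 (e ▸ e5)
      · exact absurd ha3 (e ▸ e5))
    have s1 : C' ⊆ insert u1 (C ∩ C') := by
      intro t ht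
      have := hE t
      simp only [Set.mem_ofPred_eq] at this
      by_cases h : t = u1
      · exact Or.inl h
      · exact Or.inr ⟨by grind, ht⟩
    have s2 : insert u2 (insert z2 (C ∩ C')) ⊆ C := by
      rintro t (rfl | rfl | ⟨h, _⟩) <;> assumption
    have c1 := Set.ncard_le_ncard s1 (Set.toFinite _)
    have c2 := Set.ncard_le_ncard s2 (Set.toFinite _)
    have c3 := Set.ncard_insert_le u1 (C ∩ C')
    rw [Set.ncard_insert_of_notMem (by
        rintro (h | h)
        · exact hz2u h.symm
        · exact hu2C' h.2) (Set.toFinite _),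
      Set.ncard_insert_of_notMem (fun h => hz2C' h.2) (Set.toFinite _)] at c2
    exact hmin C'.ncard (by omega) ⟨u2, u3, u1, z2, C', hd3.rot, hcut', rfl⟩
  · have hz21 : z2 ≠ u1 := fun e => hz2C' (e ▸ hu1')
    have hz1u2 : z1 ≠ u2 := fun e => hz1C (e ▸ hu2)
    -- C ∩ D' is empty
    have hE : ∀ a, ¬ (a ∈ C ∧ a ∉ C' ∧ a ≠ u2 ∧ a ≠ z2) := by
      have gen : ∀ a b, (a ∈ C ∧ a ∉ C' ∧ a ≠ u2 ∧ a ≠ z2) → G.Adj a b →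
          (b ∈ C ∧ b ∉ C' ∧ b ≠ u2 ∧ b ≠ z2) ∨ b = u2 ∨ (b = z2 ∧ (b ∈ C ∨ b = z1)) ∨
            (b = z1 ∧ z1 ∉ C' ∧ z1 ≠ z2) := by
        rintro a b ⟨haC, haC', hau, haz⟩ hb
        have e1 := hcut.cases haC hb
        have e2 : b ∉ C' := by
          intro hb'
          have := hcut'.cases hb' hb.symm
          rcases this with h | rfl | h | h <;> grind
        rcases e1 with e | rfl | rfl | rfl
        · grind
        · rcases hwn a hb with rfl | rfl | rfl <;> grind
        · grind
        · grind
      by_cases hz : z1 ∉ C' ∧ z1 ≠ z2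
      · have hz2C : z2 ∉ C := by grind
        refine hcell {a | a ∈ C ∧ a ∉ C' ∧ a ≠ u2 ∧ a ≠ z2} u2 z1 (by simp [hwC]) d2n hz1w.symm
          (by simp) (by simp [hz1C]) ?_
        intro a ha b hb
        rcases gen a b ha hb with h | h | ⟨h, h'⟩ | h
        · exact Or.inl h
        · exact Or.inr (Or.inl h)
        · subst h
          grind
        · exact Or.inr (Or.inr h.1)
      · refine hcell {a | a ∈ C ∧ a ∉ C' ∧ a ≠ u2 ∧ a ≠ z2} u2 z2 (by simp [hwC]) d2n hz2w.symm
          (by simp) (by simp) ?_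
        intro a ha b hb
        rcases gen a b ha hb with h | h | ⟨h, h'⟩ | h
        · exact Or.inl h
        · exact Or.inr (Or.inl h)
        · exact Or.inr (Or.inr h)
        · grind
    obtain ⟨b, ⟨hb1, hb2, hb3, hb4⟩, hub⟩ := hcut'.compl.rot.exists_nbr hs
    have hbz1 : b = z1 := by
      rcases hcut.cases hu2 hub with h | h | h | h
      · exact absurd ⟨h, hb1, hb3, hb4⟩ (hE b)
      · exact absurd h hb2
      · exact absurd (h ▸ hu1') hb1
      · exact h
    subst hbz1
    have hz2C : z2 ∉ C := by grind
    have hE2 := hcell {a | a ∈ C ∧ a ∈ C'} u1 u2 (by simp [hwC]) d1n d2n (by simp [hu1C])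
      (by simp [hu2C']) (by
      rintro a ⟨haC, haC'⟩ t hb
      have e1 := hcut.cases haC hb
      have e2 := hcut'.cases haC' hb
      rcases e1 with e | rfl | rfl | rfl
      · rcases e2 with e' | rfl | rfl | rfl
        · exact Or.inl ⟨e, e'⟩
        · grind
        · grind
        · grind
      · rcases hwn a hb with rfl | rfl | rfl <;> grind
      · grind
      · grind)
    have hCs : ∀ a ∈ C, a = u2 := by
      intro a ha
      have h1 := hE a
      have h2 := hE2 a
      simp only [Set.mem_ofPred_eq] at h2
      by_contra hne
      have : a = z2 := by grind
      exact hz2C (this ▸ ha)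
    have h21 : G.Adj u2 u1 := by
      obtain ⟨t, ht, ht1, ht2⟩ := exists_nbr_ne hc hs u2 w b
      rcases hcut.cases hu2 ht with h | h | h | h
      · exact absurd (hCs t h) ht.ne'
      · grind
      · exact h ▸ ht
      · grind
    obtain ⟨z3, A, _, _, h⟩ := exists_cut hs d3 (hcon _ _ _ hd3.rot.rot)
    rcases cut_split hs hd3.rot.rot h with ⟨h1, h2, h3⟩ | ⟨h1, h2, h3⟩
    · rcases h.cases h1 h21.symm with h | h | h | h <;> grind
    · rcases h.cases h1 h21 with h | h | h | h <;> grind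

end K24Paper

namespace K24Paper
open SimpleGraph

/-! ### Labelled graphs -/

/-- Oriented adjacency of the family. -/
def gh (N r s p a b : ℕ) : Prop :=
  b = a + 1 ∨ (a = 0 ∧ N ≤ b + r + 1 ∧ b + 2 ≤ N) ∨ (b + 1 = N ∧ 1 ≤ a ∧ a ≤ s) ∨
    (p = 1 ∧ a = 0 ∧ b + 1 = N)

/-- Adjacency of the graph `G_{N,r,s}` on `0, …, N-1`. -/
def gAdj (N r s p a b : ℕ) : Prop := a ≠ b ∧ (gh N r s p a b ∨ gh N r s p b a)

/-- Parameters of the family. -/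
def GP (N r s p : ℕ) : Prop :=
  (p = 1 ∧ 4 ≤ N ∧ ((r = 1 ∧ s + 3 = N) ∨ (s = 1 ∧ r + 3 = N))) ∨
  (5 ≤ N ∧ p ≤ 1 ∧ 2 ≤ r ∧ 2 ≤ s ∧ r + 3 ≤ N ∧ s + 3 ≤ N ∧ (r + s + 2 = N ∨ r + s + 1 = N))

/-- `G` has the labelling with adjacency relation `f` on `0, …, N-1`. -/
def LabBy {V : Type*} (G : SimpleGraph V) (N : ℕ) (f : ℕ → ℕ → Prop) (l : V → ℕ) : Prop :=
  Function.Injective l ∧ (∀ v, l v < N) ∧ Nat.card V = N ∧ ∀ a b, G.Adj a b ↔ f (l a) (l b)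

/-- Adjacency encoded by the bits of a number, 16 bits per row. -/
def bitAdj (M a b : ℕ) : Prop := M.testBit (16 * a + b) = true

/-- The exceptional graphs. -/
def excs : List (ℕ × ℕ) :=
  [(5, 276707635146073636894),
    (6, 8462609866481485548617784),
    (6, 8462609866481494138814520),
    (6, 27806013276125919639765048),
    (7, 554605600283507761791030526072),
    (7, 3089984171992421901051618132088),
    (7, 554630988297576616566566748238),
    (8, 135001699059822430033165416105574470),
    (8, 135001699059822577611621605409357894)]

/-- `G` is one of the graphs of the theorem. -/
def Good {V : Type*} (G : SimpleGraph V) : Prop :=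
  (∃ N r s p l, GP N r s p ∧ LabBy G N (gAdj N r s p) l) ∨
  ∃ e ∈ excs, ∃ l, LabBy G e.1 (bitAdj e.2) l

lemma LabBy.surj {V : Type*} [Finite V] {G : SimpleGraph V} {N : ℕ} {f : ℕ → ℕ → Prop} {l : V → ℕ}
    (h : LabBy G N f l) (i : ℕ) (hi : i < N) : ∃ v, l v = i := by
  obtain ⟨h1, h2, h3, _⟩ := h
  let g : V → Fin N := fun v => ⟨l v, h2 v⟩
  have hg : Function.Injective g := fun a b e => h1 (congrArg Fin.val e)
  have hb : Function.Bijective g := (Nat.bijective_iff_injective_and_card g).2 ⟨hg, by simpa using h3⟩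
  obtain ⟨v, hv⟩ := hb.2 ⟨i, hi⟩
  exact ⟨v, congrArg Fin.val hv⟩

lemma gAdj_symm {N r s p a b : ℕ} : gAdj N r s p a b ↔ gAdj N r s p b a := by
  unfold gAdj
  constructor <;> rintro ⟨h1, h2⟩ <;> exact ⟨h1.symm, h2.symm⟩

lemma GP.swap {N r s p : ℕ} (h : GP N r s p) : GP N s r p := by
  unfold GP at *
  omega

lemma LabBy.comp {V : Type*} {G : SimpleGraph V} {N : ℕ} {f : ℕ → ℕ → Prop} {l : V → ℕ}
    (h : LabBy G N f l) (f' : ℕ → ℕ → Prop) (σ : ℕ → ℕ)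
    (hinj : ∀ a b, a < N → b < N → σ a = σ b → a = b) (hlt : ∀ a, a < N → σ a < N)
    (hf : ∀ a b, a < N → b < N → (f a b ↔ f' (σ a) (σ b))) : LabBy G N f' (fun v => σ (l v)) :=
  ⟨fun a b e => h.1 (hinj _ _ (h.2.1 a) (h.2.1 b) e), fun v => hlt _ (h.2.1 v), h.2.2.1,
    fun a b => (h.2.2.2 a b).trans (hf _ _ (h.2.1 a) (h.2.1 b))⟩

lemma gAdj_rev {N r s p a b : ℕ} (ha : a < N) (hb : b < N) :
    gAdj N r s p a b ↔ gAdj N s r p (N - 1 - a) (N - 1 - b) := by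
  obtain ⟨a', ha'⟩ : ∃ a', a' = N - 1 - a := ⟨_, rfl⟩
  obtain ⟨b', hb'⟩ : ∃ b', b' = N - 1 - b := ⟨_, rfl⟩
  rw [← ha', ← hb']
  have e1 : gh N r s p a b ↔ gh N s r p b' a' := by
    unfold gh
    omega
  have e2 : gh N r s p b a ↔ gh N s r p a' b' := by
    unfold gh
    omega
  unfold gAdj
  rw [e1, e2]
  constructor
  · rintro ⟨h1, h2⟩
    exact ⟨by omega, h2.symm⟩
  · rintro ⟨h1, h2⟩
    exact ⟨by omega, h2.symm⟩

lemma LabBy.rev {V : Type*} {G : SimpleGraph V} {N r s p : ℕ} {l : V → ℕ}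
    (h : LabBy G N (gAdj N r s p) l) : LabBy G N (gAdj N s r p) (fun v => N - 1 - l v) := by
  apply h.comp (gAdj N s r p) (fun t => N - 1 - t)
  · intro a b ha hb e
    try dsimp only at e
    omega
  · intro a ha
    omega
  · intro a b ha hb
    exact gAdj_rev ha hb

/-- Rotation of the wheel. -/
lemma LabBy.wheelRot {V : Type*} {G : SimpleGraph V} {N : ℕ} {l : V → ℕ} (hN : 5 ≤ N)
    (h : LabBy G N (gAdj N 1 (N - 3) 1) l) :
    LabBy G N (gAdj N 1 (N - 3) 1)
      (fun v => if l v + 1 = N then l v else if l v + 2 = N then 0 else l v + 1) := by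
  apply h.comp (gAdj N 1 (N - 3) 1) (fun t => if t + 1 = N then t else if t + 2 = N then 0 else t + 1)
  · intro a b ha hb e
    try dsimp only at e
    grind
  · intro a ha
    grind
  · intro a b ha hb
    try dsimp only
    unfold gAdj gh
    grind

lemma lift_arith {N r s p i a b : ℕ} (ha : a < N) (hb : b < N) (hai : a ≠ i) (hbi : b ≠ i)
    (hi : 1 ≤ i) (his : i ≤ s) (hir : i + r + 1 < N) (hs : s + 3 ≤ N) :
    gh N r s p a b ↔ gh (N + 1) r (s + 1) p (if a < i then a else a + 1)
      (if b < i then b else b + 1) := by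
  unfold gh
  split_ifs <;> grind
lemma lift_arith2 {N r s p i a  : ℕ} (ha : a < N) (hai : a ≠ i)
    (hi : 1 ≤ i) (his : i ≤ s) (hir : i + r + 1 < N) (hs : s + 3 ≤ N) :
    gAdj (N + 1) r (s + 1) p i (if a < i then a else a + 1) ↔ a + 1 = i ∨ a + 1 = N := by
  unfold gAdj gh
  split_ifs <;> grind
lemma lift_arith3 {N r s p i a  : ℕ} (ha : a < N) (hai : a ≠ i)
    (hi : 1 ≤ i) (his : i ≤ s) (hir : i + r + 1 < N) (hs : s + 3 ≤ N) :
    gAdj (N + 1) r (s + 1) p (i+1) (if a < i then a else a + 1) ↔ a = i + 1 ∨ a + 1 = N := by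
  unfold gAdj gh
  split_ifs <;> grind

open Classical in
/-- Inserting a vertex in a fan. -/
lemma LabBy.lift {V : Type*} [Finite V] {G : SimpleGraph V} {N r s p i : ℕ} {p1 p2 p0 p3 x : V}
    (hd1 : Deg3 G p1 p0 p2 x) (hd2 : Deg3 G p2 p1 p3 x)
    {l : {t : V // t ≠ p1} → ℕ} {k : V → ℕ} (hk : ∀ t (ht : t ≠ p1), k t = l ⟨t, ht⟩)
    (h : LabBy (contr G p1 p2) N (gAdj N r s p) l) (hcard : Nat.card V = N + 1)
    (h2 : k p2 = i) (hx : k x + 1 = N) (hi : 1 ≤ i) (his : i ≤ s) (hir : i + r + 1 < N)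
    (hs : s + 3 ≤ N)
    (A B : ℕ) (hAB : (A = i ∧ B = i + 1 ∧ k p0 + 1 = i ∧ k p3 = i + 1) ∨
      (A = i + 1 ∧ B = i ∧ k p0 = i + 1 ∧ k p3 + 1 = i)) :
    LabBy G (N + 1) (gAdj (N + 1) r (s + 1) p)
      (fun t => if t = p1 then A else if t = p2 then B else if k t < i then k t else k t + 1) := by
  obtain ⟨hinj, hlt, hcd, hadj⟩ := h
  have kinj : ∀ t t', t ≠ p1 → t' ≠ p1 → k t = k t' → t = t' := by
    intro t t' ht ht' e
    rw [hk t ht, hk t' ht'] at e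
    exact congrArg Subtype.val (hinj e)
  have klt : ∀ t, t ≠ p1 → k t < N := by
    intro t ht
    rw [hk t ht]
    exact hlt _
  have h12 : p2 ≠ p1 := hd1.2.1.ne'
  have hx1 : x ≠ p1 := hd1.2.2.1.ne'
  have h01 : p0 ≠ p1 := hd1.1.ne'
  have h31 : p3 ≠ p1 := fun e => hd2.2.2.2.1 e.symm
  have kne : ∀ t, t ≠ p1 → t ≠ p2 → k t ≠ i := fun t ht ht2 e =>
    ht2 (kinj t p2 ht h12 (e.trans h2.symm))
  have adj1 : ∀ t, G.Adj p1 t ↔ t = p0 ∨ t = p2 ∨ t = x := by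
    intro t
    refine ⟨hd1.2.2.2.2.2.2 t, ?_⟩
    rintro (rfl | rfl | rfl)
    · exact hd1.1
    · exact hd1.2.1
    · exact hd1.2.2.1
  have adj2 : ∀ t, G.Adj p2 t ↔ t = p1 ∨ t = p3 ∨ t = x := by
    intro t
    refine ⟨hd2.2.2.2.2.2.2 t, ?_⟩
    rintro (rfl | rfl | rfl)
    · exact hd2.1
    · exact hd2.2.1
    · exact hd2.2.2.1
  -- adjacency of the new vertices with the old ones
  have hA : ∀ t, t ≠ p1 → t ≠ p2 → (G.Adj p1 t ↔ gAdj (N + 1) r (s + 1) p A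
      (if k t < i then k t else k t + 1)) := by
    intro t ht ht2
    have e0 : t = p0 ↔ k t = k p0 := ⟨fun e => e ▸ rfl, kinj t p0 ht h01⟩
    have ex : t = x ↔ k t = k x := ⟨fun e => e ▸ rfl, kinj t x ht hx1⟩
    rw [adj1, e0, ex]
    rcases hAB with ⟨rfl, rfl, q0, q3⟩ | ⟨rfl, rfl, q0, q3⟩
    · rw [lift_arith2 (klt t ht) (kne t ht ht2) hi his hir hs]
      grind
    · rw [lift_arith3 (klt t ht) (kne t ht ht2) hi his hir hs]
      grind
  have hB : ∀ t, t ≠ p1 → t ≠ p2 → (G.Adj p2 t ↔ gAdj (N + 1) r (s + 1) p B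
      (if k t < i then k t else k t + 1)) := by
    intro t ht ht2
    have e0 : t = p3 ↔ k t = k p3 := ⟨fun e => e ▸ rfl, kinj t p3 ht h31⟩
    have ex : t = x ↔ k t = k x := ⟨fun e => e ▸ rfl, kinj t x ht hx1⟩
    rw [adj2, e0, ex]
    rcases hAB with ⟨rfl, rfl, q0, q3⟩ | ⟨rfl, rfl, q0, q3⟩
    · rw [lift_arith3 (klt t ht) (kne t ht ht2) hi his hir hs]
      grind
    · rw [lift_arith2 (klt t ht) (kne t ht ht2) hi his hir hs]
      grind
  have hABadj : gAdj (N + 1) r (s + 1) p A B := by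
    unfold gAdj gh
    omega
  have hadj' : ∀ t t', t ≠ p1 → t' ≠ p1 → t ≠ p2 → t' ≠ p2 → (G.Adj t t' ↔
      gAdj (N + 1) r (s + 1) p (if k t < i then k t else k t + 1)
        (if k t' < i then k t' else k t' + 1)) := by
    intro t t' ht ht' ht2 ht2'
    rw [← contr_adj_iff_of_ne ht ht' ht2 ht2', hadj, ← hk, ← hk]
    unfold gAdj
    rw [lift_arith (klt t ht) (klt t' ht') (kne t ht ht2) (kne t' ht' ht2') hi his hir hs,
      lift_arith (klt t' ht') (klt t ht) (kne t' ht' ht2') (kne t ht ht2) hi his hir hs]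
    have : k t ≠ k t' ↔ (if k t < i then k t else k t + 1) ≠ (if k t' < i then k t' else k t' + 1) := by
      split_ifs <;> omega
    rw [this]
  refine ⟨?_, ?_, hcard, ?_⟩
  · intro t t' e
    dsimp only at e
    clear hA hB hadj' hABadj adj1 adj2 hadj hlt hinj hcd hd1 hd2 hk
    by_cases ht : t = p1
    · by_cases ht' : t' = p1
      · rw [ht, ht']
      · exfalso
        by_cases ht2' : t' = p2
        · simp only [if_true, ht, ht', ht2', h12, if_false] at e
          omega
        · have := kne t' ht' ht2'
          simp only [if_true, ht, ht', ht2', if_false] at e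
          split_ifs at e <;> omega
    · by_cases ht' : t' = p1
      · exfalso
        by_cases ht2 : t = p2
        · simp only [if_true, ht2, ht', h12, if_false] at e
          omega
        · have := kne t ht ht2
          simp only [if_true, ht, ht', ht2, if_false] at e
          split_ifs at e <;> omega
      · by_cases ht2 : t = p2
        · by_cases ht2' : t' = p2
          · rw [ht2, ht2']
          · exfalso
            have := kne t' ht' ht2'
            simp only [if_true, h12, ht', ht2, ht2', if_false] at e
            split_ifs at e <;> omega
        · have := kne t ht ht2
          by_cases ht2' : t' = p2
          · exfalso
            simp only [if_true, h12, ht, ht2, ht2', if_false] at e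
            split_ifs at e <;> omega
          · have := kne t' ht' ht2'
            apply kinj t t' ht ht'
            simp only [ht, ht', ht2, ht2', if_false] at e
            split_ifs at e <;> omega
  · intro t
    dsimp only
    by_cases ht : t = p1
    · simp only [ht, if_true]
      omega
    · have := klt t ht
      simp only [ht, if_false]
      split_ifs <;> omega
  · intro t t'
    dsimp only
    by_cases ht : t = p1
    · subst ht
      by_cases ht' : t' = t
      · subst ht'
        simp [gAdj]
      · by_cases ht2' : t' = p2
        · subst ht2'
          simp only [if_true, ht', if_false]
          exact ⟨fun _ => hABadj, fun _ => hd1.2.1⟩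
        · simp only [if_true, ht', ht2', if_false]
          exact hA t' ht' ht2'
    · by_cases ht2 : t = p2
      · subst ht2
        by_cases ht' : t' = p1
        · subst ht'
          simp only [if_true, ht, if_false]
          exact ⟨fun _ => gAdj_symm.1 hABadj, fun _ => hd1.2.1.symm⟩
        · by_cases ht2' : t' = t
          · subst ht2'
            simp [gAdj]
          · simp only [if_true, ht', ht2', ht, if_false]
            exact hB t' ht' ht2'
      · by_cases ht' : t' = p1
        · subst ht'
          simp only [if_true, ht, ht2, if_false]
          rw [gAdj_symm, G.adj_comm]
          exact hA t ht ht2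
        · by_cases ht2' : t' = p2
          · subst ht2'
            simp only [if_true, ht, ht', ht2, if_false]
            rw [gAdj_symm, G.adj_comm]
            exact hB t ht ht2
          · simp only [ht, ht', ht2, ht2', if_false]
            exact hadj' t t' ht ht' ht2 ht2'

lemma Cut.swap {V : Type*} {G : SimpleGraph V} {w u z : V} {A : Set V} (h : Cut G w u z A) :
    Cut G u w z A := by
  obtain ⟨h1, hw, hu, hz, hcl, t, ht1, ht2, ht3, ht4⟩ := h
  refine ⟨h1, hu, hw, hz, ?_, t, ht1, ht3, ht2, ht4⟩
  intro a ha b hab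
  rcases hcl a ha b hab with h | h | h | h <;> simp [h]

/-- A fan edge is contractible. -/
lemma fan_sep3 {V : Type*} {G : SimpleGraph V} (hs : Sep3 G) {p0 p1 p2 p3 x : V}
    (hd1 : Deg3 G p1 p0 p2 x) (hd2 : Deg3 G p2 p1 p3 x) (h3x : G.Adj p3 x) :
    Sep3 (contr G p1 p2) := by
  by_contra hcon
  obtain ⟨z, A, _, _, hcut⟩ := exists_cut hs hd1.2.1 hcon
  have e1 := cut_split hs hd1.rot hcut
  have e2 := cut_split hs hd2 hcut.swap
  have hx1 := hd1.2.2.1.ne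
  have hx2 := hd2.2.2.1.ne
  have h32 := hd2.2.1.ne
  have h31 := hd2.2.2.2.1
  rcases e2 with ⟨a1, a2, a3⟩ | ⟨a1, a2, a3⟩
  · rcases hcut.cases a1 h3x with h | h | h | h
    · exact a2 h
    · exact hx1 h.symm
    · exact hx2 h.symm
    · exact a3 h
  · rcases hcut.cases a1 h3x.symm with h | h | h | h
    · exact a2 h
    · exact h31 h.symm
    · exact h32 h.symm
    · exact a3 h

/-- The number of neighbours is bounded by the number of neighbouring labels. -/
lemma LabBy.deg_le {V : Type*} {G : SimpleGraph V} {N : ℕ} {f : ℕ → ℕ → Prop}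
    {l : V → ℕ} (h : LabBy G N f l) (x : V) (F : Finset ℕ) (hF : ∀ j, j < N → f (l x) j → j ∈ F) :
    {t | G.Adj x t}.ncard ≤ F.card := by
  have : (l '' {t | G.Adj x t}).ncard = {t | G.Adj x t}.ncard :=
    Set.ncard_image_of_injective _ h.1
  rw [← this, ← Set.ncard_coe_finset]
  apply Set.ncard_le_ncard _ (Finset.finite_toSet F)
  rintro _ ⟨t, ht, rfl⟩
  exact hF _ (h.2.1 t) ((h.2.2.2 x t).1 ht)

/-- Exceptional graphs have maximum degree at most 4. -/
lemma exc_deg {e : ℕ × ℕ} (he : e ∈ excs) (i : ℕ) (hi : i < e.1) :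
    ((Finset.range e.1).filter (fun j => e.2.testBit (16 * i + j) = true)).card ≤ 4 := by
  have : ∀ e ∈ excs, ∀ i < e.1,
      ((Finset.range e.1).filter (fun j => e.2.testBit (16 * i + j) = true)).card ≤ 4 := by
    decide +kernel
  exact this e he i hi

end K24Paper

namespace K24Paper
open SimpleGraph

universe u

lemma fan_core {V : Type*} [Finite V] {G : SimpleGraph V} {N r s p : ℕ} {p1 p2 p0 p3 x : V}
    (hP : GP N r s p) (hd1 : Deg3 G p1 p0 p2 x) (hd2 : Deg3 G p2 p1 p3 x) (h03 : p0 ≠ p3)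
    (hn : ¬ G.Adj p0 p3)
    {l : {t : V // t ≠ p1} → ℕ} (h : LabBy (contr G p1 p2) N (gAdj N r s p) l)
    (hcard : Nat.card V = N + 1) (hx1 : x ≠ p1) (hx : l ⟨x, hx1⟩ + 1 = N)
    (hdeg : 5 ≤ {t | (contr G p1 p2).Adj ⟨x, hx1⟩ t}.ncard) : Good G := by
  classical
  have hs3 : 3 ≤ s := by
    by_contra hcon
    have := h.deg_le ⟨x, hx1⟩ {1, 2, N - 2, 0} (by
      intro j hj hf
      simp only [Finset.mem_insert, Finset.mem_singleton]
      unfold gAdj gh at hf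
      omega)
    have h4 := Finset.card_le_four (a := 1) (b := 2) (c := N - 2) (d := 0)
    omega
  have h12 : p2 ≠ p1 := hd1.2.1.ne'
  have h01 : p0 ≠ p1 := hd1.1.ne'
  have h31 : p3 ≠ p1 := fun e => hd2.2.2.2.1 e.symm
  have h02 : p0 ≠ p2 := hd1.2.2.2.1
  have h32 : p3 ≠ p2 := hd2.2.1.ne'
  have hx2 : x ≠ p2 := hd2.2.2.1.ne'
  have coreA : ∀ (r s p : ℕ) (l : {t : V // t ≠ p1} → ℕ),
      LabBy (contr G p1 p2) N (gAdj N r s p) l → GP N r s p → 3 ≤ s → l ⟨x, hx1⟩ + 1 = N →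
      1 ≤ l ⟨p2, h12⟩ → l ⟨p2, h12⟩ ≤ s → l ⟨p2, h12⟩ + r + 1 < N → Good G := by
    intro r s p l h hP hs3 hx hi his hir
    have hsN : s + 3 ≤ N := by
      unfold GP at hP
      omega
    have mem : ∀ j, j < N → gAdj N r s p (l ⟨p2, h12⟩) j → j + 1 ≠ N →
        j = l ⟨p0, h01⟩ ∨ j = l ⟨p3, h31⟩ := by
      intro j hj hf hjN
      obtain ⟨⟨t, ht⟩, rfl⟩ := h.surj j hj
      have hf' := (h.2.2.2 _ _).2 hf
      have ht2 : t ≠ p2 := by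
        rintro rfl
        exact hf'.ne rfl
      rw [contr_adj_u hd1.2.1 ht ht2] at hf'
      have : t = p0 ∨ t = p3 ∨ t = x := by
        rcases hf' with h | h
        · rcases hd2.2.2.2.2.2.2 t h with h | h | h
          · exact absurd h ht
          · exact Or.inr (Or.inl h)
          · exact Or.inr (Or.inr h)
        · rcases hd1.2.2.2.2.2.2 t h with h | h | h
          · exact Or.inl h
          · exact absurd h ht2
          · exact Or.inr (Or.inr h)
      rcases this with rfl | rfl | rfl
      · exact Or.inl rfl
      · exact Or.inr rfl
      · exact absurd hx hjN
    have m1 := mem (l ⟨p2, h12⟩ - 1) (by omega) (by unfold gAdj gh; omega) (by omega)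
    have m2 := mem (l ⟨p2, h12⟩ + 1) (by omega) (by unfold gAdj gh; omega) (by omega)
    let k : V → ℕ := fun t => if ht : t = p1 then N else l ⟨t, ht⟩
    have hk : ∀ t (ht : t ≠ p1), k t = l ⟨t, ht⟩ := fun t ht => dif_neg ht
    have k0 := hk p0 h01
    have k3 := hk p3 h31
    have kx := hk x hx1
    have hG' : GP (N + 1) r (s + 1) p := by
      unfold GP at *
      omega
    left
    have hcases : (k p0 + 1 = l ⟨p2, h12⟩ ∧ k p3 = l ⟨p2, h12⟩ + 1) ∨
      (k p0 = l ⟨p2, h12⟩ + 1 ∧ k p3 + 1 = l ⟨p2, h12⟩) := by omega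
    rcases hcases with hc | hc
    · exact ⟨_, _, _, _, _, hG', LabBy.lift hd1 hd2 hk h hcard (hk p2 h12) (by omega) hi his hir hsN
        _ _ (Or.inl ⟨rfl, rfl, hc⟩)⟩
    · exact ⟨_, _, _, _, _, hG', LabBy.lift hd1 hd2 hk h hcard (hk p2 h12) (by omega) hi his hir hsN
        _ _ (Or.inr ⟨rfl, rfl, hc⟩)⟩
  by_cases hgood : 1 ≤ l ⟨p2, h12⟩ ∧ l ⟨p2, h12⟩ ≤ s ∧ l ⟨p2, h12⟩ + r + 1 < N
  · exact coreA r s p l h hP hs3 hx hgood.1 hgood.2.1 hgood.2.2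
  -- wheel case
  have mem : ∀ j, j < N → gAdj N r s p (l ⟨p2, h12⟩) j →
      j = l ⟨p0, h01⟩ ∨ j = l ⟨p3, h31⟩ ∨ j + 1 = N := by
    intro j hj hf
    obtain ⟨⟨t, ht⟩, rfl⟩ := h.surj j hj
    have hf' := (h.2.2.2 _ _).2 hf
    have ht2 : t ≠ p2 := by
      rintro rfl
      exact hf'.ne rfl
    rw [contr_adj_u hd1.2.1 ht ht2] at hf'
    have : t = p0 ∨ t = p3 ∨ t = x := by
      rcases hf' with h | h
      · rcases hd2.2.2.2.2.2.2 t h with h | h | h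
        · exact absurd h ht
        · exact Or.inr (Or.inl h)
        · exact Or.inr (Or.inr h)
      · rcases hd1.2.2.2.2.2.2 t h with h | h | h
        · exact Or.inl h
        · exact absurd h ht2
        · exact Or.inr (Or.inr h)
    rcases this with rfl | rfl | rfl
    · exact Or.inl rfl
    · exact Or.inr (Or.inl rfl)
    · exact Or.inr (Or.inr hx)
  have hN6 : 6 ≤ N := by
    unfold GP at hP
    omega
  have hlt := h.2.1 ⟨p2, h12⟩
  have hne : l ⟨p2, h12⟩ + 1 ≠ N := by
    intro e
    exact hx2 (congrArg Subtype.val (h.1 (show l ⟨x, hx1⟩ = l ⟨p2, h12⟩ by omega)))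
  have hadjx : gAdj N r s p (l ⟨p2, h12⟩) (N - 1) := by
    have := (h.2.2.2 ⟨p2, h12⟩ ⟨x, hx1⟩).1 (contr_adj_of _ _ hd2.2.2.1)
    have e : l ⟨x, hx1⟩ = N - 1 := by omega
    rwa [e] at this
  have hnot : ¬ gAdj N r s p (l ⟨p0, h01⟩) (l ⟨p3, h31⟩) := by
    rw [← h.2.2.2, contr_adj_iff_of_ne h01 h31 h02 h32]
    exact hn
  have hnot' : ¬ gAdj N r s p (l ⟨p3, h31⟩) (l ⟨p0, h01⟩) := by
    rwa [gAdj_symm]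
  have hwheel : r = 1 ∧ s = N - 3 ∧ p = 1 ∧ (l ⟨p2, h12⟩ = 0 ∨ l ⟨p2, h12⟩ + 2 = N) := by
    obtain ⟨i, hi⟩ : ∃ i, i = l ⟨p2, h12⟩ := ⟨_, rfl⟩
    obtain ⟨a, ha⟩ : ∃ a, a = l ⟨p0, h01⟩ := ⟨_, rfl⟩
    obtain ⟨b, hb⟩ : ∃ b, b = l ⟨p3, h31⟩ := ⟨_, rfl⟩
    rw [← hi] at hgood hlt hne hadjx mem ⊢
    rw [← ha] at hnot hnot' mem
    rw [← hb] at hnot hnot' mem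
    clear hi ha hb coreA h hdeg hd1 hd2
    have hcs : i = 0 ∨ i + 2 = N ∨ (1 ≤ i ∧ i ≤ s) := by
      unfold gAdj gh at hadjx
      unfold GP at hP
      omega
    rcases hcs with rfl | hi | hi
    · have hp : p = 1 := by
        unfold gAdj gh at hadjx
        omega
      have q1 := mem 1 (by omega) (by unfold gAdj gh; omega)
      have q2 := mem (N - 2) (by omega) (by unfold gAdj gh; unfold GP at hP; omega)
      by_cases hr : 2 ≤ r
      · have q3 := mem (N - 3) (by omega) (by unfold gAdj gh; omega)
        omega
      · unfold GP at hP
        omega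
    · have q1 := mem 0 (by omega) (by unfold gAdj gh; unfold GP at hP; omega)
      have q2 := mem (N - 3) (by omega) (by unfold gAdj gh; omega)
      by_cases hr : 2 ≤ r
      · exfalso
        have q3 : gAdj N r s p 0 (N - 3) := by
          unfold gAdj gh
          omega
        rcases q1 with q1 | q1 | q1
        · rcases q2 with q2 | q2 | q2
          · omega
          · rw [q1, q2] at q3
            exact hnot q3
          · omega
        · rcases q2 with q2 | q2 | q2
          · rw [q1, q2] at q3
            exact hnot' q3
          · omega
          · omega
        · omega
      · unfold GP at hP
        omega
    · exfalso
      have q0 := mem 0 (by omega) (by unfold gAdj gh; unfold GP at hP; omega)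
      have q1 := mem (i - 1) (by omega) (by unfold gAdj gh; omega)
      have q2 := mem (i + 1) (by omega) (by unfold gAdj gh; unfold GP at hP; omega)
      unfold GP at hP
      omega
  obtain ⟨rfl, rfl, rfl, hw⟩ := hwheel
  have hr1 := h.wheelRot (by omega)
  have hr2 := hr1.wheelRot (by omega)
  rcases hw with hw | hw
  · refine coreA _ _ _ _ hr1 hP hs3 ?_ ?_ ?_ ?_ <;> grind
  · refine coreA _ _ _ _ hr2 hP hs3 ?_ ?_ ?_ ?_ <;> grind

/-- Reduction of a fan. -/
lemma fan_good {V : Type u} [Finite V] {G : SimpleGraph V} {N : ℕ} {p1 p2 p0 p3 x : V}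
    (IH : ∀ (W : Type u) [Finite W] (H : SimpleGraph W), Nat.card W = N → Sep3 H →
      ¬ IsMinor K24 H → Good H)
    (hs : Sep3 G) (hm : ¬ IsMinor K24 G) (hcard : Nat.card V = N + 1)
    (hd1 : Deg3 G p1 p0 p2 x) (hd2 : Deg3 G p2 p1 p3 x) (h03 : p0 ≠ p3) (hn : ¬ G.Adj p0 p3)
    (h3x : G.Adj p3 x) (hdeg : 6 ≤ {t | G.Adj x t}.ncard) : Good G := by
  classical
  have hx1 : x ≠ p1 := hd1.2.2.1.ne'
  have hcard' : Nat.card {t : V // t ≠ p1} = N := by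
    have := Fintype.ofFinite V
    rw [Nat.card_eq_fintype_card] at hcard ⊢
    rw [Fintype.card_subtype_compl, hcard]
    simp
  have hH := IH _ (contr G p1 p2) hcard' (fan_sep3 hs hd1 hd2 h3x)
    (fun h => hm (isMinor_of_contr hd1.2.1 h))
  have hdeg' : 5 ≤ {t | (contr G p1 p2).Adj ⟨x, hx1⟩ t}.ncard := by
    have e1 : {t | G.Adj x t} ⊆ insert p1 (Subtype.val '' {t | (contr G p1 p2).Adj ⟨x, hx1⟩ t}) := by
      intro t ht
      by_cases h : t = p1
      · exact Or.inl h
      · exact Or.inr ⟨⟨t, h⟩, contr_adj_of _ _ ht, rfl⟩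
    have e2 := Set.ncard_le_ncard e1 (Set.toFinite _)
    have e3 := Set.ncard_insert_le p1 (Subtype.val '' {t | (contr G p1 p2).Adj ⟨x, hx1⟩ t})
    have e4 : (Subtype.val '' {t | (contr G p1 p2).Adj ⟨x, hx1⟩ t}).ncard =
      {t | (contr G p1 p2).Adj ⟨x, hx1⟩ t}.ncard :=
      Set.ncard_image_of_injective _ Subtype.val_injective
    omega
  rcases hH with ⟨M, r, s, p, l, hP, hl⟩ | ⟨e, he, l, hl⟩
  · obtain rfl : N = M := by rw [← hcard', hl.2.2.1]
    by_cases hx0 : l ⟨x, hx1⟩ + 1 = N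
    · exact fan_core hP hd1 hd2 h03 hn hl hcard hx1 hx0 hdeg'
    · by_cases hx2 : l ⟨x, hx1⟩ = 0
      · have hlt := hl.2.1 ⟨x, hx1⟩
        exact fan_core hP.swap hd1 hd2 h03 hn hl.rev hcard hx1 (by omega) hdeg'
      · exfalso
        have := hl.deg_le ⟨x, hx1⟩ {l ⟨x, hx1⟩ - 1, l ⟨x, hx1⟩ + 1, 0, N - 1} (by
          intro j hj hf
          simp only [Finset.mem_insert, Finset.mem_singleton]
          unfold gAdj gh at hf
          omega)
        have h4 := Finset.card_le_four (a := l ⟨x, hx1⟩ - 1) (b := l ⟨x, hx1⟩ + 1) (c := 0)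
          (d := N - 1)
        omega
  · exfalso
    have h1 := hl.deg_le ⟨x, hx1⟩ ((Finset.range e.1).filter
      (fun j => e.2.testBit (16 * l ⟨x, hx1⟩ + j) = true)) (fun j hj hf => Finset.mem_filter.2 ⟨Finset.mem_range.2 hj, hf⟩)
    have h2 := exc_deg he _ (hl.2.1 ⟨x, hx1⟩)
    omega

end K24Paper

namespace K24Paper
open SimpleGraph

/-! ### Splitting a vertex -/

/-- Adjacency after splitting off a cubic vertex `N` from `v` with other neighbours `c`, `d`. -/
def spl (f : ℕ → ℕ → Prop) (N v c d : ℕ) (kc kd : Prop) (a b : ℕ) : Prop :=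
  (a = N ∧ (b = v ∨ b = c ∨ b = d)) ∨ (b = N ∧ (a = v ∨ a = c ∨ a = d)) ∨
  (a ≠ N ∧ b ≠ N ∧ f a b ∧ (((a = v ∧ b = c) ∨ (a = c ∧ b = v)) → kc) ∧
    (((a = v ∧ b = d) ∨ (a = d ∧ b = v)) → kd))

lemma spl_far {f : ℕ → ℕ → Prop} {N v c d : ℕ} {kc kd : Prop} {a b : ℕ} (h1 : a ≠ N) (hv : a ≠ v)
    (hc : a ≠ c) (hd : a ≠ d) : spl f N v c d kc kd a b ↔ b ≠ N ∧ f a b := by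
  unfold spl
  grind

lemma spl_nev {f : ℕ → ℕ → Prop} {N v c d : ℕ} {kc kd : Prop} {a b : ℕ} (h1 : a ≠ N) (h2 : b ≠ N)
    (hv : a ≠ v) (hv2 : b ≠ v) : spl f N v c d kc kd a b ↔ f a b := by
  unfold spl
  grind

lemma spl_v {f : ℕ → ℕ → Prop} {N v c d : ℕ} {kc kd : Prop} {b : ℕ} (h1 : v ≠ N) (h2 : b ≠ N)
    (hv : b ≠ c) (hv2 : b ≠ d) (hvc : v ≠ c) (hvd : v ≠ d) :
    spl f N v c d kc kd v b ↔ f v b := by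
  unfold spl
  grind

lemma spl_comm {f : ℕ → ℕ → Prop} {N v c d : ℕ} {kc kd : Prop} {a b : ℕ} :
    spl f N v c d kc kd a b ↔ spl f N v d c kd kc a b := by
  unfold spl
  grind

/-- Labelling of `G` from a labelling of the contraction. -/
lemma split_lab {V : Type*} [Finite V] {G : SimpleGraph V} {N : ℕ} {f : ℕ → ℕ → Prop}
    {w u c d : V} {l : {t : V // t ≠ w} → ℕ} (hd : Deg3 G w u c d)
    (h : LabBy (contr G w u) N f l) (hcard : Nat.card V = N + 1) :
    ∃ k : V → ℕ, LabBy G (N + 1) (spl f N (k u) (k c) (k d) (G.Adj u c) (G.Adj u d)) k ∧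
      k w = N ∧ k u < N ∧ k c < N ∧ k d < N ∧ k u ≠ k c ∧ k u ≠ k d ∧ k c ≠ k d ∧
      f (k u) (k c) ∧ f (k u) (k d) := by
  classical
  obtain ⟨h1, h2, h3, h4⟩ := h
  obtain ⟨wu, wc, wd, uc, ud, cd, hw⟩ := hd
  set k : V → ℕ := fun t => if ht : t = w then N else l ⟨t, ht⟩ with hk
  have kw : k w = N := by simp [hk]
  have kn : ∀ t (ht : t ≠ w), k t = l ⟨t, ht⟩ := fun t ht => by simp [hk, ht]
  have klt : ∀ t, t ≠ w → k t < N := fun t ht => by rw [kn t ht]; exact h2 _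
  have kinj : Function.Injective k := by
    intro a b e
    by_cases ha : a = w
    · by_cases hb : b = w
      · rw [ha, hb]
      · have := klt b hb
        rw [← e, ha, kw] at this
        omega
    · by_cases hb : b = w
      · have := klt a ha
        rw [e, hb, kw] at this
        omega
      · rw [kn a ha, kn b hb] at e
        exact congrArg Subtype.val (h1 e)
  have kadj : ∀ a b (ha : a ≠ w) (hb : b ≠ w), (contr G w u).Adj ⟨a, ha⟩ ⟨b, hb⟩ ↔ f (k a) (k b) := by
    intro a b ha hb
    rw [h4, kn a ha, kn b hb]
  have ku := klt u wu.ne'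
  have kc := klt c wc.ne'
  have kd := klt d wd.ne'
  have main1 : ∀ b, b ≠ w → b ≠ u → (f (k u) (k b) ↔ G.Adj u b ∨ b = c ∨ b = d) := by
    intro b hb hbu
    rw [← kadj u b wu.ne' hb, contr_adj_u wu hb hbu]
    constructor
    · rintro (h | h)
      · exact Or.inl h
      · rcases hw b h with h | h | h
        · exact absurd h hbu
        · exact Or.inr (Or.inl h)
        · exact Or.inr (Or.inr h)
    · rintro (h | rfl | rfl)
      · exact Or.inl h
      · exact Or.inr wc
      · exact Or.inr wd
  have main2 : ∀ b, b ≠ w → b ≠ u → (f (k b) (k u) ↔ G.Adj u b ∨ b = c ∨ b = d) := by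
    intro b hb hbu
    rw [← main1 b hb hbu, ← kadj u b wu.ne' hb, ← kadj b u hb wu.ne', adj_comm]
  refine ⟨k, ⟨kinj, ?_, hcard, ?_⟩, kw, ku, kc, kd, fun e => uc (kinj e), fun e => ud (kinj e),
    fun e => cd (kinj e), (main1 c wc.ne' uc.symm).2 (Or.inr (Or.inl rfl)),
    (main1 d wd.ne' ud.symm).2 (Or.inr (Or.inr rfl))⟩
  · intro t
    by_cases ht : t = w
    · rw [ht, kw]
      omega
    · have := klt t ht
      omega
  · have ww : ∀ t, G.Adj w t ↔ (t = u ∨ t = c ∨ t = d) := fun t =>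
      ⟨hw t, by rintro (rfl | rfl | rfl) <;> assumption⟩
    have keq : ∀ a b, k a = k b ↔ a = b := fun a b => kinj.eq_iff
    have kN : ∀ a, k a = N ↔ a = w := fun a => by rw [← kw]; exact kinj.eq_iff
    intro a b
    unfold spl
    simp only [keq, kN]
    by_cases ha : a = w
    · subst ha
      rw [ww]
      constructor
      · intro h
        exact Or.inl ⟨rfl, h⟩
      · rintro (h | ⟨h, h'⟩ | h)
        · exact h.2
        · subst h
          exact h'
        · exact absurd kw h.1
    by_cases hb : b = w
    · subst hb
      rw [adj_comm, ww]
      constructor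
      · intro h
        exact Or.inr (Or.inl ⟨rfl, h⟩)
      · rintro (h | ⟨h, h'⟩ | h)
        · exact absurd h.1 ha
        · exact h'
        · exact absurd kw h.2.1
    by_cases hau : a = u
    · subst hau
      by_cases hbu : b = a
      · subst hbu
        have : ¬ f (k b) (k b) := by
          rw [← kadj b b ha ha]
          exact SimpleGraph.irrefl _
        have := G.irrefl (v := b)
        grind
      · have := main1 b hb hbu
        grind
    by_cases hbu : b = u
    · subst hbu
      have := main2 a ha hau
      rw [adj_comm]
      grind
    · rw [← kadj a b ha hb, contr_adj_iff_of_ne ha hb hau hbu]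
      grind

lemma LabBy.deg_ge {V : Type*} [Finite V] {G : SimpleGraph V} {N : ℕ} {f : ℕ → ℕ → Prop}
    {l : V → ℕ} (h : LabBy G N f l) (x : V) (F : Finset ℕ)
    (hF : ∀ j ∈ F, j < N ∧ f (l x) j) : F.card ≤ {t | G.Adj x t}.ncard := by
  have e : (F : Set ℕ) ⊆ l '' {t | G.Adj x t} := by
    intro j hj
    obtain ⟨t, rfl⟩ := h.surj j (hF j hj).1
    exact ⟨t, (h.2.2.2 x t).2 (hF _ hj).2, rfl⟩
  have e1 := Set.ncard_le_ncard e (Set.toFinite _)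
  rw [Set.ncard_coe_finset, Set.ncard_image_of_injective _ h.1] at e1
  exact e1

/-- Existence of a window in the run of the last hub. -/
def Win (s v c d : ℕ) : Prop :=
  6 ≤ s ∧ ∃ a, 1 ≤ a ∧ a + 2 ≤ s ∧ ∀ j, a ≤ j → j ≤ a + 2 → j ≠ v ∧ j ≠ c ∧ j ≠ d

universe u

/-- Induction hypothesis at order `N`. -/
def IHyp (N : ℕ) : Prop :=
  ∀ (W : Type u) [Finite W] (H : SimpleGraph W), Nat.card W = N → Sep3 H →
      ¬ IsMinor K24 H → Good H

lemma gAdj_run {N r s p i j : ℕ} (hi : 1 ≤ i) (his : i ≤ s) (hir : i + r + 1 < N) (hj : j < N) :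
    gAdj N r s p i j ↔ (j + 1 = i ∨ j = i + 1 ∨ j = N - 1) := by
  unfold gAdj gh
  constructor
  · omega
  · intro h
    omega

lemma gAdj_hub {N r s p j : ℕ} (hs : s + 3 ≤ N) (hj : j = N - 2 ∨ (1 ≤ j ∧ j ≤ s)) :
    gAdj N r s p (N - 1) j := by
  unfold gAdj gh
  omega

lemma window_good {V : Type u} [Finite V] {G : SimpleGraph V} {N r s p v c d : ℕ} {kc kd : Prop}
    {k : V → ℕ} (IH : IHyp.{u} N)
    (hs : Sep3 G) (hm : ¬ IsMinor K24 G) (hP : GP N r s p)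
    (h : LabBy G (N + 1) (spl (gAdj N r s p) N v c d kc kd) k)
    (hv : v < N) (hvc : v ≠ c) (hvd : v ≠ d) (hw : Win s v c d) : Good G := by
  classical
  obtain ⟨h6, a, ha, has, hfree⟩ := hw
  have f0 := hfree a le_rfl (by omega)
  have f1 := hfree (a + 1) (by omega) (by omega)
  have f2 := hfree (a + 2) (by omega) (by omega)
  have hsN : s + 3 ≤ N ∧ r + s + 1 ≤ N ∧ 1 ≤ r := by unfold GP at hP; omega
  obtain ⟨p0, e0⟩ := h.surj (a - 1) (by omega)
  obtain ⟨p1, e1⟩ := h.surj a (by omega)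
  obtain ⟨p2, e2⟩ := h.surj (a + 1) (by omega)
  obtain ⟨p3, e3⟩ := h.surj (a + 2) (by omega)
  obtain ⟨x, ex⟩ := h.surj (N - 1) (by omega)
  have hlt := h.2.1
  have A1 : ∀ t, G.Adj p1 t ↔ k t = k p0 ∨ k t = k p2 ∨ k t = k x := by
    intro t
    rw [h.2.2.2, e1, e0, e2, ex, spl_far (by omega) f0.1 f0.2.1 f0.2.2]
    have ht := hlt t
    clear h hfree hm hs hP
    constructor
    · rintro ⟨h1, h2⟩
      rw [gAdj_run ha (by omega) (by omega) (by omega)] at h2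
      omega
    · intro h2
      exact ⟨by omega, (gAdj_run ha (by omega) (by omega) (by omega)).2 (by omega)⟩
  have A2 : ∀ t, G.Adj p2 t ↔ k t = k p1 ∨ k t = k p3 ∨ k t = k x := by
    intro t
    rw [h.2.2.2, e2, e1, e3, ex, spl_far (by omega) f1.1 f1.2.1 f1.2.2]
    have ht := hlt t
    clear h hfree hm hs hP
    constructor
    · rintro ⟨h1, h2⟩
      rw [gAdj_run (by omega) (by omega) (by omega) (by omega)] at h2
      omega
    · intro h2
      exact ⟨by omega, (gAdj_run (by omega) (by omega) (by omega) (by omega)).2 (by omega)⟩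
  have A3 : ∀ t, G.Adj p3 t ↔ k t ≠ N ∧ gAdj N r s p (a + 2) (k t) := by
    intro t
    rw [h.2.2.2, e3, spl_far (by omega) f2.1 f2.2.1 f2.2.2]
  have ne : ∀ {y z : V}, k y ≠ k z → y ≠ z := fun hk e => hk (congrArg k e)
  have eq : ∀ {y z : V}, k y = k z → y = z := fun hk => h.1 hk
  refine fan_good IH hs hm h.2.2.1 (p1 := p1) (p2 := p2) (p0 := p0) (p3 := p3) (x := x) ?_ ?_
    (ne (by omega)) ?_ ?_ ?_
  · exact ⟨(A1 _).2 (Or.inl rfl), (A1 _).2 (Or.inr (Or.inl rfl)), (A1 _).2 (Or.inr (Or.inr rfl)),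
      ne (by omega), ne (by omega), ne (by omega), fun t ht =>
        ((A1 t).1 ht).imp eq (Or.imp eq eq)⟩
  · exact ⟨(A2 _).2 (Or.inl rfl), (A2 _).2 (Or.inr (Or.inl rfl)), (A2 _).2 (Or.inr (Or.inr rfl)),
      ne (by omega), ne (by omega), ne (by omega), fun t ht =>
        ((A2 t).1 ht).imp eq (Or.imp eq eq)⟩
  · intro hadj
    have ht := ((A3 _).1 hadj.symm).2
    rw [e0] at ht
    clear h hfree hm hs hP A1 A2 A3 hadj
    unfold gAdj gh at ht
    omega
  · refine (A3 _).2 ⟨by omega, ?_⟩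
    rw [ex, gAdj_symm]
    exact gAdj_hub hsN.1 (by omega)
  · by_cases hvx : v = N - 1
    · refine le_trans ?_ (h.deg_ge x (insert N ((insert (N - 2) (Finset.Icc 1 s)) \ {c, d})) ?_)
      · rw [Finset.card_insert_of_notMem]
        · have q1 := Finset.le_card_sdiff {c, d} (insert (N - 2) (Finset.Icc 1 s))
          rw [Finset.card_insert_of_notMem (by simp; omega), Nat.card_Icc] at q1
          have q2 := Finset.card_le_two (a := c) (b := d)
          omega
        · simp only [Finset.mem_sdiff, Finset.mem_insert, Finset.mem_Icc]
          omega
      · intro j hj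
        simp only [Finset.mem_sdiff, Finset.mem_insert, Finset.mem_Icc, Finset.mem_singleton] at hj
        rw [ex, ← hvx]
        rcases hj with rfl | hj
        · exact ⟨by omega, Or.inr (Or.inl ⟨rfl, Or.inl rfl⟩)⟩
        · refine ⟨by omega, (spl_v (by omega) (by omega) (by omega) (by omega) hvc hvd).2 ?_⟩
          rw [hvx]
          exact gAdj_hub hsN.1 (by omega)
    · refine le_trans ?_ (h.deg_ge x ((insert (N - 2) (Finset.Icc 1 s)).erase v) ?_)
      · have q1 := Finset.pred_card_le_card_erase (s := insert (N - 2) (Finset.Icc 1 s)) (a := v)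
        rw [Finset.card_insert_of_notMem (by simp; omega), Nat.card_Icc] at q1
        omega
      · intro j hj
        simp only [Finset.mem_erase, Finset.mem_insert, Finset.mem_Icc] at hj
        rw [ex]
        refine ⟨by omega, (spl_nev (by omega) (by omega) (by omega) (by omega)).2 ?_⟩
        exact gAdj_hub hsN.1 (by omega)

/-- Reversal of a split labelling. -/
lemma split_rev {V : Type u} {G : SimpleGraph V} {N r s p v c d : ℕ} {kc kd : Prop} {k : V → ℕ}
    (h : LabBy G (N + 1) (spl (gAdj N r s p) N v c d kc kd) k) (hv : v < N) (hc : c < N)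
    (hd : d < N) :
    LabBy G (N + 1) (spl (gAdj N s r p) N (N - 1 - v) (N - 1 - c) (N - 1 - d) kc kd)
      (fun t => if k t = N then N else N - 1 - k t) := by
  apply h.comp _ (fun t => if t = N then N else N - 1 - t)
  · intro a b ha hb e
    grind
  · intro a ha
    grind
  · intro a b ha hb
    have e : a ≠ N → b ≠ N → (gAdj N r s p a b ↔ gAdj N s r p (N - 1 - a) (N - 1 - b)) := by
      intro h1 h2
      exact gAdj_rev (by omega) (by omega)
    have inj : ∀ x y, x < N → y < N → (N - 1 - x = N - 1 - y ↔ x = y) := by omega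
    unfold spl
    by_cases h1 : a = N
    · subst h1
      by_cases h2 : b = a
      · grind
      · grind
    · by_cases h2 : b = N
      · grind
      · have e1 : N - 1 - a ≠ N := by omega
        have e2 : N - 1 - b ≠ N := by omega
        have e := e h1 h2
        have ha' : a < N := by omega
        have hb' : b < N := by omega
        rw [if_neg h1, if_neg h2]
        simp only [inj a v ha' hv, inj a c ha' hc, inj a d ha' hd,
          inj b v hb' hv, inj b c hb' hc, inj b d hb' hd, e]
        simp only [ne_eq, h1, h2, e1, e2]

/-- For large order there is always a window. -/
lemma exists_win {N r s p v c d : ℕ} (hN : 16 ≤ N) (hP : GP N r s p) (hrs : r ≤ s)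
    (hv : v < N) (hc : c < N) (hd : d < N) (h1 : gAdj N r s p v c) (h2 : gAdj N r s p v d) :
    Win s v c d ∨ Win r (N - 1 - v) (N - 1 - c) (N - 1 - d) := by
  unfold GP at hP
  have W : ∀ a s v c d, 6 ≤ s → 1 ≤ a → a + 2 ≤ s →
      (v < a ∨ a + 2 < v) → (c < a ∨ a + 2 < c) → (d < a ∨ a + 2 < d) → Win s v c d :=
    fun a s v c d h6 ha has p1 p2 p3 => ⟨h6, a, ha, has, fun j _ _ => by omega⟩
  unfold gAdj gh at h1 h2
  by_cases hv1 : v = N - 1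
  · by_cases h9 : 9 ≤ s
    · left
      by_cases g1 : (c < 1 ∨ 3 < c) ∧ (d < 1 ∨ 3 < d)
      · exact W 1 _ _ _ _ (by omega) (by omega) (by omega) (by omega) (by omega) (by omega)
      · by_cases g2 : (c < 4 ∨ 6 < c) ∧ (d < 4 ∨ 6 < d)
        · exact W 4 _ _ _ _ (by omega) (by omega) (by omega) (by omega) (by omega) (by omega)
        · exact W 7 _ _ _ _ (by omega) (by omega) (by omega) (by omega) (by omega) (by omega)
    · right
      exact W 2 _ _ _ _ (by omega) (by omega) (by omega) (by omega) (by omega) (by omega)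
  · by_cases hv0 : v = 0
    · left
      exact W 2 _ _ _ _ (by omega) (by omega) (by omega) (by omega) (by omega) (by omega)
    · by_cases h4 : 4 < v
      · left
        exact W 1 _ _ _ _ (by omega) (by omega) (by omega) (by omega) (by omega) (by omega)
      · by_cases h8 : 8 ≤ s
        · left
          exact W 6 _ _ _ _ (by omega) (by omega) (by omega) (by omega) (by omega) (by omega)
        · right
          exact W 1 _ _ _ _ (by omega) (by omega) (by omega) (by omega) (by omega) (by omega)

end K24Paper

namespace K24Paper
open SimpleGraph

/-! ### Explicit minors -/

lemma ConnSet.single {V : Type*} {G : SimpleGraph V} (x : V) : ConnSet G {x} :=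
  ⟨⟨x, rfl⟩, fun A hA hne _ => by
    obtain ⟨a, ha⟩ := hne
    have : a = x := hA ha
    rintro y rfl
    exact this ▸ ha⟩

lemma ConnSet.insert {V : Type*} {G : SimpleGraph V} {R : Set V} (h : ConnSet G R) {x y : V}
    (hy : y ∈ R) (hxy : G.Adj x y) : ConnSet G (insert x R) := by
  refine ⟨⟨x, Or.inl rfl⟩, fun A hA hne hcl => ?_⟩
  have hyA : (A ∩ R).Nonempty := by
    obtain ⟨a, ha⟩ := hne
    rcases hA ha with h' | h'
    · exact ⟨y, hcl a ha y (Or.inr hy) (h' ▸ hxy), hy⟩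
    · exact ⟨a, ha, h'⟩
  have h1 := h.2 (A ∩ R) Set.inter_subset_right hyA
    (fun a ha b hb hab => ⟨hcl a ha.1 b (Or.inr hb) hab, hb⟩)
  rintro z (rfl | hz)
  · exact hcl y (h1 hy).1 z (Or.inl rfl) hxy.symm
  · exact (h1 hz).1

lemma ConnSet.pair {V : Type*} {G : SimpleGraph V} {x y : V} (h : G.Adj x y) :
    ConnSet G {x, y} := (ConnSet.single y).insert rfl h

lemma inj4 {V : Type*} {a b c d : V} (h1 : a ≠ b) (h2 : a ≠ c) (h3 : a ≠ d) (h4 : b ≠ c)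
    (h5 : b ≠ d) (h6 : c ≠ d) : Function.Injective ![a, b, c, d] := by
  intro i j hij
  fin_cases i <;> fin_cases j <;> simp_all

lemma minor_of_std {V : Type*} {G : SimpleGraph V} {R1 R2 : Set V} (h1 : ConnSet G R1)
    (h2 : ConnSet G R2) (hd : ∀ x ∈ R1, x ∉ R2) (s : Fin 4 → V) (hs : Function.Injective s)
    (hs1 : ∀ i, s i ∉ R1) (hs2 : ∀ i, s i ∉ R2) (ha1 : ∀ i, ∃ x ∈ R1, G.Adj (s i) x)
    (ha2 : ∀ i, ∃ x ∈ R2, G.Adj (s i) x) : IsMinor K24 G := by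
  rw [isMinor_iff]
  set R : Fin 2 → Set V := fun i => if i = 0 then R1 else R2 with hR
  have ha : ∀ i j, ∃ x ∈ R i, G.Adj (s j) x := by
    intro i j
    fin_cases i
    · exact ha1 j
    · exact ha2 j
  have hns : ∀ i j, s j ∉ R i := by
    intro i j
    fin_cases i
    · exact hs1 j
    · exact hs2 j
  refine ⟨fun t => match t with
    | Sum.inl i => R i
    | Sum.inr j => {s j}, ?_, ?_, ?_⟩
  · rintro (i | j)
    · fin_cases i
      · exact h1
      · exact h2
    · exact ConnSet.single _
  · rintro (i | i) (j | j) hne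
    · rw [Set.disjoint_left]
      fin_cases i <;> fin_cases j
      · exact absurd rfl hne
      · exact hd
      · intro x hx hx'
        exact hd x hx' hx
      · exact absurd rfl hne
    · exact Set.disjoint_singleton_right.2 (hns i j)
    · exact Set.disjoint_singleton_left.2 (hns j i)
    · refine Set.disjoint_singleton.2 fun e => hne ?_
      rw [hs e]
  · rintro (i | i) (j | j) hadj
    · simp [K24] at hadj
    · obtain ⟨x, hx, hadj'⟩ := ha i j
      exact ⟨x, hx, s j, rfl, hadj'.symm⟩
    · obtain ⟨x, hx, hadj'⟩ := ha j i
      exact ⟨s i, rfl, x, hx, hadj'⟩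
    · simp [K24] at hadj

/-! ### The finite checker -/

/-- Test a bit of a mask. -/
def tb (M a b : ℕ) : Bool :=
  Nat.beq (Nat.land 1 (Nat.shiftRight M (Nat.add (Nat.mul 16 a) b))) 1

lemma tb_eq (M a b : ℕ) : tb M a b = M.testBit (16 * a + b) := by
  have e : Nat.land 1 (Nat.shiftRight M (Nat.add (Nat.mul 16 a) b)) =
    (M >>> (16 * a + b)) % 2 := by
    have : Nat.land 1 (Nat.shiftRight M (Nat.add (Nat.mul 16 a) b)) = 1 &&& (M >>> (16 * a + b)) := rfl
    rw [this, Nat.land_comm, Nat.and_one_is_mod]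
  unfold tb
  rw [e, Nat.testBit_eq_decide_div_mod_eq, Nat.shiftRight_eq_div_pow]
  by_cases h : M / 2 ^ (16 * a + b) % 2 = 1
  · rw [h]
    rfl
  · have : M / 2 ^ (16 * a + b) % 2 = 0 := by omega
    rw [this]
    rfl

/-- Hexadecimal digits below the leading one. -/
def digs : ℕ → ℕ → List ℕ
  | 0, _ => []
  | k + 1, n => cond (Nat.ble n 15) [] (Nat.mod n 16 :: digs k (Nat.div n 16))

/-- Every vertex of the second list is adjacent to an earlier one. -/
def connB (M : ℕ) : List ℕ → List ℕ → Bool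
  | _, [] => true
  | acc, x :: xs => acc.any (tb M x) && connB M (x :: acc) xs

/-- No repetitions. -/
def ndB : List ℕ → Bool
  | [] => true
  | x :: xs => !(xs.any (Nat.beq x)) && ndB xs

lemma ndB_nodup : ∀ l : List ℕ, ndB l = true → l.Nodup
  | [], _ => List.nodup_nil
  | x :: xs, h => by
    simp only [ndB, Bool.and_eq_true, Bool.not_eq_true', List.any_eq_false] at h
    refine List.nodup_cons.2 ⟨fun hx => h.1 x hx ?_, ndB_nodup xs h.2⟩
    exact Nat.beq_refl x

/-- Check an explicit `K_{2,4}` minor. -/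
def k24B (M n : ℕ) (R1 R2 S : List ℕ) : Bool :=
  match R1, R2, S with
  | x1 :: t1, x2 :: t2, [a, b, c, d] =>
    ([a, b, c, d].all fun x => (x1 :: t1).any (tb M x) && (x2 :: t2).any (tb M x)) &&
    connB M [x1] t1 && connB M [x2] t2 &&
    ndB (a :: b :: c :: d :: x1 :: t1 ++ x2 :: t2) &&
    ((a :: b :: c :: d :: x1 :: t1 ++ x2 :: t2).all fun x => Nat.blt x n)
  | _, _, _ => false

lemma connB_sound {V : Type*} {G : SimpleGraph V} {M n : ℕ} {k : V → ℕ}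
    (hinj : Function.Injective k) (hsurj : ∀ i, i < n → ∃ v, k v = i)
    (hadj : ∀ a b, tb M (k a) (k b) = true → G.Adj a b) :
    ∀ (xs acc : List ℕ), (∀ x ∈ xs, x < n) → (∀ x ∈ acc, x < n) → ConnSet G {v | k v ∈ acc} →
      connB M acc xs = true → ConnSet G {v | k v ∈ xs ++ acc}
  | [], acc, _, _, h, _ => h
  | x :: xs, acc, hlt, hacc, h, hb => by
    simp only [connB, Bool.and_eq_true, List.any_eq_true] at hb
    obtain ⟨⟨y, hy, hxy⟩, hb⟩ := hb
    obtain ⟨v, hv⟩ := hsurj x (hlt x (by simp))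
    obtain ⟨z, hz⟩ := hsurj y (hacc y hy)
    have hins : ConnSet G {v | k v ∈ x :: acc} := by
      subst hz hv
      convert h.insert (x := v) hy (hadj _ _ hxy) using 1
      ext t
      simp [hinj.eq_iff]
    have := connB_sound hinj hsurj hadj xs (x :: acc) (fun t ht => hlt t (by simp [ht]))
      (by
        intro t ht
        rcases List.mem_cons.1 ht with rfl | ht
        · exact hlt _ (by simp)
        · exact hacc _ ht) hins hb
    convert this using 1
    ext t
    simp
    tauto

lemma conn_list {V : Type*} {G : SimpleGraph V} {M n : ℕ} {k : V → ℕ}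
    (hinj : Function.Injective k) (hsurj : ∀ i, i < n → ∃ v, k v = i)
    (hadj : ∀ a b, tb M (k a) (k b) = true → G.Adj a b) (x : ℕ) (t : List ℕ)
    (hlt : ∀ y ∈ x :: t, y < n) (hb : connB M [x] t = true) : ConnSet G {v | k v ∈ x :: t} := by
  obtain ⟨v, hv⟩ := hsurj x (hlt x (by simp))
  have h0 : ConnSet G {v | k v ∈ [x]} := by
    convert ConnSet.single (G := G) v using 1
    ext y
    subst hv
    simp [hinj.eq_iff]
  have := connB_sound hinj hsurj hadj t [x] (fun y hy => hlt y (by simp [hy]))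
    (fun y hy => hlt y (by simp_all)) h0 hb
  convert this using 1
  ext y
  simp
  tauto

lemma k24B_sound {V : Type*} {G : SimpleGraph V} {M n : ℕ} {k : V → ℕ}
    (hinj : Function.Injective k) (hsurj : ∀ i, i < n → ∃ v, k v = i)
    (hadj : ∀ a b, tb M (k a) (k b) = true → G.Adj a b) {R1 R2 S : List ℕ}
    (h : k24B M n R1 R2 S = true) : IsMinor K24 G := by
  unfold k24B at h
  split at h
  · rename_i x1 t1 x2 t2 a b c d
    simp only [Bool.and_eq_true] at h
    obtain ⟨⟨⟨⟨hA, hc1⟩, hc2⟩, hnd⟩, hlt⟩ := h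
    have hnd := ndB_nodup _ hnd
    have hlt : ∀ y ∈ a :: b :: c :: d :: x1 :: t1 ++ x2 :: t2, y < n := fun y hy =>
      Nat.blt_eq.mp (List.all_eq_true.1 hlt y hy)
    have hl1 : ∀ y ∈ x1 :: t1, y < n := fun y hy => hlt y (by simp at hy ⊢; tauto)
    have hl2 : ∀ y ∈ x2 :: t2, y < n := fun y hy => hlt y (by simp at hy ⊢; tauto)
    have hC1 := conn_list hinj hsurj hadj x1 t1 hl1 hc1
    have hC2 := conn_list hinj hsurj hadj x2 t2 hl2 hc2
    obtain ⟨va, rfl⟩ := hsurj a (hlt a (by simp))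
    obtain ⟨vb, rfl⟩ := hsurj b (hlt b (by simp))
    obtain ⟨vc, rfl⟩ := hsurj c (hlt c (by simp))
    obtain ⟨vd, rfl⟩ := hsurj d (hlt d (by simp))
    have hS : ∀ i : Fin 4, k (![va, vb, vc, vd] i) ∈ [k va, k vb, k vc, k vd] := by
      intro i
      fin_cases i <;> simp
    have hnd' : ([k va, k vb, k vc, k vd] ++ ((x1 :: t1) ++ (x2 :: t2))).Nodup := hnd
    rw [List.nodup_append] at hnd'
    obtain ⟨n1, n2, n3⟩ := hnd'
    rw [List.nodup_append] at n2
    have hA' : ∀ i : Fin 4, (x1 :: t1).any (tb M (k (![va, vb, vc, vd] i))) = true ∧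
        (x2 :: t2).any (tb M (k (![va, vb, vc, vd] i))) = true := by
      intro i
      have := List.all_eq_true.1 hA _ (hS i)
      simpa only [Bool.and_eq_true] using this
    refine minor_of_std hC1 hC2 (fun x hx hx' => n2.2.2 _ hx _ hx' rfl) ![va, vb, vc, vd] ?_
      (fun i hi => n3 _ (hS i) _ (List.mem_append_left _ hi) rfl)
      (fun i hi => n3 _ (hS i) _ (List.mem_append_right _ hi) rfl) ?_ ?_
    · have e : ∀ x y : V, k x ≠ k y → x ≠ y := fun x y h e => h (congrArg k e)
      simp only [List.nodup_cons, List.mem_cons, not_or, List.not_mem_nil, not_false_eq_true] at n1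
      obtain ⟨⟨e1, e2, e3, -⟩, ⟨e4, e5, -⟩, ⟨e6, -⟩, -⟩ := n1
      have e1 := e _ _ e1
      have e2 := e _ _ e2
      have e3 := e _ _ e3
      have e4 := e _ _ e4
      have e5 := e _ _ e5
      have e6 := e _ _ e6
      exact inj4 e1 e2 e3 e4 e5 e6
    · intro i
      obtain ⟨y, hy, hyy⟩ := List.any_eq_true.1 (hA' i).1
      obtain ⟨z, rfl⟩ := hsurj y (hl1 y hy)
      exact ⟨z, hy, hadj _ _ hyy⟩
    · intro i
      obtain ⟨y, hy, hyy⟩ := List.any_eq_true.1 (hA' i).2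
      obtain ⟨z, rfl⟩ := hsurj y (hl2 y hy)
      exact ⟨z, hy, hadj _ _ hyy⟩
  · exact absurd h (by simp)

/-- Symmetric pair of bits. -/
def ps (a b : ℕ) : ℕ :=
  Nat.xor (Nat.shiftLeft 1 (Nat.add (Nat.mul 16 a) b)) (Nat.shiftLeft 1 (Nat.add (Nat.mul 16 b) a))

lemma tb_xor_ps (M : ℕ) {a b x y : ℕ} (_ha : a < 16) (hb : b < 16) (hx : x < 16) (hy : y < 16)
    (hxy : x ≠ y) :
    tb (Nat.xor M (ps x y)) a b = (tb M a b ^^ decide ((a = x ∧ b = y) ∨ (a = y ∧ b = x))) := by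
  have e : Nat.xor M (ps x y) = M ^^^ (2 ^ (16 * x + y) ^^^ 2 ^ (16 * y + x)) := by
    have : Nat.xor M (ps x y) = M ^^^ ((1 <<< (16 * x + y)) ^^^ (1 <<< (16 * y + x))) := rfl
    rw [this, Nat.one_shiftLeft, Nat.one_shiftLeft]
  rw [tb_eq, tb_eq, e, Nat.testBit_xor, Nat.testBit_xor, Nat.testBit_two_pow, Nat.testBit_two_pow]
  congr 1
  by_cases h1 : a = x ∧ b = y
  · obtain ⟨rfl, rfl⟩ := h1
    have : ¬ (16 * b + a = 16 * a + b) := by omega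
    simp [this]
  · by_cases h2 : a = y ∧ b = x
    · obtain ⟨rfl, rfl⟩ := h2
      have : ¬ (16 * b + a = 16 * a + b) := by omega
      simp [this]
    · have q1 : ¬ (16 * x + y = 16 * a + b) := by omega
      have q2 : ¬ (16 * y + x = 16 * a + b) := by omega
      simp [h1, h2, q1, q2]

/-- Mask of the split graph. -/
def spm (M N v c d : ℕ) (kc kd : Bool) : ℕ :=
  Nat.xor (Nat.xor (Nat.xor (cond kd (cond kc M (Nat.xor M (ps v c)))
    (Nat.xor (cond kc M (Nat.xor M (ps v c))) (ps v d))) (ps N v)) (ps N c)) (ps N d)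

lemma spm_iff {M N v c d : ℕ} {kc kd : Bool} {f : ℕ → ℕ → Prop} (hN : N ≤ 15) (hv : v < N)
    (hc : c < N) (hd : d < N) (hvc : v ≠ c) (hvd : v ≠ d) (hcd : c ≠ d)
    (hM : ∀ a b, a ≤ N → b ≤ N → (tb M a b = true ↔ a < N ∧ b < N ∧ f a b))
    (hsym : ∀ a b, f a b ↔ f b a)
    (fc : f v c) (fd : f v d) {a b : ℕ} (ha : a ≤ N) (hb : b ≤ N) :
    tb (spm M N v c d kc kd) a b = true ↔ spl f N v c d (kc = true) (kd = true) a b := by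
  classical
  have hM' := hM a b ha hb
  have fc' := (hsym v c).1 fc
  have fd' := (hsym v d).1 fd
  have ha' : a < 16 := by omega
  have hb' : b < 16 := by omega
  have e : ∀ (X x y : ℕ), x ≤ N → y ≤ N → x ≠ y → tb (Nat.xor X (ps x y)) a b =
      (tb X a b ^^ decide ((a = x ∧ b = y) ∨ (a = y ∧ b = x))) := fun X x y hx hy hxy =>
    tb_xor_ps X ha' hb' (by omega) (by omega) hxy
  unfold spm spl
  rw [e _ _ _ le_rfl (by omega) (by omega), e _ _ _ le_rfl (by omega) (by omega),
    e _ _ _ le_rfl (by omega) (by omega)]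
  have hM2 : tb M a b = decide (a < N ∧ b < N ∧ f a b) := by
    by_cases h : tb M a b = true
    · rw [h]
      exact (decide_eq_true (hM'.1 h)).symm
    · have h2 : ¬ (a < N ∧ b < N ∧ f a b) := fun q => h (hM'.2 q)
      rw [Bool.not_eq_true] at h
      rw [h]
      exact (decide_eq_false h2).symm
  have key : ∀ X : Bool, X = decide (a < N ∧ b < N ∧ f a b) →
      (((tb M a b ^^ (!kc && decide ((a = v ∧ b = c) ∨ (a = c ∧ b = v)))) ^^
        (!kd && decide ((a = v ∧ b = d) ∨ (a = d ∧ b = v)))) =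
      decide (a < N ∧ b < N ∧ f a b ∧ (((a = v ∧ b = c) ∨ (a = c ∧ b = v)) → kc = true) ∧
    (((a = v ∧ b = d) ∨ (a = d ∧ b = v)) → kd = true))) := by
    intro X hX
    rw [hM2]
    clear hM hsym e hM2 hX hM'
    by_cases h1 : (a = v ∧ b = c) ∨ (a = c ∧ b = v)
    · have h2 : ¬ ((a = v ∧ b = d) ∨ (a = d ∧ b = v)) := by omega
      have h3 : f a b := by
        rcases h1 with ⟨rfl, rfl⟩ | ⟨rfl, rfl⟩ <;> assumption
      have h4 : a < N ∧ b < N := by omega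
      cases kc <;> simp [h1, h2, h3, h4]
    · by_cases h2 : (a = v ∧ b = d) ∨ (a = d ∧ b = v)
      · have h3 : f a b := by
          rcases h2 with ⟨rfl, rfl⟩ | ⟨rfl, rfl⟩ <;> assumption
        have h4 : a < N ∧ b < N := by omega
        cases kd <;> simp [h1, h2, h3, h4]
      · simp [h1, h2]
  have e2 : tb (cond kd (cond kc M (Nat.xor M (ps v c)))
    (Nat.xor (cond kc M (Nat.xor M (ps v c))) (ps v d))) a b =
    ((tb M a b ^^ (!kc && decide ((a = v ∧ b = c) ∨ (a = c ∧ b = v)))) ^^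
        (!kd && decide ((a = v ∧ b = d) ∨ (a = d ∧ b = v)))) := by
    have e3 := e M v c (by omega) (by omega) hvc
    have e4 := e M v d (by omega) (by omega) hvd
    have e5 := e (Nat.xor M (ps v c)) v d (by omega) (by omega) hvd
    cases kc <;> cases kd <;> simp only [cond_true, cond_false, e3, e4, e5] <;> simp
  rw [e2, key _ rfl]
  clear hM hsym e hM2 hM' key e2
  by_cases h1 : a = N
  · subst h1
    by_cases h2 : b = v
    · subst h2
      have : ¬ a < a := by omega
      have : b ≠ a := by omega
      simp [*]
    · by_cases h3 : b = c
      · subst h3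
        have : b ≠ a := by omega
        simp [*]
      · by_cases h4 : b = d
        · subst h4
          have : b ≠ a := by omega
          simp [*]
        · simp [*, show a ≠ v by omega, show a ≠ c by omega, show a ≠ d by omega]
  · by_cases h2 : b = N
    · subst h2
      by_cases h2 : a = v
      · subst h2
        simp [*]
        try omega
      · by_cases h3 : a = c
        · subst h3
          simp [*]
          try omega
        · by_cases h4 : a = d
          · subst h4
            simp [*]
            try omega
          · simp [*]
            try omega
    · have h3 : a < N := by omega
      have h4 : b < N := by omega
      simp only [h1, h2, h3, h4]
      simp [h1, h2]
      grind

end K24Paper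

namespace K24Paper
open SimpleGraph

/-- Boolean version of `gh`. -/
def ghB (N r s p a b : ℕ) : Bool :=
  Nat.beq b (Nat.succ a) || (Nat.beq a 0 && Nat.ble N (Nat.succ (Nat.add b r)) && Nat.blt (Nat.succ b) N) ||
  (Nat.beq (Nat.succ b) N && ((Nat.ble 1 a && Nat.ble a s) || (Nat.beq p 1 && Nat.beq a 0)))

lemma ghB_iff {N r s p a b : ℕ} : ghB N r s p a b = true ↔ gh N r s p a b := by
  unfold ghB gh
  simp only [Bool.or_eq_true, Bool.and_eq_true, Nat.beq_eq, Nat.ble_eq, Nat.blt_eq,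
    Nat.add_eq, Nat.succ_eq_add_one]
  omega

/-- Boolean version of `gAdj`. -/
def gB (N r s p a b : ℕ) : Bool := !(Nat.beq a b) && (ghB N r s p a b || ghB N r s p b a)

lemma gB_iff {N r s p a b : ℕ} : gB N r s p a b = true ↔ gAdj N r s p a b := by
  unfold gB gAdj
  rw [Bool.and_eq_true, Bool.or_eq_true, ghB_iff, ghB_iff, Bool.not_eq_true', ← Bool.not_eq_true,
    Nat.beq_eq]

/-- Boolean version of `GP`. -/
def gpB (N r s p : ℕ) : Bool :=
  (Nat.beq p 1 && Nat.ble 4 N && ((Nat.beq r 1 && Nat.beq (s + 3) N) ||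
    (Nat.beq s 1 && Nat.beq (r + 3) N))) ||
  (Nat.ble 5 N && Nat.ble p 1 && Nat.ble 2 r && Nat.ble 2 s && Nat.ble (r + 3) N &&
    Nat.ble (s + 3) N && (Nat.beq (r + s + 2) N || Nat.beq (r + s + 1) N))

lemma gpB_iff {N r s p : ℕ} : gpB N r s p = true ↔ GP N r s p := by
  unfold gpB GP
  simp only [Bool.or_eq_true, Bool.and_eq_true, Nat.beq_eq, Nat.ble_eq]
  constructor <;> intro h <;> omega

/-- Value of an encoded permutation. -/
def pv (P i : ℕ) : ℕ := Nat.mod (Nat.shiftRight P (Nat.mul 4 i)) 16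

/-- The adjacency encoded by a target code. -/
def tgt (n t a b : ℕ) : Bool :=
  cond (Nat.beq (Nat.mod t 16) 2) (tb (excs.getD (Nat.div t 256) (0, 0)).2 a b)
    (gB n (Nat.div t 256) (Nat.mod (Nat.div t 16) 16) (Nat.mod t 16) a b)

/-- Validity of a target code. -/
def tgtOK (n t : ℕ) : Bool :=
  cond (Nat.beq (Nat.mod t 16) 2)
    (Nat.blt (Nat.div t 256) 9 && Nat.beq (excs.getD (Nat.div t 256) (0, 0)).1 n)
    (gpB n (Nat.div t 256) (Nat.mod (Nat.div t 16) 16) (Nat.mod t 16))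

/-- Check an explicit isomorphism. -/
def isoB (M n P t : ℕ) : Bool :=
  tgtOK n t && ndB ((List.range n).map (pv P)) &&
  (List.range n).all fun a => Nat.blt (pv P a) n &&
    (List.range n).all fun b => !(tb M a b ^^ tgt n t (pv P a) (pv P b))

lemma isoB_sound {V : Type*} {G : SimpleGraph V} {M n P t : ℕ} {k : V → ℕ}
    (h : LabBy G n (fun a b => tb M a b = true) k) (hb : isoB M n P t = true) : Good G := by
  unfold isoB at hb
  simp only [Bool.and_eq_true, List.all_eq_true, List.mem_range, Bool.not_eq_true',
    bne_eq_false_iff_eq, Nat.blt_eq] at hb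
  obtain ⟨⟨h1, h2⟩, h3⟩ := hb
  have hinj : ∀ a b, a < n → b < n → pv P a = pv P b → a = b := by
    intro a b ha hb e
    have := List.inj_on_of_nodup_map (ndB_nodup _ h2) (List.mem_range.2 ha) (List.mem_range.2 hb) e
    exact this
  have h' : LabBy G n (fun a b => tgt n t a b = true) (fun v => pv P (k v)) :=
    h.comp _ (pv P) hinj (fun a ha => (h3 a ha).1) (fun a b ha hb => by
      have := (h3 a ha).2 b hb
      simp only [this])
  unfold tgtOK at h1
  unfold tgt at h'
  by_cases h5 : Nat.beq (Nat.mod t 16) 2 = true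
  · rw [h5] at h1 h'
    simp only [cond_true, Bool.and_eq_true, Nat.blt_eq, Nat.beq_eq] at h1 h'
    refine Or.inr ⟨excs.getD (Nat.div t 256) (0, 0), ?_, fun v => pv P (k v), ?_⟩
    · rw [List.getD_eq_getElem _ _ (show Nat.div t 256 < excs.length from h1.1)]
      exact List.getElem_mem _
    · rw [h1.2]
      simp only [tb_eq] at h'
      exact h'
  · rw [Bool.not_eq_true] at h5
    rw [h5] at h1 h'
    simp only [cond_false, gB_iff] at h1 h'
    exact Or.inl ⟨n, _, _, _, _, gpB_iff.1 h1, h'⟩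

def winB (s v c d : ℕ) : Bool :=
  Nat.ble 6 s && (List.range s).any fun a => Nat.ble 1 a && Nat.ble (a + 2) s &&
    (Nat.blt v a || Nat.blt (a + 2) v) && (Nat.blt c a || Nat.blt (a + 2) c) &&
    (Nat.blt d a || Nat.blt (a + 2) d)

lemma winB_sound {s v c d : ℕ} (h : winB s v c d = true) : Win s v c d := by
  unfold winB at h
  simp only [Bool.and_eq_true, List.any_eq_true, Bool.or_eq_true, Nat.blt_eq, Nat.ble_eq] at h
  obtain ⟨h6, a, -, ⟨⟨⟨h1, h2⟩, h3⟩, h4⟩, h5⟩ := h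
  exact ⟨h6, a, h1, h2, fun j _ _ => by omega⟩

/-- A vertex of degree at most two. -/
def degB (M N v : ℕ) : Bool :=
  (List.range N).any fun x => (List.range N).all fun t => !(tb M v t) || Nat.beq t x

/-- Search for a minor certificate. -/
def k24A (M n : ℕ) (K : List (ℕ × ℕ × ℕ)) : Bool :=
  K.any fun e => k24B M n (digs 16 e.1) (digs 16 e.2.1) (digs 16 e.2.2)

/-- Check one fully specified split. -/
def flagOK (N M : ℕ) (K I : List (ℕ × ℕ × ℕ)) (v c d : ℕ) (kc kd : Bool) : Bool :=
  (I.any fun e => Nat.beq e.1 (4096 * v + 256 * c + 16 * d + cond kc 1 0 + cond kd 2 0) &&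
    isoB (spm M N v c d kc kd) (N + 1) e.2.1 e.2.2) ||
  k24A (spm M N v c d kc kd) (N + 1) K || degB (spm M N v c d kc kd) N v

/-- Check one splitting. -/
def triOK (N M r s : ℕ) (K I : List (ℕ × ℕ × ℕ)) (v c d : ℕ) : Bool :=
  winB s v c d || winB r (N - 1 - v) (N - 1 - c) (N - 1 - d) ||
  k24A (spm M N v c d false false) (N + 1) K ||
  (flagOK N M K I v c d false false && flagOK N M K I v c d true false &&
    flagOK N M K I v c d false true && flagOK N M K I v c d true true)

/-- Check all splittings of a graph. -/
def chk (N M r s : ℕ) (K I : List (ℕ × ℕ × ℕ)) : Bool :=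
  (List.range N).all fun v => (List.range N).all fun c => !(tb M v c) ||
    (List.range N).all fun d => !(tb M v d) || Nat.ble d c || triOK N M r s K I v c d

lemma chk_sound {V : Type*} [Finite V] {G : SimpleGraph V} {M N r s v c d : ℕ}
    {K I : List (ℕ × ℕ × ℕ)} {kc kd : Prop} {f : ℕ → ℕ → Prop} {k : V → ℕ}
    (hchk : chk N M r s K I = true)
    (hN3 : 3 ≤ N) (hN : N ≤ 15) (hv : v < N)
    (hc : c < N) (hd : d < N) (hvc : v ≠ c) (hvd : v ≠ d) (hcd : c < d)
    (hM : ∀ a b, a ≤ N → b ≤ N → (tb M a b = true ↔ a < N ∧ b < N ∧ f a b))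
    (hsym : ∀ a b, f a b ↔ f b a)
    (fc : f v c) (fd : f v d) (hs : Sep3 G) (hm : ¬ IsMinor K24 G)
    (h : LabBy G (N + 1) (spl f N v c d kc kd) k)
    (hw1 : Win s v c d → Good G)
    (hw2 : Win r (N - 1 - v) (N - 1 - c) (N - 1 - d) → Good G) : Good G := by
  classical
  have ht : triOK N M r s K I v c d = true := by
    unfold chk at hchk
    simp only [List.all_eq_true, List.mem_range] at hchk
    have h1 := hchk v hv c hc
    rw [(hM v c hv.le hc.le).2 ⟨hv, hc, fc⟩] at h1
    simp only [Bool.not_true, Bool.false_or, List.all_eq_true, List.mem_range] at h1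
    have h2 := h1 d hd
    rw [(hM v d hv.le hd.le).2 ⟨hv, hd, fd⟩] at h2
    have h3 : Nat.ble d c = false := by
      rw [← Bool.not_eq_true, Nat.ble_eq]
      omega
    rw [h3] at h2
    simpa using h2
  have hspm : ∀ (bc bd : Bool) (a b : ℕ), a < N + 1 → b < N + 1 →
      (tb (spm M N v c d bc bd) a b = true ↔ spl f N v c d (bc = true) (bd = true) a b) :=
    fun bc bd a b ha hb => spm_iff hN hv hc hd hvc hvd hcd.ne hM hsym fc fd (by omega) (by omega)
  have hsurj := h.surj
  unfold triOK at ht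
  rw [Bool.or_eq_true, Bool.or_eq_true, Bool.or_eq_true] at ht
  have hk24 : ∀ X : ℕ, (∀ a b, tb X (k a) (k b) = true → G.Adj a b) → k24A X (N + 1) K = true →
      Good G := by
    intro X hX hk
    unfold k24A at hk
    obtain ⟨e, -, he⟩ := List.any_eq_true.1 hk
    exact absurd (k24B_sound h.1 hsurj hX he) hm
  rcases ht with ((ht | ht) | ht) | ht
  · exact hw1 (winB_sound ht)
  · exact hw2 (winB_sound ht)
  · refine hk24 _ ?_ ht
    intro a b hab
    rw [hspm _ _ _ _ (h.2.1 a) (h.2.1 b)] at hab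
    rw [h.2.2.2]
    unfold spl at hab ⊢
    grind
  · have hfl : flagOK N M K I v c d (decide kc) (decide kd) = true := by
      simp only [Bool.and_eq_true] at ht
      by_cases h1 : kc <;> by_cases h2 : kd <;> simp only [h1, h2, decide_true, decide_false]
      · exact ht.2
      · exact ht.1.1.2
      · exact ht.1.2
      · exact ht.1.1.1
    have hlab : LabBy G (N + 1)
        (fun a b => tb (spm M N v c d (decide kc) (decide kd)) a b = true) k := by
      refine ⟨h.1, h.2.1, h.2.2.1, fun a b => ?_⟩
      show G.Adj a b ↔ tb (spm M N v c d (decide kc) (decide kd)) (k a) (k b) = true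
      rw [hspm _ _ _ _ (h.2.1 a) (h.2.1 b), decide_eq_true_iff, decide_eq_true_iff]
      exact h.2.2.2 a b
    unfold flagOK at hfl
    rw [Bool.or_eq_true, Bool.or_eq_true] at hfl
    rcases hfl with (hfl | hfl) | hfl
    · obtain ⟨e, -, he⟩ := List.any_eq_true.1 hfl
      rw [Bool.and_eq_true] at he
      exact isoB_sound hlab he.2
    · exact hk24 _ (fun a b hab => (hlab.2.2.2 a b).2 hab) hfl
    · exfalso
      unfold degB at hfl
      obtain ⟨x, hx, hx2⟩ := List.any_eq_true.1 hfl
      rw [List.mem_range] at hx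
      obtain ⟨vv, rfl⟩ := hsurj v (by omega)
      obtain ⟨vx, rfl⟩ := hsurj x (by omega)
      obtain ⟨vN, hvN⟩ := hsurj N (by omega)
      obtain ⟨b, hb, hb1, hb2⟩ := exists_nbr_ne (by rw [h.2.2.1]; omega) hs vv vx vN
      have hkb : k b ≠ N := fun e => hb2 (h.1 (e.trans hvN.symm))
      have hlt := h.2.1 b
      have h5 := List.all_eq_true.1 hx2 (k b) (List.mem_range.2 (by omega))
      have h6 := (hlab.2.2.2 vv b).1 hb
      dsimp only at h6
      rw [h6] at h5
      simp only [Bool.not_true, Bool.false_or, Nat.beq_eq] at h5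
      exact hb1 (h.1 h5)

/-- An entry of the table: `(N, M)`, `(r, s)`, minors, isomorphisms. -/
abbrev Ent := (ℕ × ℕ) × (ℕ × ℕ × ℕ) × List (ℕ × ℕ × ℕ) × List (ℕ × ℕ × ℕ)

/-- Check the mask of an entry. -/
def maskOK (N M : ℕ) (f : ℕ → ℕ → Bool) : Bool :=
  (List.range (N + 1)).all fun a => (List.range (N + 1)).all fun b =>
    !(tb M a b ^^ (Nat.blt a N && Nat.blt b N && f a b))

lemma maskOK_sound {N M : ℕ} {f : ℕ → ℕ → Bool} (h : maskOK N M f = true) (a b : ℕ) (ha : a ≤ N)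
    (hb : b ≤ N) : tb M a b = true ↔ a < N ∧ b < N ∧ f a b = true := by
  unfold maskOK at h
  simp only [List.all_eq_true, List.mem_range] at h
  have := h a (by omega) b (by omega)
  have e : tb M a b = (Nat.blt a N && Nat.blt b N && f a b) := by
    cases h5 : tb M a b <;> cases h6 : (Nat.blt a N && Nat.blt b N && f a b) <;> simp_all
  rw [e]
  simp only [Bool.and_eq_true, Nat.blt_eq]
  tauto

/-- Check a family entry. -/
def famOK (e : Ent) : Bool :=
  maskOK e.1.1 e.1.2 (gB e.1.1 e.2.1.1 e.2.1.2.1 e.2.1.2.2) &&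
    chk e.1.1 e.1.2 e.2.1.1 e.2.1.2.1 e.2.2.1 e.2.2.2

/-- Check an exceptional entry. -/
def excOK (e : Ent) : Bool :=
  maskOK e.1.1 e.1.2 (tb e.1.2) && chk e.1.1 e.1.2 0 0 e.2.2.1 e.2.2.2

end K24Paper

namespace K24Paper

/-- Certificates for the graphs of the class with 4 vertices. -/
def fam4 : List Ent :=
  [
    ((4, 1970372082466830), (1, 1, 1), [], [(289, 201280, 289), (290, 201760, 289),
      (291, 201760, 545), (305, 205120, 289), (306, 213280, 289), (307, 213280,
      545), (561, 205840, 289), (562, 213520, 289), (563, 213520, 545), (4129,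
      201220, 289), (4130, 201760, 289), (4131, 201760, 545), (4145, 205060, 289),
      (4146, 213280, 289), (4147, 213280, 545), (4657, 144400, 289), (4658, 148240,
      289), (4659, 213505, 545), (8209, 201220, 289), (8210, 201280, 289), (8211,
      201760, 545), (8241, 143620, 289), (8242, 213520, 289), (8243, 213520, 545),
      (8497, 143680, 289), (8498, 148240, 289), (8499, 213505, 545), (12305, 205060,
      289), (12306, 205120, 289), (12307, 213280, 545), (12321, 143620, 289), (12322,
      205840, 289), (12323, 213520, 545), (12577, 143680, 289), (12578, 144400, 289),
      (12579, 213505, 545)])]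

lemma fam4_ok : fam4.all famOK = true := by
  decide +kernel

/-- Certificates for the graphs of the class with 5 vertices. -/
def fam5 : List Ent :=
  [
    ((5, 276707072191824723994), (1, 2, 1), [(19, 17, 87072), (18, 16, 87089)],
      [(305, 2110545, 545), (306, 2118705, 545), (321, 1061970, 545), (322, 1393440,
      305), (323, 4526640, 561), (833, 1070130, 545), (834, 4534800, 305), (835,
      4534800, 561), (4129, 3478080, 545), (4130, 3477570, 545), (4161, 4526640,
      545), (4162, 1393440, 305), (4163, 4526640, 561), (4673, 4526130, 545),
      (4674, 2442000, 305), (4675, 4530945, 561), (8497, 3482625, 545), (8498,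
      3474465, 545), (8513, 4530945, 545), (8514, 2442000, 305), (8515, 4530945,
      561), (9025, 4522785, 545), (9026, 3490320, 305), (9027, 4522785, 561),
      (12321, 3490320, 545), (12322, 3489810, 545), (12353, 4534800, 545), (12354,
      4534800, 305), (12355, 4534800, 561), (12865, 4534290, 545), (12866, 3490320,
      305), (12867, 4522785, 561), (16400, 4526640, 544), (16401, 4526640, 545),
      (16402, 1061970, 545), (16403, 4526640, 561), (16416, 5390640, 258), (16417,
      5390385, 514), (16418, 5390640, 514), (16432, 4534800, 544), (16433, 4534800,
      545), (16434, 1070130, 545), (16435, 4534800, 561), (16672, 5517840, 544),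
      (16673, 4530945, 545), (16674, 4526130, 545), (16675, 4530945, 561), (16688,
      2441520, 258), (16689, 5374995, 514), (16690, 5379075, 514), (16944, 5509680,
      544), (16945, 4534290, 545), (16946, 4522785, 545), (16947, 4522785, 561)]),
    ((5, 258260328122410139662), (2, 2, 0), [(19, 17, 87072), (20, 16, 86817)],
      [(289, 1323090, 545), (290, 1262880, 305), (291, 4330800, 561), (305, 2371665,
      545), (306, 2379825, 545), (561, 4338960, 305), (562, 1331250, 545), (563,
      4338960, 561), (4129, 4330800, 545), (4130, 1262880, 305), (4131, 4330800,
      561), (4161, 3282240, 545), (4162, 3151170, 545), (4673, 2311440, 305),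
      (4674, 4199730, 545), (4675, 4400385, 561), (8208, 4330800, 544), (8209,
      4330800, 545), (8210, 1323090, 545), (8211, 4330800, 561), (8240, 3490320,
      544), (8241, 4338960, 545), (8242, 1331250, 545), (8243, 4338960, 561),
      (8256, 5390640, 258), (8257, 5259825, 514), (8258, 5390640, 514), (8496,
      2184240, 258), (8497, 5505555, 514), (8498, 5513475, 514), (8512, 2442000,
      544), (8513, 4400385, 545), (8514, 4199730, 545), (8515, 4400385, 561),
      (9024, 5379120, 544), (9025, 4392225, 545), (9026, 4207890, 545), (9027,
      4392225, 561), (12321, 4338960, 545), (12322, 4338960, 305), (12323, 4338960,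
      561), (12353, 3294480, 545), (12354, 3163410, 545), (12865, 3294480, 305),
      (12866, 4207890, 545), (12867, 4392225, 561), (16673, 4400385, 545), (16674,
      2311440, 305), (16675, 4400385, 561), (16689, 3417345, 545), (16690, 3409185,
      545), (16945, 3294480, 305), (16946, 4392225, 545), (16947, 4392225, 561)]),
    ((5, 276707072196119691294), (2, 2, 1), [(18, 16, 87089), (20, 16, 86817), (20,
      18, 86800), (19, 17, 87072)], [(288, 3477570, 545), (290, 1262880, 561),
      (304, 151875, 514), (305, 3474465, 770), (306, 3482625, 770), (320, 3151170,
      545), (322, 1393440, 561), (560, 3489810, 545), (561, 1254720, 561), (576,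
      5390640, 514), (832, 3163410, 545), (834, 1385280, 561), (4129, 2114325, 561),
      (4130, 1262880, 561), (4161, 2310165, 561), (4162, 1393440, 561), (4673,
      2311440, 561), (4674, 2442000, 561), (8208, 3478080, 545), (8209, 2114325,
      561), (8240, 3490320, 545), (8241, 1253445, 561), (8256, 5390385, 514),
      (8496, 152625, 514), (8497, 144705, 770), (8498, 152625, 770), (8512,
      2442000, 545), (8514, 2442000, 561), (9024, 2429760, 545), (9026, 2429760,
      561), (12321, 1253445, 561), (12322, 1254720, 561), (12353, 2297925, 561),
      (12354, 1385280, 561), (12865, 2299200, 561), (12866, 2429760, 561), (16400,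
      3282240, 545), (16401, 2310165, 561), (16416, 5259825, 514), (16432, 3294480,
      545), (16433, 2297925, 561), (16672, 2311440, 545), (16674, 2311440, 561),
      (16688, 344625, 514), (16689, 340545, 770), (16690, 344625, 770), (16944,
      2299200, 545), (16945, 2299200, 561)])]

lemma fam5_ok : fam5.all famOK = true := by
  decide +kernel

/-- Certificates for the graphs of the class with 6 vertices. -/
def fam6 : List Ent :=
  [
    ((6, 37477456739197405687513138), (1, 3, 1), [(289, 20, 91440), (306, 16, 91457),
      (323, 17, 91424), (320, 18, 91441), (272, 19, 91458)], [(321, 73605381,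
      561), (322, 73404981, 561), (337, 90382596, 561), (338, 23413536, 321), (339,
      90252096, 577), (1105, 90182196, 561), (1106, 90452496, 321), (1107, 90452496,
      577), (4129, 73474896, 561), (4130, 73535571, 561), (4177, 90252096, 561),
      (4178, 23413536, 321), (4179, 90252096, 577), (4689, 90312771, 561), (4690,
      40190736, 321), (4691, 90321921, 577), (8497, 73544961, 561), (8498, 73467186,
      561), (8529, 90321921, 561), (8530, 40190736, 321), (8531, 90321921, 577),
      (9041, 90244146, 561), (9042, 56967696, 321), (9043, 90390546, 577), (12865,
      73617426, 561), (12866, 73421601, 561), (12881, 90390546, 561), (12882, 56967696,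
      321), (12883, 90390546, 577), (13393, 90194721, 561), (13394, 73740816, 321),
      (13395, 90194721, 577), (16433, 73740816, 561), (16434, 73728291, 561), (16465,
      90452496, 561), (16466, 90452496, 321), (16467, 90452496, 577), (17233, 90439971,
      561), (17234, 73740816, 321), (17235, 90194721, 577), (20496, 90252096, 560),
      (20497, 90252096, 561), (20498, 90382596, 561), (20499, 90252096, 577), (20512,
      100938321, 1026), (20528, 101000001, 1026), (20544, 90452496, 560), (20545, 90452496,
      561), (20546, 90182196, 561), (20547, 90452496, 577), (20768, 90321921, 560),
      (20769, 90321921, 561), (20770, 90312771, 561), (20771, 90321921, 577), (20784,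
      100930851, 1026), (20800, 100807701, 1026), (21040, 90390546, 560), (21041, 90390546,
      561), (21042, 90244146, 561), (21043, 90390546, 577), (21056, 100815171, 1026),
      (21312, 90194721, 560), (21313, 90439971, 561), (21314, 90194721, 561), (21315,
      90194721, 577)]),
    ((6, 26597124353940018837127194), (2, 2, 0), [(323, 17, 91424), (338, 16, 91185),
      (337, 19, 91168), (289, 20, 91440), (320, 18, 91441), (304, 21, 91169)],
      [(306, 21193986, 560), (322, 22426626, 560), (833, 37971201, 560), (834,
      39203841, 560), (835, 106042416, 1538), (4130, 20207136, 560), (4178, 23413536,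
      560), (4689, 36984336, 560), (4690, 40190736, 560), (4691, 103104771, 1538),
      (8497, 20185701, 560), (8529, 36962661, 560), (8530, 40190736, 560), (8531,
      103104771, 1538), (9042, 56967696, 560), (12321, 21176406, 560), (12353, 37949526,
      560), (12354, 39203841, 560), (12355, 106042416, 1538), (12866, 55976961, 560),
      (16433, 37949526, 560), (16434, 37971201, 560), (16435, 106042416, 1538), (16465,
      54661206, 560), (17233, 54682881, 560), (20769, 36962661, 560), (20770, 36984336,
      560), (20771, 103104771, 1538), (20801, 52691301, 560), (21057, 52712976, 560)]),
    ((6, 27806050173554648011833402), (2, 2, 1), [(304, 21, 91169), (306, 16, 91457),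
      (306, 21, 91152), (323, 17, 91424), (338, 16, 91185), (355, 21, 82448),
      (354, 16, 87089), (289, 20, 91440)], [(320, 33952821, 1026), (322, 33952821,
      1282), (336, 23413536, 560), (338, 23413536, 561), (832, 6636321, 560), (833,
      73728291, 816), (848, 101000001, 1026), (4130, 20207136, 816), (4178, 23413536,
      561), (4689, 36984336, 816), (4690, 40190736, 561), (8530, 40190736, 561),
      (9042, 56967696, 561), (12321, 50406486, 561), (12353, 33633366, 561), (16433,
      33633366, 561), (16434, 73728291, 816), (16465, 16921686, 561), (17233, 90439971,
      816), (20512, 102973776, 1026), (20544, 54661206, 560), (20545, 16921686, 561),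
      (20768, 70389846, 560), (20770, 36984336, 816), (20800, 40059216, 1026), (20801,
      40059216, 1282)]),
    ((6, 36268530919864251489517594), (2, 3, 0), [(337, 19, 91168), (272, 21, 91186),
      (272, 19, 91458), (304, 21, 91169), (320, 18, 91441), (353, 19, 87072),
      (352, 21, 82721), (289, 20, 91440)], [(306, 50423106, 561), (833, 33645891,
      561), (4178, 56951076, 561), (4690, 40173876, 561), (8497, 87188481, 816),
      (8529, 70411521, 816), (8530, 40173876, 561), (9042, 23396916, 561), (12352,
      73740816, 560), (12353, 73740816, 816), (12368, 101000001, 1026), (12864, 33968961,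
      1026), (12866, 33968961, 1282), (12880, 56967696, 560), (12882, 23396916, 561),
      (16433, 73740816, 816), (16434, 33645891, 561), (16465, 90452496, 816), (17233,
      16934211, 561), (20768, 70411521, 560), (20769, 70411521, 816), (20784, 101975331,
      1026), (21056, 23332131, 1026), (21057, 23332131, 1282), (21312, 54682881, 560),
      (21313, 16934211, 561)]),
    ((6, 37477456739478880664223802), (2, 3, 1), [(304, 21, 91169), (272, 21, 91186),
      (272, 19, 91458), (306, 21, 91152), (355, 21, 82448), (353, 19, 87072),
      (352, 21, 82721), (354, 16, 87089), (21, 16, 91185), (306, 16, 91457),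
      (21, 19, 91168)], [(336, 56951076, 561), (338, 23413536, 577), (832,
      73728291, 561), (833, 73728291, 817), (4178, 23413536, 577), (4690, 40190736,
      577), (8530, 40190736, 577), (9042, 56967696, 577), (12352, 73740816, 561),
      (12353, 73740816, 817), (12880, 56967696, 561), (12882, 56967696, 577), (16433,
      73740816, 817), (16434, 73728291, 817), (16465, 90452496, 817), (17233, 90439971,
      817), (20544, 90452496, 816), (20545, 90452496, 817), (20768, 86381616, 1538),
      (21312, 90439971, 816), (21313, 90439971, 817)])]

lemma fam6_ok : fam6.all famOK = true := by
  decide +kernel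

/-- Certificates for the graphs of the class with 7 vertices. -/
def fam7 : List Ent :=
  [
    ((7, 4991472163308527081238089236578), (1, 4, 1), [(340, 289, 95792), (336, 306,
      95809), (323, 272, 95826)], [(337, 1464017158, 577), (338, 1459692358, 577),
      (353, 1732452613, 577), (354, 392512288, 337), (355, 1729246288, 593), (1377,
      1728127813, 577), (1378, 1733571088, 337), (1379, 1733571088, 593), (4129, 1460810848,
      577), (4130, 1462898788, 577), (4193, 1729246288, 577), (4194, 392512288, 337),
      (4195, 1729246288, 593), (4705, 1731334228, 577), (4706, 660947728, 337), (4707,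
      1730364673, 593), (8497, 1461929473, 577), (8498, 1461782083, 577), (8545,
      1730364673, 577), (8546, 660947728, 337), (8547, 1730364673, 593), (9057,
      1730217283, 577), (9058, 929382928, 337), (9059, 1731481618, 593), (12865,
      1463050258, 577), (12866, 1460692018, 577), (12897, 1731481618, 577), (12898,
      929382928, 337), (12899, 1731481618, 593), (13409, 1729123378, 577), (13410,
      1197814288, 337), (13411, 1729123378, 593), (17233, 1464205603, 577), (17234,
      1460028193, 577), (17249, 1732575523, 577), (17250, 1197814288, 337), (17251,
      1729123378, 593), (17761, 1728398113, 577), (17762, 1466184208, 337), (17763,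
      1728398113, 593), (20545, 1466184208, 577), (20546, 1465913908, 577), (20577,
      1733571088, 577), (20578, 1733571088, 337), (20579, 1733571088, 593), (21601,
      1733300788, 577), (21602, 1466184208, 337), (21603, 1728398113, 593), (24592,
      1729246288, 576), (24593, 1729246288, 577), (24594, 1732452613, 577), (24595,
      1729246288, 593), (24656, 1733571088, 576), (24657, 1733571088, 577), (24658,
      1728127813, 577), (24659, 1733571088, 593), (24864, 1730364673, 576), (24865,
      1730364673, 577), (24866, 1731334228, 577), (24867, 1730364673, 593), (25136,
      1731481618, 576), (25137, 1731481618, 577), (25138, 1730217283, 577), (25139,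
      1731481618, 593), (25408, 1729123378, 576), (25409, 1732575523, 577), (25410,
      1729123378, 577), (25411, 1729123378, 593), (25680, 1728398113, 576), (25681,
      1733300788, 577), (25682, 1728398113, 577), (25683, 1728398113, 593)]),
    ((7, 3644593399403888465504140329010), (2, 3, 0), [(353, 323, 95520), (355, 272,
      95554), (323, 272, 95826), (340, 289, 95792), (369, 323, 91424), (5952,
      22, 86817), (354, 320, 95537), (371, 272, 91458)], [(322, 806839618, 816),
      (1105, 538404163, 816), (4194, 392512288, 576), (4706, 660947728, 576), (8546,
      660947728, 576), (9058, 929382928, 576), (12898, 929382928, 576), (13410,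
      1197814288, 576), (16433, 1197814288, 816), (16465, 1466184208, 816), (20545,
      1466184208, 816), (20546, 538404163, 816), (20577, 1733571088, 816), (21601,
      271017283, 816), (24880, 1192383328, 1794), (25168, 1947358048, 1794), (25169,
      1947358048, 2050)]),
    ((7, 3723821561918152803097684279410), (2, 3, 1), [(5136, 22, 95538), (323, 272,
      95826), (5170, 22, 95504), (336, 306, 95809), (5955, 22, 86544), (369,
      323, 91424), (5952, 22, 86817), (355, 272, 95554), (323, 22, 95520),
      (371, 272, 91458)], [(352, 392512288, 576), (354, 392512288, 577), (1104,
      124076833, 576), (1105, 1465913908, 832), (4194, 392512288, 577), (4706,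
      660947728, 577), (8546, 660947728, 577), (9058, 929382928, 577), (12898,
      929382928, 577), (13410, 1197814288, 577), (16433, 1197814288, 817), (16465,
      1466184208, 817), (20545, 1466184208, 817), (20546, 1465913908, 832), (20577,
      1733571088, 817), (21601, 1733300788, 832), (24656, 1733571088, 816), (24657,
      1733571088, 817)]),
    ((7, 4912244000812709487718254837810), (2, 4, 0), [(5136, 22, 95538), (353, 323,
      95520), (323, 272, 95826), (5921, 20, 91440), (5952, 22, 86817), (355,
      272, 95554), (5904, 22, 87090), (371, 272, 91458), (272, 22, 95554)],
      [(322, 806839618, 817), (1105, 538404163, 817), (4194, 1197478453, 577), (4706,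
      929043013, 577), (8546, 929043013, 577), (9058, 660607813, 577), (12898,
      660607813, 577), (13410, 392176453, 577), (16464, 1466184208, 576), (16465,
      1466184208, 832), (17248, 1197814288, 576), (17250, 392176453, 577), (20545,
      1466184208, 832), (20546, 538404163, 817), (20577, 1733571088, 832), (21601,
      271017283, 817), (25680, 271017283, 816), (25681, 271017283, 817)]),
    ((7, 4991472163326973825311798788210), (2, 4, 1), [(354, 320, 95537), (4624, 22,
      95555), (323, 272, 95826), (5921, 20, 91440), (5170, 22, 95504), (5955,
      22, 86544), (5952, 22, 86817), (371, 272, 91458), (5904, 22, 87090)],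
      [(352, 1197478453, 577), (354, 392512288, 593), (1104, 1465913908, 577), (1105,
      1465913908, 833), (4194, 392512288, 593), (4706, 660947728, 593), (8546,
      660947728, 593), (9058, 929382928, 593), (12898, 929382928, 593), (13410,
      1197814288, 593), (16464, 1466184208, 577), (16465, 1466184208, 833), (17248,
      1197814288, 577), (17250, 1197814288, 593), (20545, 1466184208, 833), (20546,
      1465913908, 833), (20577, 1733571088, 833), (21601, 1733300788, 833), (24656,
      1733571088, 832), (24657, 1733571088, 833), (25680, 1733300788, 832), (25681,
      1733300788, 833)]),
    ((7, 3644593399403888746979117039674), (3, 3, 0), [(357, 304, 95265), (355, 272,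
      95554), (336, 306, 95809), (371, 357, 82448), (369, 323, 91424), (5952,
      22, 86817), (357, 306, 95248), (371, 272, 91458), (369, 19, 91168),
      (272, 19, 95810), (357, 19, 95264), (5986, 16, 87089), (373, 19,
      91168)], [(4194, 392512288, 832), (4706, 660947728, 832), (8546, 660947728,
      832), (9058, 929382928, 832), (12352, 1197814288, 816), (12353, 806503783, 832),
      (12896, 929382928, 816), (12898, 929382928, 832), (16433, 806503783, 832), (16465,
      538133863, 832), (20545, 538133863, 832), (20577, 270746983, 832)]),
    ((7, 3723821561918153084572660990074), (3, 3, 1), [(355, 272, 95554), (357, 304,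
      95265), (353, 323, 95520), (336, 306, 95809), (369, 323, 91424), (5952,
      22, 86817), (371, 357, 82448), (272, 19, 95810), (323, 22, 95520),
      (5986, 16, 87089), (371, 272, 91458)], [(352, 392512288, 832), (354,
      392512288, 833), (4194, 392512288, 833), (4706, 660947728, 833), (8546,
      660947728, 833), (9058, 929382928, 833), (12352, 1197814288, 817), (12353,
      806503783, 833), (12896, 929382928, 817), (12898, 929382928, 833), (16433,
      806503783, 833), (16465, 538133863, 833), (20545, 538133863, 833), (20577,
      270746983, 833), (24656, 270746983, 832), (24657, 270746983, 833)])]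

lemma fam7_ok : fam7.all famOK = true := by
  decide +kernel

/-- Certificates for the graphs of the class with 8 vertices. -/
def fam8 : List Ent :=
  [
    ((8, 659434457019547574956231735197892802), (1, 5, 1), [(4897, 357, 100160), (5443, 272,
      100194), (5170, 352, 100177), (5716, 289, 100144)], [(353, 28005572871, 593),
      (354, 27918480471, 593), (369, 32300540166, 593), (370, 6566527776, 353), (371,
      32231343456, 609), (1649, 32213447766, 593), (1650, 32318435856, 353), (1651,
      32318435856, 609), (4129, 27936376176, 593), (4130, 27987677301, 593), (4209,
      32231343456, 593), (4210, 6566527776, 353), (4211, 32231343456, 609), (4721,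
      32282644581, 593), (4722, 10861495056, 353), (4723, 32249239041, 609), (8497,
      27954272001, 593), (8498, 27969783636, 593), (8561, 32249239041, 593), (8562,
      10861495056, 353), (8563, 32249239041, 609), (9073, 32264750676, 593), (9074,
      15156462096, 353), (9075, 32267132946, 609), (12865, 27972169746, 593), (12866,
      27951920451, 593), (12913, 32267132946, 593), (12914, 15156462096, 353), (12915,
      32267132946, 609), (13425, 32246883651, 593), (13426, 19451425296, 353), (13427,
      32284999971, 609), (17233, 27990098211, 593), (17234, 27934544946, 593), (17265,
      32284999971, 593), (17266, 19451425296, 353), (17267, 32284999971, 609), (17777,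
      32229446706, 593), (17778, 23746327056, 353), (17779, 32229446706, 609), (21601,
      28008518196, 593), (21602, 27924972321, 593), (21617, 32302436916, 593), (21618,
      23746327056, 353), (21619, 32229446706, 609), (22129, 32218891041, 593), (22130,
      28040245776, 353), (22131, 32218891041, 609), (24657, 28040245776, 593), (24658,
      28034802501, 593), (24689, 32318435856, 593), (24690, 32318435856, 353), (24691,
      32318435856, 609), (25969, 32312992581, 593), (25970, 28040245776, 353), (25971,
      32218891041, 609), (28688, 32231343456, 592), (28689, 32231343456, 593), (28690,
      32300540166, 593), (28691, 32231343456, 609), (28768, 32318435856, 592), (28769,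
      32318435856, 593), (28770, 32213447766, 593), (28771, 32318435856, 609), (28960,
      32249239041, 592), (28961, 32249239041, 593), (28962, 32282644581, 593), (28963,
      32249239041, 609), (29232, 32267132946, 592), (29233, 32267132946, 593), (29234,
      32264750676, 593), (29235, 32267132946, 609), (29504, 32284999971, 592), (29505,
      32284999971, 593), (29506, 32246883651, 593), (29507, 32284999971, 609), (29776,
      32229446706, 592), (29777, 32302436916, 593), (29778, 32229446706, 593), (29779,
      32229446706, 609), (30048, 32218891041, 592), (30049, 32312992581, 593), (30050,
      32218891041, 593), (30051, 32218891041, 609)]),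
    ((8, 488088660534364684123667451145945186), (2, 4, 0), [(5443, 369, 99872), (5392, 371,
      99906), (4624, 340, 100195), (6177, 340, 95792), (5648, 323, 100178),
      (99408, 23, 90913), (99600, 23, 91186), (4624, 388, 95827)], [(338,
      23739835206, 832), (1377, 28034802501, 832), (4210, 6566527776, 592), (4722,
      10861495056, 592), (8562, 10861495056, 592), (9074, 15156462096, 592), (12914,
      15156462096, 592), (13426, 19451425296, 592), (17266, 19451425296, 592), (17778,
      23746327056, 592), (20545, 23746327056, 832), (20577, 28040245776, 832), (24657,
      28040245776, 832), (24658, 28034802501, 832), (24689, 32318435856, 832), (25969,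
      32312992581, 832)]),
    ((8, 493280957392899511752197947475165410), (2, 4, 1), [(4624, 372, 99923), (5200, 370,
      99889), (4624, 340, 100195), (99378, 16, 95825), (5443, 385, 95776),
      (99408, 23, 90913), (99600, 23, 91186), (389, 23, 91152), (5200, 23,
      99889)], [(368, 6566527776, 592), (370, 6566527776, 593), (1376, 2271560481,
      592), (1377, 28034802501, 848), (4210, 6566527776, 593), (4722, 10861495056, 593),
      (8562, 10861495056, 593), (9074, 15156462096, 593), (12914, 15156462096, 593),
      (13426, 19451425296, 593), (17266, 19451425296, 593), (17778, 23746327056, 593),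
      (20545, 23746327056, 833), (20577, 28040245776, 833), (24657, 28040245776, 833),
      (24658, 28034802501, 848), (24689, 32318435856, 833), (25969, 32312992581, 848),
      (28768, 32318435856, 832), (28769, 32318435856, 833)]),
    ((8, 654242160162221673147315868043378786), (2, 5, 0), [(5443, 369, 99872), (5392, 371,
      99906), (4624, 340, 100195), (99105, 21, 95808), (6160, 372, 91442),
      (98832, 23, 91459), (4624, 388, 95827), (384, 23, 91425), (99600, 23,
      91186)], [(338, 23739835206, 833), (1377, 28034802501, 833), (4210, 23739835206,
      593), (4722, 19444867926, 593), (8562, 19444867926, 593), (9074, 15149900886,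
      593), (12914, 15149900886, 593), (13426, 10854937686, 593), (17266, 10854937686,
      593), (17778, 6560035926, 593), (20576, 28040245776, 592), (20577, 28040245776,
      848), (21616, 23746327056, 592), (21618, 6560035926, 593), (24657, 28040245776,
      848), (24658, 28034802501, 833), (24689, 32318435856, 848), (25969, 32312992581,
      833), (30048, 32312992581, 832), (30049, 32312992581, 833)]),
    ((8, 659434457020756500775846364372599010), (2, 5, 1), [(5392, 371, 99906), (5443, 369,
      99872), (5443, 272, 100194), (99105, 21, 95808), (99600, 23, 91186),
      (98832, 23, 91459), (4624, 388, 95827), (389, 23, 91152), (384, 23,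
      91425)], [(368, 23739835206, 593), (370, 6566527776, 609), (1376, 28034802501,
      593), (1377, 28034802501, 849), (4210, 6566527776, 609), (4722, 10861495056, 609),
      (8562, 10861495056, 609), (9074, 15156462096, 609), (12914, 15156462096, 609),
      (13426, 19451425296, 609), (17266, 19451425296, 609), (17778, 23746327056, 609),
      (20576, 28040245776, 593), (20577, 28040245776, 849), (21616, 23746327056, 593),
      (21618, 23746327056, 609), (24657, 28040245776, 849), (24658, 28034802501, 849),
      (24689, 32318435856, 849), (25969, 32312992581, 849), (28768, 32318435856, 848),
      (28769, 32318435856, 849), (30048, 32312992581, 848), (30049, 32312992581, 849)]),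
    ((8, 405011910797805099330682148765368434), (3, 3, 0), [(5136, 374, 99634), (5170, 352,
      100177), (5170, 374, 99600), (6211, 374, 86544), (5170, 390, 95504), (6208,
      23, 90913), (6259, 16, 91457), (6211, 272, 95826), (385, 323, 95520),
      (323, 272, 100178), (371, 272, 99906), (374, 323, 99616), (390, 323,
      95520)], [(4210, 6566527776, 832), (4722, 10861495056, 832), (8562, 10861495056,
      832), (9074, 15156462096, 832), (12914, 15156462096, 832), (13426, 19451425296,
      832), (16433, 17198962296, 832), (16465, 12904060536, 832), (20545, 12904060536,
      832), (20577, 8610141816, 832), (24657, 8610141816, 832), (24689, 4331951736,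
      832)]),
    ((8, 410204207656339926959212645094588658), (3, 3, 1), [(5955, 272, 99922), (4928, 374,
      99617), (5443, 369, 99872), (5170, 352, 100177), (5170, 390, 95504), (6208,
      23, 90913), (6259, 16, 91457), (6211, 374, 86544), (323, 272, 100178),
      (374, 323, 99616), (6211, 272, 95826)], [(368, 6566527776, 832), (370,
      6566527776, 833), (4210, 6566527776, 833), (4722, 10861495056, 833), (8562,
      10861495056, 833), (9074, 15156462096, 833), (12914, 15156462096, 833), (13426,
      19451425296, 833), (16433, 17198962296, 833), (16465, 12904060536, 833), (20545,
      12904060536, 833), (20577, 8610141816, 833), (24657, 8610141816, 833), (24689,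
      4331951736, 833), (28768, 4331951736, 832), (28769, 4331951736, 833)]),
    ((8, 488088660534364702570411524855496818), (3, 4, 0), [(4624, 372, 99923), (5746, 320,
      99633), (5648, 323, 100178), (6177, 340, 95792), (6211, 374, 86544), (6208,
      23, 90913), (6259, 16, 91457), (385, 323, 95520), (323, 272, 100178),
      (374, 320, 99633), (4624, 388, 95827)], [(4210, 6566527776, 848), (4722,
      10861495056, 848), (8562, 10861495056, 848), (9074, 15156462096, 848), (12914,
      15156462096, 848), (13426, 19451425296, 848), (16464, 23746327056, 832), (16465,
      23746327056, 1088), (17264, 19451425296, 832), (17266, 19451425296, 848), (20545,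
      23746327056, 1088), (20577, 28040245776, 1088), (24657, 28040245776, 1088), (24689,
      32318435856, 1088)]),
    ((8, 493280957392899530198942021184717042), (3, 4, 1), [(4624, 372, 99923), (5746, 320,
      99633), (5170, 352, 100177), (369, 340, 99888), (5170, 390, 95504), (6208,
      23, 90913), (99600, 23, 91186), (323, 272, 100178), (6259, 16, 91457),
      (4624, 388, 95827)], [(368, 6566527776, 848), (370, 6566527776, 849), (4210,
      6566527776, 849), (4722, 10861495056, 849), (8562, 10861495056, 849), (9074,
      15156462096, 849), (12914, 15156462096, 849), (13426, 19451425296, 849), (16464,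
      23746327056, 833), (16465, 23746327056, 1089), (17264, 19451425296, 833), (17266,
      19451425296, 849), (20545, 23746327056, 1089), (20577, 28040245776, 1089), (24657,
      28040245776, 1089), (24689, 32318435856, 1089), (28768, 32318435856, 1088), (28769,
      32318435856, 1089)])]

lemma fam8_ok : fam8.all famOK = true := by
  decide +kernel

/-- Certificates for the graphs of the class with 9 vertices. -/
def fam9 : List Ent :=
  [
    ((9, 86773670325090219673298952072793636012418), (1, 6, 1), [(5716, 4624, 104563), (5989,
      4897, 104512)], [(12865, 520569126930, 609), (12866, 520530986580, 609), (13441,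
      589250459220, 609), (13442, 315804168720, 369), (13443, 589574897955, 625), (17233,
      520855486755, 609), (17234, 520245241155, 609), (17281, 589574897955, 609), (17282,
      315804168720, 369), (17283, 589574897955, 625), (33600, 589574897955, 608), (33601,
      589574897955, 609), (33602, 589250459220, 609), (33603, 589574897955, 625)]),
    ((9, 64655316455026038107042196503374994931906), (2, 5, 0), [(78352, 389, 104292), (6194,
      5472, 104257), (5716, 4624, 104563), (103201, 357, 100160), (6484, 4624,
      100195), (1660432, 24, 95282), (1663504, 24, 95555), (400, 389, 95777)],
      [(354, 453120242775, 848), (1649, 521839719510, 848), (4226, 109645742880, 608),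
      (4738, 178365219600, 608), (8578, 178365219600, 608), (9090, 247084696080, 608),
      (12930, 247084696080, 608), (13442, 315804168720, 608), (17282, 315804168720, 608),
      (17794, 384523579920, 608), (21634, 384523579920, 608), (22146, 453242008080, 608),
      (24657, 453242008080, 848), (24689, 521944707600, 848), (28769, 521944707600, 848),
      (28770, 521839719510, 848), (28801, 590395748880, 848), (30337, 590290760790, 848)]),
    ((9, 64995598821946976570505571110806763143618), (2, 5, 1), [(78352, 389, 104292), (87568,
      387, 104258), (5716, 4624, 104563), (1659954, 16, 100193), (6433, 5716,
      100144), (1660432, 24, 95282), (1663504, 24, 95555), (406, 24, 95504), (5472,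
      24, 104257), (400, 389, 95777)], [(384, 109645742880, 608), (386, 109645742880,
      609), (1648, 40926266145, 608), (1649, 521839719510, 864), (4226, 109645742880,
      609), (4738, 178365219600, 609), (8578, 178365219600, 609), (9090, 247084696080,
      609), (12930, 247084696080, 609), (13442, 315804168720, 609), (17282, 315804168720,
      609), (17794, 384523579920, 609), (21634, 384523579920, 609), (22146, 453242008080,
      609), (24657, 453242008080, 849), (24689, 521944707600, 849), (28769, 521944707600,
      849), (28770, 521839719510, 864), (28801, 590395748880, 849), (30337, 590290760790,
      864), (32880, 590395748880, 848), (32881, 590395748880, 849)]),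
    ((9, 86433387958248509372349841802955411751106), (2, 6, 0), [(6177, 5716, 104240), (102928,
      24, 95811), (6501, 385, 95280)], [(13442, 246961816935, 609), (17282,
      246961816935, 609)]),
    ((9, 86773670325169447835813216410387179962818), (2, 6, 1), [(6177, 5716, 104240), (102928,
      24, 95811), (6501, 24, 95280)], [(13442, 315804168720, 625), (17282, 315804168720,
      625)]),
    ((9, 53766280713555699000130207335118862090466), (3, 4, 0), [(6228, 4624, 104291), (6018,
      5200, 103985), (5904, 5443, 104546), (6433, 5716, 100144), (103504, 24,
      95009), (103696, 24, 95282), (6532, 16, 95825), (405, 391, 91152), (5443,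
      401, 99872), (4624, 340, 104547), (5200, 391, 103985), (6484, 4624, 100195)],
      [(4226, 109645742880, 848), (4738, 178365219600, 848), (8578, 178365219600, 848),
      (9090, 247084696080, 848), (12930, 247084696080, 848), (13442, 315804168720, 848),
      (17282, 315804168720, 848), (17794, 384523579920, 848), (20545, 384523579920, 1088),
      (20577, 453242008080, 1088), (24657, 453242008080, 1088), (24689, 521944707600, 1088),
      (28769, 521944707600, 1088), (28801, 590395748880, 1088)]),
    ((9, 54106563080476637463593581942550630302178), (3, 4, 1), [(6228, 4624, 104291), (6018,
      5200, 103985), (87090, 368, 104545), (5716, 385, 104240), (6433, 5716,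
      100144), (103504, 24, 95009), (103696, 24, 95282), (6532, 16, 95825), (4624,
      340, 104547), (6484, 4624, 100195)], [(384, 109645742880, 848), (386,
      109645742880, 849), (4226, 109645742880, 849), (4738, 178365219600, 849), (8578,
      178365219600, 849), (9090, 247084696080, 849), (12930, 247084696080, 849), (13442,
      315804168720, 849), (17282, 315804168720, 849), (17794, 384523579920, 849), (20545,
      384523579920, 1089), (20577, 453242008080, 1089), (24657, 453242008080, 1089), (24689,
      521944707600, 1089), (28769, 521944707600, 1089), (28801, 590395748880, 1089), (32880,
      590395748880, 1088), (32881, 590395748880, 1089)]),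
    ((9, 64655316455026039315968016118004169638114), (3, 5, 0), [(78352, 389, 104292), (6018,
      5200, 103985), (5904, 5443, 104546), (6433, 5716, 100144), (4624, 340,
      104547), (103696, 24, 95282), (103504, 24, 95009), (6532, 16, 95825), (405,
      391, 91152), (5443, 401, 99872), (6484, 4624, 100195)], [(4226, 109645742880,
      864), (4738, 178365219600, 864), (8578, 178365219600, 864), (9090, 247084696080,
      864), (12930, 247084696080, 864), (13442, 315804168720, 864), (17282, 315804168720,
      864), (17794, 384523579920, 864), (20576, 453242008080, 848), (20577, 453242008080,
      1104), (21632, 384523579920, 848), (21634, 384523579920, 864), (24657, 453242008080,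
      1104), (24689, 521944707600, 1104), (28769, 521944707600, 1104), (28801, 590395748880,
      1104)]),
    ((9, 64995598821946977779431390725435937849826), (3, 5, 1), [(78352, 389, 104292), (6018,
      5200, 103985), (87090, 368, 104545), (385, 357, 104256), (6433, 5716, 100144),
      (103696, 24, 95282), (103504, 24, 95009), (6532, 16, 95825), (4624, 340,
      104547), (6484, 4624, 100195)], [(384, 109645742880, 864), (386, 109645742880,
      865), (4226, 109645742880, 865), (4738, 178365219600, 865), (8578, 178365219600,
      865), (9090, 247084696080, 865), (12930, 247084696080, 865), (13442, 315804168720,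
      865), (17282, 315804168720, 865), (17794, 384523579920, 865), (20576, 453242008080,
      849), (20577, 453242008080, 1105), (21632, 384523579920, 849), (21634, 384523579920,
      865), (24657, 453242008080, 1105), (24689, 521944707600, 1105), (28769, 521944707600,
      1105), (28801, 590395748880, 1105), (32880, 590395748880, 1104), (32881, 590395748880,
      1105)]),
    ((9, 53766280713555699000148654079192571642098), (4, 4, 0), [(6262, 5136, 103730), (90640,
      388, 104275), (6017, 5443, 103968), (6433, 5716, 100144), (5904, 323, 104530),
      (6464, 24, 95009), (103696, 24, 95282), (6532, 16, 95825), (406, 388,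
      95504), (104323, 16, 91457)], [(4226, 109645742880, 1104), (4738, 178365219600,
      1104), (8578, 178365219600, 1104), (9090, 247084696080, 1104), (12930, 247084696080,
      1104), (13442, 315804168720, 1104), (16464, 384523579920, 1088), (16465, 275183396745,
      1104), (17280, 315804168720, 1088), (17282, 315804168720, 1104), (20545, 275183396745,
      1104), (20577, 206464968585, 1104), (24657, 206464968585, 1104), (24689, 137762269065,
      1104), (28769, 137762269065, 1104), (28801, 69311227785, 1104)]),
    ((9, 54106563080476637463612028686624339853810), (4, 4, 1), [(6262, 5136, 103730), (90640,
      388, 104275), (6177, 5716, 104240), (5170, 368, 104529), (6433, 5716, 100144),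
      (6464, 24, 95009), (103696, 24, 95282), (6532, 16, 95825), (104323, 16,
      91457)], [(384, 109645742880, 1104), (386, 109645742880, 1105), (4226, 109645742880,
      1105), (4738, 178365219600, 1105), (8578, 178365219600, 1105), (9090, 247084696080,
      1105), (12930, 247084696080, 1105), (13442, 315804168720, 1105), (16464, 384523579920,
      1089), (16465, 275183396745, 1105), (17280, 315804168720, 1089), (17282, 315804168720,
      1105), (20545, 275183396745, 1105), (20577, 206464968585, 1105), (24657, 206464968585,
      1105), (24689, 137762269065, 1105), (28769, 137762269065, 1105), (28801, 69311227785,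
      1105), (32880, 69311227785, 1104), (32881, 69311227785, 1105)])]

lemma fam9_ok : fam9.all famOK = true := by
  decide +kernel

/-- Certificates for the graphs of the class with 10 vertices. -/
def fam10 : List Ent :=
  [
    ((10, 11395898921766388975221712500983248389140710146), (1, 7, 1), [(78352, 5989, 108932)],
      [(17233, 9501918429475, 625), (17234, 9496726959700, 625)]),
    ((10, 8519102788502674895252307925632526130637767042), (2, 6, 0), [(78352, 6501, 108660),
      (107024, 406, 100163), (108389, 401, 99376)], [(13458, 5126167540240, 624), (17298,
      5126167540240, 624)]),
    ((10, 8541403533701205518393843643905174492143747970), (2, 6, 1), [(78352, 6501, 108660),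
      (107024, 406, 100163), (108389, 25, 99376)], [(13458, 5126167540240, 625), (17298,
      5126167540240, 625)]),
    ((10, 11373598176573050648938711610339130523963949442), (2, 7, 0), [(108389, 6433, 99376),
      (1716752, 406, 100180)], []),
    ((10, 11395898921771581272080247328611778885469930370), (2, 7, 1), [(108389, 402, 99376),
      (4624, 25, 108659)], []),
    ((10, 7091855095796674528602977167106520693296398786), (3, 5, 0), [(78352, 6501, 108660),
      (83296, 6290, 108337), (91459, 6160, 108914), (95828, 6689, 104496), (5716,
      4624, 108915), (1725968, 25, 99378), (1729040, 25, 99651), (6805, 16, 100193),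
      (422, 408, 95504), (6689, 5716, 104240), (416, 405, 99873), (78352, 6757,
      104564)], [(4242, 1827632661280, 864), (4754, 2927144289040, 864), (8594,
      2927144289040, 864), (9106, 4026655916560, 864), (12946, 4026655916560, 864), (13458,
      5126167540240, 864), (17298, 5126167540240, 864), (17810, 6225679102480, 864), (21650,
      6225679102480, 864), (22162, 7325189681680, 864), (24657, 7325189681680, 1104), (24689,
      8424684532240, 1104), (28769, 8424684532240, 1104), (28801, 9523927724560, 1104), (32881,
      9523927724560, 1104), (32913, 10619144385040, 1104)]),
    ((10, 7114155840995205151744512885379169054802379714), (3, 5, 1), [(78352, 6501, 108660),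
      (83296, 6290, 108337), (1463346, 384, 108913), (5989, 401, 108608), (91459,
      6305, 104224), (1725968, 25, 99378), (1729040, 25, 99651), (6805, 16, 100193),
      (5716, 4624, 108915), (416, 405, 99873), (78352, 6757, 104564)], [(400,
      1827632661280, 864), (402, 1827632661280, 865), (4242, 1827632661280, 865), (4754,
      2927144289040, 865), (8594, 2927144289040, 865), (9106, 4026655916560, 865), (12946,
      4026655916560, 865), (13458, 5126167540240, 865), (17298, 5126167540240, 865), (17810,
      6225679102480, 865), (21650, 6225679102480, 865), (22162, 7325189681680, 865), (24657,
      7325189681680, 1105), (24689, 8424684532240, 1105), (28769, 8424684532240, 1105), (28801,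
      9523927724560, 1105), (32881, 9523927724560, 1105), (32913, 10619144385040, 1105), (36992,
      10619144385040, 1104), (36993, 10619144385040, 1105)]),
    ((10, 8519102788502674974480470439896863724181717442), (3, 6, 0), [(78352, 6501, 108660),
      (107024, 25, 99907), (6757, 408, 95280)], [(13458, 5126167540240, 880), (17298,
      5126167540240, 880)]),
    ((10, 8541403533701205597622006158169512085687698370), (3, 6, 1), [(78352, 6501, 108660),
      (107024, 25, 99907), (6757, 408, 95280)], [(13458, 5126167540240, 881), (17298,
      5126167540240, 881)]),
    ((10, 6378231249443694587456073088558697616830169570), (4, 4, 0), [(104020, 4624, 108659),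
      (96402, 5200, 108081), (6289, 5716, 108336), (87090, 6791, 103952), (91459,
      6160, 108914), (107600, 25, 99105), (107792, 25, 99378), (108692, 16, 95825),
      (108884, 16, 100193), (95828, 6689, 104496)], [(4242, 1827632661280, 1104), (4754,
      2927144289040, 1104), (8594, 2927144289040, 1104), (9106, 4026655916560, 1104), (12946,
      4026655916560, 1104), (13458, 5126167540240, 1104), (17298, 5126167540240, 1104), (17810,
      6225679102480, 1104), (20545, 5502444927130, 1104), (20577, 4402934347930, 1104), (24657,
      4402934347930, 1104), (24689, 3303439497370, 1104), (28769, 3303439497370, 1104), (28801,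
      2204196305050, 1104), (32881, 2204196305050, 1104), (32913, 1108979644570, 1104)]),
    ((10, 6400531994642225210597608806831345978336150498), (4, 4, 1), [(94736, 6484, 108643),
      (96402, 5200, 108081), (95828, 401, 108592), (1463346, 384, 108913), (87090,
      6791, 103952), (107600, 25, 99105), (107792, 25, 99378), (108692, 16, 95825),
      (108884, 16, 100193)], [(400, 1827632661280, 1104), (402, 1827632661280, 1105),
      (4242, 1827632661280, 1105), (4754, 2927144289040, 1105), (8594, 2927144289040, 1105),
      (9106, 4026655916560, 1105), (12946, 4026655916560, 1105), (13458, 5126167540240, 1105),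
      (17298, 5126167540240, 1105), (17810, 6225679102480, 1105), (20545, 5502444927130, 1105),
      (20577, 4402934347930, 1105), (24657, 4402934347930, 1105), (24689, 3303439497370, 1105),
      (28769, 3303439497370, 1105), (28801, 2204196305050, 1105), (32881, 2204196305050, 1105),
      (32913, 1108979644570, 1105), (36992, 1108979644570, 1104), (36993, 1108979644570,
      1105)]),
    ((10, 7091855095796674528604186092926135322471104994), (4, 5, 0), [(78352, 6501, 108660),
      (1542450, 336, 108097), (91459, 6160, 108914), (6289, 357, 108352), (87090,
      6791, 103952), (107792, 25, 99378), (107600, 25, 99105), (108692, 16, 95825),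
      (6805, 16, 100193), (95828, 6689, 104496)], [(4242, 1827632661280, 1120), (4754,
      2927144289040, 1120), (8594, 2927144289040, 1120), (9106, 4026655916560, 1120), (12946,
      4026655916560, 1120), (13458, 5126167540240, 1120), (17298, 5126167540240, 1120), (17810,
      6225679102480, 1120), (20576, 7325189681680, 1104), (20577, 7325189681680, 1360), (21648,
      6225679102480, 1104), (21650, 6225679102480, 1120), (24657, 7325189681680, 1360), (24689,
      8424684532240, 1360), (28769, 8424684532240, 1360), (28801, 9523927724560, 1360), (32881,
      9523927724560, 1360), (32913, 10619144385040, 1360)]),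
    ((10, 7114155840995205151745721811198783683977085922), (4, 5, 1), [(78352, 6501, 108660),
      (1542450, 336, 108097), (1463346, 384, 108913), (5989, 401, 108608), (87090,
      6791, 103952), (6292, 352, 108369), (107792, 25, 99378), (107600, 25, 99105),
      (6805, 16, 100193), (108692, 16, 95825)], [(400, 1827632661280, 1120), (402,
      1827632661280, 1121), (4242, 1827632661280, 1121), (4754, 2927144289040, 1121), (8594,
      2927144289040, 1121), (9106, 4026655916560, 1121), (12946, 4026655916560, 1121), (13458,
      5126167540240, 1121), (17298, 5126167540240, 1121), (17810, 6225679102480, 1121), (20576,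
      7325189681680, 1105), (20577, 7325189681680, 1361), (21648, 6225679102480, 1105), (21650,
      6225679102480, 1121), (24657, 7325189681680, 1361), (24689, 8424684532240, 1361), (28769,
      8424684532240, 1361), (28801, 9523927724560, 1361), (32881, 9523927724560, 1361), (32913,
      10619144385040, 1361), (36992, 10619144385040, 1360), (36993, 10619144385040, 1361)])]

lemma fam10_ok : fam10.all famOK = true := by
  decide +kernel

/-- Certificates for the graphs of the class with 11 vertices. -/
def fam11 : List Ent :=
  [
    ((11, 1495144742810349840147840844225874343232745553331714), (1, 8, 1), [(5811, 26, 95554)],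
      []),
    ((11, 1119538821668198928809373794094757383778472009466626), (2, 7, 0), [(1782288, 6774, 104532),
      (1804133, 6689, 103472)], []),
    ((11, 1121000323305529831727577478927473666798127942010626), (2, 7, 1), [(1782288, 6774, 104532),
      (1804133, 418, 103472)], []),
    ((11, 1493683241173359219596558097856621434820521388999426), (2, 8, 0), [(6262, 417, 112976)],
      []),
    ((11, 1495144742810690122514761782689337717840177321543426), (2, 8, 1), [(6262, 26, 112976)],
      []),
    ((11, 932466612089838043559615854378409170564767851807618), (3, 6, 0), [(78352, 6757, 113012),
      (111120, 422, 104259), (112485, 425, 99376)], [(13474, 83191493112336, 880),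
      (17314, 83191493112336, 880)]),
    ((11, 933928113727168946477819539211125453584423784351618), (3, 6, 1), [(78352, 6757, 113012),
      (111120, 422, 104259), (112485, 425, 99376)], [(13474, 83191493112336, 881),
      (17314, 83191493112336, 881)]),
    ((11, 1119538821668198934001670652629585012308968338686850), (3, 7, 0), [(112485, 6562, 99376),
      (1782288, 422, 104276)], []),
    ((11, 1121000323305529836919874337462301295328624271230850), (3, 7, 1), [(112485, 6562, 99376),
      (1782288, 422, 104276)], []),
    ((11, 838930507300660256713529614832474639948592707863490), (4, 5, 0), [(78352, 6757, 113012),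
      (83296, 6808, 112433), (104993, 5989, 112704), (111393, 100197, 108864), (6757,
      384, 113009), (91459, 6416, 113266), (1791504, 26, 103474), (1794576, 26,
      103747), (113061, 16, 100193), (113253, 16, 104561), (6757, 440, 104208), (432,
      421, 103969)], [(4258, 30414934983456, 1120), (4770, 48007121027856, 1120), (8610,
      48007121027856, 1120), (9122, 65599307072016, 1120), (12962, 65599307072016, 1120),
      (13474, 83191493112336, 1120), (17314, 83191493112336, 1120), (17826, 100783679091216,
      1120), (21666, 100783679091216, 1120), (22178, 118375864087056, 1120), (24657,
      118375864087056, 1360), (24689, 135968033354256, 1360), (28769, 135968033354256, 1360),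
      (28801, 153559950963216, 1360), (32881, 153559950963216, 1360), (32913, 171147842040336,
      1360), (36993, 171147842040336, 1360), (37025, 188671308608016, 1360)]),
    ((11, 840392008937991159631733299665190922968248640407490), (4, 5, 1), [(78352, 6757, 113012),
      (83296, 6808, 112433), (1673061, 4897, 113216), (6262, 417, 112976), (6757,
      384, 113009), (91459, 6416, 113266), (1791504, 26, 103474), (1794576, 26,
      103747), (113061, 16, 100193), (113253, 16, 104561), (111393, 100197, 108864),
      (432, 421, 103969)], [(416, 30414934983456, 1120), (418, 30414934983456, 1121),
      (4258, 30414934983456, 1121), (4770, 48007121027856, 1121), (8610, 48007121027856,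
      1121), (9122, 65599307072016, 1121), (12962, 65599307072016, 1121), (13474,
      83191493112336, 1121), (17314, 83191493112336, 1121), (17826, 100783679091216, 1121),
      (21666, 100783679091216, 1121), (22178, 118375864087056, 1121), (24657, 118375864087056,
      1361), (24689, 135968033354256, 1361), (28769, 135968033354256, 1361), (28801,
      153559950963216, 1361), (32881, 153559950963216, 1361), (32913, 171147842040336, 1361),
      (36993, 171147842040336, 1361), (37025, 188671308608016, 1361), (41104, 188671308608016,
      1360), (41105, 188671308608016, 1361)]),
    ((11, 932466612089838043559695082540923434902361395758018), (4, 6, 0), [(78352, 6757, 113012),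
      (111120, 26, 104003), (7013, 6808, 95280)], [(13474, 83191493112336, 1136), (17314,
      83191493112336, 1136)]),
    ((11, 933928113727168946477898767373639717922017328302018), (4, 6, 1), [(78352, 6757, 113012),
      (111120, 26, 104003), (7013, 6808, 95280)], [(13474, 83191493112336, 1137), (17314,
      83191493112336, 1137)]),
    ((11, 838930507300660256713529616041400459563221882569698), (5, 5, 0), [(78352, 6757, 113012),
      (108935, 5200, 112177), (104993, 5989, 112704), (111393, 100197, 108864), (6416,
      5443, 113250), (111888, 26, 103474), (111696, 26, 103201), (113061, 16, 100193),
      (113253, 16, 104561), (5537, 391, 112992), (6564, 352, 112721)], [(4258,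
      30414934983456, 1376), (4770, 48007121027856, 1376), (8610, 48007121027856, 1376),
      (9122, 65599307072016, 1376), (12962, 65599307072016, 1376), (13474, 83191493112336,
      1376), (17314, 83191493112336, 1376), (17826, 100783679091216, 1376), (20576,
      118375864087056, 1360), (20577, 88039118834091, 1376), (21664, 100783679091216, 1360),
      (21666, 100783679091216, 1376), (24657, 88039118834091, 1376), (24689, 70446949566891,
      1376), (28769, 70446949566891, 1376), (28801, 52855031957931, 1376), (32881,
      52855031957931, 1376), (32913, 35267140880811, 1376), (36993, 35267140880811, 1376),
      (37025, 17743674313131, 1376)]),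
    ((11, 840392008937991159631733300874116742582877815113698), (5, 5, 1), [(78352, 6757, 113012),
      (108935, 5200, 112177), (100197, 6689, 112960), (87090, 6528, 113249), (111393,
      100197, 108864), (111888, 26, 103474), (111696, 26, 103201), (113061, 16, 100193),
      (113253, 16, 104561), (6564, 352, 112721)], [(416, 30414934983456, 1376), (418,
      30414934983456, 1377), (4258, 30414934983456, 1377), (4770, 48007121027856, 1377),
      (8610, 48007121027856, 1377), (9122, 65599307072016, 1377), (12962, 65599307072016,
      1377), (13474, 83191493112336, 1377), (17314, 83191493112336, 1377), (17826,
      100783679091216, 1377), (20576, 118375864087056, 1361), (20577, 88039118834091, 1377),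
      (21664, 100783679091216, 1361), (21666, 100783679091216, 1377), (24657, 88039118834091,
      1377), (24689, 70446949566891, 1377), (28769, 70446949566891, 1377), (28801,
      52855031957931, 1377), (32881, 52855031957931, 1377), (32913, 35267140880811, 1377),
      (36993, 35267140880811, 1377), (37025, 17743674313131, 1377), (41104, 17743674313131,
      1376), (41105, 17743674313131, 1377)])]

lemma fam11_ok : fam11.all famOK = true := by
  decide +kernel

/-- Certificates for the graphs of the class with 12 vertices. -/
def fam12 : List Ent :=
  [
    ((12, 196067391239440654970602273619885863523895576705431309314), (1, 9, 1), [], []),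
    ((12, 146931752914778468028095586491155460020008557597677651458), (2, 8, 0), [(5827, 27, 95554)],
      []),
    ((12, 147027533886082586081742983180352354343984728792814128642), (2, 8, 1), [(5827, 27, 95554)],
      []),
    ((12, 195971610268158837662153407553830504918192053871800813058), (2, 9, 0), [], []),
    ((12, 196067391239462955715800804243027399242168225066937290242), (2, 9, 1), [], []),
    ((12, 122411824260923549736356946895715803554287318813211166466), (3, 7, 0), [(1847824, 7030,
      108628), (1869669, 6834, 103472)], []),
    ((12, 122507605232227667790004343584912697878263490008347643650), (3, 7, 1), [(1847824, 7030,
      108628), (1869669, 6834, 103472)], []),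
    ((12, 146931752914778468368377953412093923483383165029445863170), (3, 8, 0), [(6262, 442,
      117072)], []),
    ((12, 147027533886082586422025350101290817807359336224582340354), (3, 8, 1), [(6262, 442,
      117072)], []),
    ((12, 110151859933996438858861539009092537929735479849828812674), (4, 6, 0), [(78352, 7013,
      117364), (115216, 438, 108355), (116581, 7081, 99376)], [(13490, 1349828888310288,
      1136), (17330, 1349828888310288, 1136)]),
    ((12, 110247640905300556912508935698289432253711651044965289858), (4, 6, 1), [(78352, 7013,
      117364), (115216, 438, 108355), (116581, 7081, 99376)], [(13490, 1349828888310288,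
      1137), (17330, 1349828888310288, 1137)]),
    ((12, 122411824260923549736362139192574338381915849309540386690), (4, 7, 0), [(116581, 105138,
      99376), (1847824, 438, 108372)], []),
    ((12, 122507605232227667790009535881771232705892020504676863874), (4, 7, 1), [(116581, 105138,
      99376), (1847824, 438, 108372)], []),
    ((12, 104021877770532883425427988720442634496161469376628066242), (5, 5, 0), [(1454608, 113304,
      116564), (1603156, 107024, 117651), (100197, 6833, 117056), (1673061, 115489,
      113216), (1262944, 113304, 116513), (1857040, 27, 107570), (1860112, 27, 107843),
      (1874613, 16, 100193), (1878885, 16, 104561), (7320, 7013, 108304), (117605,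
      384, 108913), (448, 437, 108065)], [(4274, 505403958182688, 1376), (4786,
      786878934893328, 1376), (8626, 786878934893328, 1376), (9138, 1068353911603728, 1376),
      (12978, 1068353911603728, 1376), (13490, 1349828888310288, 1376), (17330, 1349828888310288,
      1376), (17842, 1631303864955408, 1376), (21682, 1631303864955408, 1376), (22194,
      1912778840617488, 1376), (24657, 1690100861278908, 1376), (24689, 1408625901345468, 1376),
      (28769, 1408625901345468, 1376), (28801, 1127151193070268, 1376), (32881, 1127151193070268,
      1376), (32913, 845680511326908, 1376), (36993, 845680511326908, 1376), (37025,
      564274254092988, 1376), (41105, 564274254092988, 1376), (41137, 283898789010108, 1376)]),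
    ((12, 104117658741837001479075385409639528820137640571764543426), (5, 5, 1), [(1651216, 112485,
      117380), (25799474, 5472, 116545), (1463346, 416, 117617), (104566, 433, 117328),
      (1463346, 117400, 112400), (1857040, 27, 107570), (1860112, 27, 107843), (1874613,
      16, 100193), (1878885, 16, 104561), (117605, 384, 108913), (448, 437, 108065)],
      [(432, 505403958182688, 1376), (434, 505403958182688, 1377), (4274, 505403958182688,
      1377), (4786, 786878934893328, 1377), (8626, 786878934893328, 1377), (9138,
      1068353911603728, 1377), (12978, 1068353911603728, 1377), (13490, 1349828888310288, 1377),
      (17330, 1349828888310288, 1377), (17842, 1631303864955408, 1377), (21682, 1631303864955408,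
      1377), (22194, 1912778840617488, 1377), (24657, 1690100861278908, 1377), (24689,
      1408625901345468, 1377), (28769, 1408625901345468, 1377), (28801, 1127151193070268, 1377),
      (32881, 1127151193070268, 1377), (32913, 845680511326908, 1377), (36993, 845680511326908,
      1377), (37025, 564274254092988, 1377), (41105, 564274254092988, 1377), (41137,
      283898789010108, 1377), (45216, 283898789010108, 1376), (45217, 283898789010108, 1377)]),
    ((12, 110151859933996438858861539088320700443999817443372763074), (5, 6, 0), [(78352, 7013,
      117364), (115216, 27, 108099), (113304, 7269, 95280)], [(13490, 1349828888310288,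
      1392), (17330, 1349828888310288, 1392)]),
    ((12, 110247640905300556912508935777517594767975988638509240258), (5, 6, 1), [(78352, 7013,
      117364), (115216, 27, 108099), (113304, 7269, 95280)], [(13490, 1349828888310288,
      1393), (17330, 1349828888310288, 1393)])]

lemma fam12_ok : fam12.all famOK = true := by
  decide +kernel

/-- Certificates for the graphs of the class with 13 vertices. -/
def fam13 : List Ent :=
  [
    ((13, 25705222110490380904952563349932198373325819409207561338296322), (1, 10, 1), [], []),
    ((13, 19271192825734183917150831741100250906847726113140882199088130), (2, 9, 0), [], []),
    ((13, 19277469927469570597914667530523458573263828468585346233605122), (2, 9, 1), [], []),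
    ((13, 25698945008756455725826058463427194391742433336782753236323330), (2, 10, 0), [], []),
    ((13, 25705222110491842406589894252850402058158535692227217270840322), (2, 10, 1), [], []),
    ((13, 16057316737216112044515319573516161113036993630534929538682370), (3, 8, 0), [(5843, 28,
      95554)], []),
    ((13, 16063593838951498725279155362939368779453095985979393573199362), (3, 8, 1), [(5843, 28,
      95554)], []),
    ((13, 19271192825734183939451576939630874048383444385789243705069058), (3, 9, 0), [], []),
    ((13, 19277469927469570620215412729054081714799546741233707739586050), (3, 9, 1), [], []),
    ((13, 14450378692957121767579901188633755502632271619319045877468930), (4, 7, 0), [(1913360, 7286,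
      112724), (30762880, 450, 111665)], []),
    ((13, 14456655794692508448343736978056963169048373974763509911985922), (4, 7, 1), [(1913360, 7286,
      112724), (30762880, 450, 111665)], []),
    ((13, 16057316737216112044515659855883082051500457005142361306894082), (4, 8, 0), [(7354, 6262,
      121168)], []),
    ((13, 16063593838951498725279495645306289717916559360586825341411074), (4, 8, 1), [(7354, 6262,
      121168)], []),
    ((13, 13646909670827626629808898880007538501252031290045181303525250), (5, 6, 0), [(78352, 7269,
      121716), (119312, 454, 112451), (120677, 117673, 99376)], [(13506, 21897502188188176,
      1392), (17346, 21897502188188176, 1392)]),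
    ((13, 13653186772563013310572734669430746167668133645489645338042242), (5, 6, 1), [(78352, 7269,
      121716), (119312, 454, 112451), (120677, 117673, 99376)], [(13506, 21897502188188176,
      1393), (17346, 21897502188188176, 1393)]),
    ((13, 14450378692957121767579901193826052361167099247849542206689154), (5, 7, 0), [(1682370, 120677,
      99376), (1913360, 454, 112468)], []),
    ((13, 14456655794692508448343736983249260027583201603294006241206146), (5, 7, 1), [(1682370, 120677,
      99376), (1913360, 454, 112468)], []),
    ((13, 13646909670827626629808898880007617729414545554382774847475650), (6, 6, 0), [], []),
    ((13, 13653186772563013310572734669430825395830647909827238881992642), (6, 6, 1), [], [])]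

lemma fam13_ok : fam13.all famOK = true := by
  decide +kernel

/-- Certificates for the graphs of the class with 14 vertices. -/
def fam14 : List Ent :=
  [
    ((14, 3369646242328423772097800361862163019607141069467706430234709798914), (1, 11, 1), [], []),
    ((14, 2526736532056094041051886420671333942217973214608086885871516981250), (2, 10, 0), [], []),
    ((14, 2527147908195424342562425162966973279844218898574495280837354141698), (2, 10, 1), [], []),
    ((14, 3369234866189189251558565737620171078670092279825274206464009115650), (2, 11, 0), [], []),
    ((14, 3369646242328519553069104479915810416296337963791682601429846276098), (2, 11, 1), [], []),
    ((14, 2105487365381853323100302932510849206559928053931676439110813555714), (3, 9, 0), [], []),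
    ((14, 2105898741521183624610841674806488544186173737898084834076650716162), (3, 9, 1), [], []),
    ((14, 2526736532056094042513388058002236860421658047324369905527449525250), (3, 10, 0), [], []),
    ((14, 2527147908195424344023926800297876198047903731290778300493286685698), (3, 10, 1), [], []),
    ((14, 1894862782044738949521801473222344007769818794759315487506706013698), (4, 8, 0), [(5859, 29,
      95554)], []),
    ((14, 1895274158184069251032340215517983345396064478725723882472543174146), (4, 8, 1), [(5859, 29,
      95554)], []),
    ((14, 2105487365381853323100325233256047737183069589649949087472319536642), (4, 9, 0), [], []),
    ((14, 2105898741521183624610863975551687074809315273616357482438156697090), (4, 9, 1), [], []),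
    ((14, 1789550490376181762823880658285806126043969470857356902638975000322), (5, 7, 0), [(1978896,
      7542, 116820), (31811456, 466, 115761)], []),
    ((14, 1789961866515512064334419400581445463670215154823765297604812160770), (5, 7, 1), [(1978896,
      7542, 116820), (31811456, 466, 115761)], []),
    ((14, 1894862782044738949521801473562626374690757258222690094938474225410), (5, 8, 0), [(5859, 29,
      95554)], []),
    ((14, 1895274158184069251032340215858265712317002942189098489904311385858), (5, 8, 1), [(5859, 29,
      95554)], []),
    ((14, 1736894344541903169474921644401440806316263150051789051579177705346), (6, 6, 0), [], []),
    ((14, 1737305720681233470985460386697080143942508834018197446545014865794), (6, 6, 1), [], []),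
    ((14, 1789550490376181762823880658285811318340828005684985433135304220546), (6, 7, 0), [], []),
    ((14, 1789961866515512064334419400581450655967073689651393828101141380994), (6, 7, 1), [], [])]

lemma fam14_ok : fam14.all famOK = true := by
  decide +kernel

/-- Certificates for the graphs of the class with 15 vertices. -/
def fam15 : List Ent :=
  [
    ((15, 441693231809762171965896045506342155297283205156009791387810019999571970), (1, 12, 1), [], []),
    ((15, 331238330211608242996305293740900990306980625561856176686074251383746562), (2, 11, 0), [], []),
    ((15, 331265290158275393636099960755988009937654262706278717258555354994012162), (2, 11, 1), [], []),
    ((15, 441666271863101298427836765172018971456032775678003353170773380423823362), (2, 12, 0), [], []),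
    ((15, 441693231809768449067631432187105991086706412822425893743254484034088962), (2, 12, 1), [], []),
    ((15, 276024359437282163517174371476611881387412641064783382632084136721201154), (3, 10, 0), [], []),
    ((15, 276051319383949314156969038491698901018086278209205923204565240331466754), (3, 10, 1), [], []),
    ((15, 331238330211608243092086265045019043954377314758750500662245446520223746), (3, 11, 0), [], []),
    ((15, 331265290158275393731880932060106063585050951903173041234726550130489346), (3, 11, 1), [], []),
    ((15, 248417374050119908343491566703111597068677236561710971700410896974429186), (4, 9, 0), [], []),
    ((15, 248444333996787058983286233718198616699350873706133512272892000584694786), (4, 9, 1), [], []),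
    ((15, 276024359437282163517175832978249212290330844749616098915103792653745154), (4, 10, 0), [], []),
    ((15, 276051319383949314156970499993336231921004481894038639487584896264010754), (4, 10, 1), [], []),
    ((15, 234613881356538780768621689625448958636576090837697737791979296049675778), (5, 8, 0), [(5875,
      30, 95554)], []),
    ((15, 234640841303205931408416356640535978267249727982120278364460399659941378), (5, 8, 1), [(5875,
      30, 95554)], []),
    ((15, 248417374050119908343491566725412342267207859703246689973059258480410114), (5, 9, 0), [], []),
    ((15, 248444333996787058983286233740499361897881496847669230545540362090675714), (5, 9, 1), [], []),
    ((15, 227712135009748216981186933757597087166859247018606885043262113217593090), (6, 7, 0), [], []),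
    ((15, 227739094956415367620981600772684106797532884163029425615743216827858690), (6, 7, 1), [], []),
    ((15, 234613881356538780768621689625449298918943011776161201166586727817887490), (6, 8, 0), [], []),
    ((15, 234640841303205931408416356640536318549616648920583741739067831428153090), (6, 8, 1), [], []),
    ((15, 227712135009748216981186933757597087172051543877141712671792609546813314), (7, 7, 0), [], []),
    ((15, 227739094956415367620981600772684106802725181021564253244273713157078914), (7, 7, 1), [], [])]

lemma fam15_ok : fam15.all famOK = true := by
  decide +kernel

/-- Certificates for the exceptional graphs. -/
def excTab : List Ent :=
  [
    ((5, 276707635146073636894), (0, 0, 0), [(18, 16, 87089), (19, 17, 87072), (20,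
      16, 86817), (20, 18, 86800), (17, 16, 87090), (18, 17, 87088), (19,
      16, 87073), (20, 17, 86816), (19, 18, 87056), (20, 19, 86544)], [(288,
      3490320, 770), (304, 3482640, 770), (320, 3298320, 770), (560, 3481920, 770),
      (576, 3297600, 770), (832, 3282240, 770), (4128, 3490305, 770), (4144,
      3482625, 770), (4160, 3298305, 770), (4656, 152625, 770), (4672, 336945,
      770), (4928, 344625, 770), (8208, 3489825, 770), (8240, 3481665, 770),
      (8256, 3297345, 770), (8496, 152385, 770), (8512, 336705, 770), (9024,
      344865, 770), (12304, 3474465, 770), (12320, 3473985, 770), (12352, 3278145,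
      770), (12576, 144705, 770), (12608, 340545, 770), (12864, 341025, 770),
      (16400, 3167265, 770), (16416, 3166785, 770), (16432, 3155265, 770), (16672,
      206145, 770), (16688, 217665, 770), (16944, 218145, 770)]),
    ((6, 8462609866481485548617784), (0, 0, 0), [(20, 19, 90640), (21, 19, 90640),
      (21, 20, 90640), (17, 16, 91459), (18, 16, 91459), (18, 17, 91459)],
      [(833, 69273171, 1026), (834, 69211731, 1026), (849, 68290131, 1026), (850,
      67245651, 1026), (1105, 68167251, 1026), (1106, 67184211, 1026), (4929, 69273141,
      1026), (4930, 69211701, 1026), (4945, 68290101, 1026), (4946, 67245621, 1026),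
      (5201, 68167221, 1026), (5202, 67184181, 1026), (9025, 69272421, 1026), (9026,
      69210981, 1026), (9041, 68289381, 1026), (9042, 67244901, 1026), (9297, 68166501,
      1026), (9298, 67183461, 1026), (12305, 73740816, 1026), (12306, 73740801, 1026),
      (12321, 56967696, 1026), (12322, 73740321, 1026), (12577, 56967681, 1026), (12578,
      56967201, 1026), (16401, 73617936, 1026), (16402, 73617921, 1026), (16417, 56906256,
      1026), (16418, 73617441, 1026), (16673, 56906241, 1026), (16674, 56905761, 1026),
      (20497, 70668816, 1026), (20498, 70668801, 1026), (20513, 54940176, 1026), (20514,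
      70668321, 1026), (20769, 54940161, 1026), (20770, 54939681, 1026)]),
    ((6, 8462609866481494138814520), (0, 0, 0), [(18, 17, 91459), (304, 17, 91458),
      (304, 18, 91457), (320, 17, 91442), (320, 18, 91441), (336, 17, 91186),
      (336, 18, 91185), (352, 18, 87089), (352, 17, 87090), (20, 19, 90640),
      (21, 19, 90640), (21, 20, 90640)], [(833, 69273171, 1282), (834, 69211731,
      1282), (849, 68290131, 1282), (850, 67245651, 1282), (1105, 68167251, 1282), (1106,
      67184211, 1282), (4656, 56967201, 1026), (4672, 56905761, 1026), (4688, 54939681,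
      1026), (4928, 38162481, 1026), (4944, 40128561, 1026), (5200, 40190001, 1026),
      (8496, 56967681, 1026), (8512, 56906241, 1026), (8528, 54940161, 1026), (9024,
      38163201, 1026), (9040, 40129281, 1026), (9296, 40190721, 1026)]),
    ((6, 27806013276125919639765048), (0, 0, 0), [(21, 20, 90640), (18, 17, 91459),
      (355, 21, 82448), (355, 20, 86544), (305, 20, 91424), (305, 21, 91168),
      (306, 20, 91408), (306, 21, 91152), (352, 18, 87089), (352, 17, 87090),
      (304, 21, 91169), (304, 20, 91425), (304, 17, 91458), (304, 18, 91457),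
      (336, 17, 91186), (320, 17, 91442), (336, 18, 91185), (320, 18, 91441)],
      [(4656, 56967201, 1282), (5200, 40190001, 1282), (8496, 56967681, 1282), (9296,
      40190721, 1282), (16464, 67184211, 1282), (16672, 17049171, 1282), (20544, 68167251,
      1282), (20768, 20981331, 1282)]),
    ((7, 554605600283507761791030526072), (0, 0, 0), [(321, 16, 95827), (338, 320,
      95793), (370, 321, 91440), (369, 306, 91456), (306, 16, 95828), (321,
      306, 95824), (354, 320, 95537), (372, 354, 86800), (372, 338, 90896),
      (22, 21, 94736), (369, 304, 91458), (371, 353, 87072), (371, 337,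
      91168), (354, 321, 95536), (338, 321, 95792), (353, 306, 95552), (337,
      306, 95808), (370, 16, 91459), (369, 16, 91459)], [(832, 607131493, 1794),
      (1376, 1681004368, 1794)]),
    ((7, 3089984171992421901051618132088), (0, 0, 0), [(321, 16, 95827), (338, 320,
      95793), (5955, 21, 90640), (5955, 22, 86544), (354, 321, 95536), (353,
      306, 95552), (370, 321, 91440), (369, 306, 91456), (306, 16, 95828),
      (321, 306, 95824), (354, 320, 95537), (338, 321, 95792), (337, 306,
      95808), (369, 304, 91458), (370, 16, 91459), (369, 16, 91459)], [(832,
      607131493, 2050), (1376, 1681004368, 2050)]),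
    ((7, 554630988297576616566566748238), (0, 0, 0), [(304, 289, 95828), (321, 288,
      95827), (338, 272, 95811), (338, 304, 95809), (369, 338, 91184), (370,
      321, 91440), (5955, 18, 91408), (368, 338, 91185), (370, 304, 91457),
      (368, 321, 91442), (369, 304, 91458), (321, 304, 95826), (338, 321,
      95792), (5971, 17, 91168)], []),
    ((8, 135001699059822430033165416105574470), (0, 0, 0), [(352, 338, 99377), (20, 19,
      100197), (369, 352, 99378), (369, 338, 99376), (5904, 389, 91186), (5648,
      389, 95282), (5408, 391, 91185), (6176, 372, 91441), (6176, 371, 91457),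
      (390, 338, 82704), (390, 369, 82720), (391, 338, 82704), (391, 352,
      82721), (389, 369, 82720), (389, 352, 82721), (6177, 356, 95536), (6177,
      355, 95552), (5408, 372, 99889), (5408, 371, 99905), (5648, 340, 100146),
      (5648, 339, 100162), (5716, 369, 99104), (5715, 369, 99360)], []),
    ((8, 135001699059822577611621605409357894), (0, 0, 0), [(352, 338, 99377), (5408, 371,
      99905), (5648, 339, 100162), (5715, 369, 99360), (98832, 20, 95827),
      (98832, 19, 95828), (369, 352, 99378), (369, 338, 99376), (5904, 389,
      91186), (5648, 389, 95282), (5408, 391, 91185), (5408, 372, 99889), (5648,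
      340, 100146), (5716, 369, 99104), (390, 338, 82704), (390, 369, 82720),
      (391, 338, 82704), (391, 352, 82721), (389, 369, 82720), (389, 352,
      82721)], [])]

lemma excTab_ok : excTab.all excOK = true := by
  decide +kernel

end K24Paper

namespace K24Paper
open SimpleGraph

/-- The whole table of certificates for the class. -/
def famTab : List Ent :=
  fam4 ++ fam5 ++ fam6 ++ fam7 ++ fam8 ++ fam9 ++ fam10 ++ fam11 ++ fam12 ++ fam13 ++ fam14 ++ fam15

lemma famTab_ok : famTab.all famOK = true := by
  unfold famTab
  rw [List.all_append, List.all_append, List.all_append, List.all_append, List.all_append,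
    List.all_append, List.all_append, List.all_append, List.all_append, List.all_append,
    List.all_append, fam4_ok, fam5_ok, fam6_ok, fam7_ok, fam8_ok, fam9_ok, fam10_ok, fam11_ok,
    fam12_ok, fam13_ok, fam14_ok, fam15_ok]
  rfl

/-- Coverage of the parameters by the table. -/
def covB : Bool :=
  (List.range 16).all fun N => (List.range 13).all fun r => (List.range 13).all fun s =>
    (List.range 2).all fun p => !(gpB N r s p) || !(Nat.ble r s) ||
      famTab.any fun e => Nat.beq e.1.1 N && Nat.beq e.2.1.1 r && Nat.beq e.2.1.2.1 s &&
        Nat.beq e.2.1.2.2 p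

lemma covB_true : covB = true := by decide +kernel

lemma famTab_cov {N r s p : ℕ} (hN : N ≤ 15) (hP : GP N r s p) (hrs : r ≤ s) :
    ∃ M K I, maskOK N M (gB N r s p) = true ∧ chk N M r s K I = true := by
  have h := covB_true
  unfold covB at h
  simp only [List.all_eq_true, List.mem_range] at h
  have b : r < 13 ∧ s < 13 ∧ p < 2 := by
    unfold GP at hP
    omega
  have h2 := h N (by omega) r b.1 s b.2.1 p b.2.2
  rw [gpB_iff.2 hP, Nat.ble_eq.mpr hrs] at h2
  simp only [Bool.not_true, Bool.false_or, List.any_eq_true, Bool.and_eq_true, Nat.beq_eq] at h2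
  obtain ⟨⟨⟨N', M⟩, ⟨r', s', p'⟩, K, I⟩, he, ⟨⟨e1, e2⟩, e3⟩, e4⟩ := h2
  dsimp only at e1 e2 e3 e4
  subst e1 e2 e3 e4
  have h3 := List.all_eq_true.1 famTab_ok _ he
  unfold famOK at h3
  rw [Bool.and_eq_true] at h3
  exact ⟨M, K, I, h3.1, h3.2⟩

lemma excTab_cov : excTab.map (fun e => e.1) = excs := by decide +kernel

universe u

/-- The case of a vertex of degree three, contraction in the class. -/
lemma step_fam {V : Type u} [Finite V] {G : SimpleGraph V} {N r s p v c d : ℕ} {kc kd : Prop}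
    {k : V → ℕ} (IH : IHyp.{u} N) (hs : Sep3 G) (hm : ¬ IsMinor K24 G) (hP : GP N r s p)
    (hrs : r ≤ s) (h : LabBy G (N + 1) (spl (gAdj N r s p) N v c d kc kd) k)
    (hv : v < N) (hc : c < N) (hd : d < N) (hvc : v ≠ c) (hvd : v ≠ d) (hcd : c < d)
    (fc : gAdj N r s p v c) (fd : gAdj N r s p v d) : Good G := by
  have w1 : Win s v c d → Good G := window_good IH hs hm hP h hv hvc hvd
  have w2 : Win r (N - 1 - v) (N - 1 - c) (N - 1 - d) → Good G :=
    window_good IH hs hm hP.swap (split_rev h hv hc hd) (by omega) (by omega) (by omega)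
  by_cases hN : 16 ≤ N
  · rcases exists_win hN hP hrs hv hc hd fc fd with q | q
    · exact w1 q
    · exact w2 q
  · obtain ⟨M, K, I, h1, h2⟩ := famTab_cov (by omega) hP hrs
    have hN4 : 4 ≤ N := by
      unfold GP at hP
      omega
    refine chk_sound h2 (by omega) (by omega) hv hc hd hvc hvd hcd (f := gAdj N r s p) ?_
      (fun a b => gAdj_symm) fc fd hs hm h w1 w2
    intro a b ha hb
    rw [maskOK_sound h1 a b ha hb, gB_iff]

lemma step_exc {V : Type u} [Finite V] {G : SimpleGraph V} {N M v c d : ℕ} {kc kd : Prop}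
    {k : V → ℕ} (hs : Sep3 G) (hm : ¬ IsMinor K24 G) (he : (N, M) ∈ excs)
    {f : ℕ → ℕ → Prop} (hf : ∀ a b, f a b ↔ a < N ∧ b < N ∧ bitAdj M a b)
    (hsym : ∀ a b, f a b ↔ f b a)
    (h : LabBy G (N + 1) (spl f N v c d kc kd) k)
    (hv : v < N) (hc : c < N) (hd : d < N) (hvc : v ≠ c) (hvd : v ≠ d) (hcd : c < d)
    (fc : f v c) (fd : f v d) : Good G := by
  have hN : 3 ≤ N ∧ N ≤ 15 := by
    have : ∀ e ∈ excs, 3 ≤ e.1 ∧ e.1 ≤ 15 := by decide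
    exact this _ he
  rw [← excTab_cov, List.mem_map] at he
  obtain ⟨⟨⟨N', M'⟩, q, K, I⟩, h1, h2⟩ := he
  obtain ⟨rfl, rfl⟩ : N' = N ∧ M' = M := by simpa using h2
  have h3 := List.all_eq_true.1 excTab_ok _ h1
  unfold excOK at h3
  rw [Bool.and_eq_true] at h3
  refine chk_sound h3.2 hN.1 hN.2 hv hc hd hvc hvd hcd (f := f) ?_
      hsym fc fd hs hm h (fun hw => by have := hw.1; omega) (fun hw => by have := hw.1; omega)
  intro a b ha hb
  rw [maskOK_sound h3.1 a b ha hb, hf, bitAdj, tb_eq]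
  dsimp only
  tauto

lemma deg3_step {V : Type u} [Finite V] {G : SimpleGraph V} {N : ℕ} (IH : IHyp.{u} N)
    (hN : 4 ≤ N) (hcard : Nat.card V = N + 1) (hs : Sep3 G) (hm : ¬ IsMinor K24 G)
    {w a b c : V} (hd : Deg3 G w a b c) : Good G := by
  obtain ⟨u, c, d, hd, hs'⟩ := halin (by omega) hs hd
  have hcH : Nat.card {t : V // t ≠ w} = N := by
    classical
    have h1 : ({w}ᶜ : Set V).ncard = N := by
      rw [Set.ncard_compl, Set.ncard_singleton]
      omega
    rw [← h1]
    rfl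
  have hH := IH _ (contr G w u) hcH hs' (fun h => hm (isMinor_of_contr hd.1 h))
  rcases hH with ⟨N', r, s, p, l, hP, hl⟩ | ⟨⟨N', M⟩, he, l, hl⟩
  · obtain rfl : N' = N := hl.2.2.1.symm.trans hcH
    have main : ∀ r s l, GP N' r s p → LabBy (contr G w u) N' (gAdj N' r s p) l → r ≤ s →
        Good G := by
      intro r s l hP hl hrs
      obtain ⟨k, h, -, hu, hc, hd', n1, n2, n3, f1, f2⟩ := split_lab hd hl hcard
      rcases lt_or_gt_of_ne n3 with q | q
      · exact step_fam IH hs hm hP hrs h hu hc hd' n1 n2 q f1 f2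
      · refine step_fam IH hs hm hP hrs (kc := G.Adj u d) (kd := G.Adj u c) (k := k)
          ⟨h.1, h.2.1, h.2.2.1, fun a b => (h.2.2.2 a b).trans spl_comm⟩ hu hd' hc n2 n1 q f2 f1
    rcases le_total r s with q | q
    · exact main r s l hP hl q
    · exact main s r _ hP.swap hl.rev q
  · obtain rfl : N' = N := hl.2.2.1.symm.trans hcH
    have hl' : LabBy (contr G w u) N' (fun a b => a < N' ∧ b < N' ∧ bitAdj M a b) l := by
      refine ⟨hl.1, hl.2.1, hl.2.2.1, fun a b => ?_⟩
      have h1 := hl.2.1 a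
      have h2 := hl.2.1 b
      have h3 := hl.2.2.2 a b
      dsimp only at h1 h2 h3 ⊢
      tauto
    have hsym : ∀ a b, (a < N' ∧ b < N' ∧ bitAdj M a b) ↔ (b < N' ∧ a < N' ∧ bitAdj M b a) := by
      have : ∀ a b, (a < N' ∧ b < N' ∧ bitAdj M a b) → (b < N' ∧ a < N' ∧ bitAdj M b a) := by
        rintro a b ⟨h1, h2, h3⟩
        obtain ⟨x, rfl⟩ := hl.surj a h1
        obtain ⟨y, rfl⟩ := hl.surj b h2
        exact ⟨h2, h1, (hl.2.2.2 _ _).1 ((hl.2.2.2 x y).2 h3).symm⟩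
      exact fun a b => ⟨this a b, this b a⟩
    obtain ⟨k, h, -, hu, hc, hd', n1, n2, n3, f1, f2⟩ := split_lab hd hl' hcard
    rcases lt_or_gt_of_ne n3 with q | q
    · exact step_exc hs hm he (fun a b => Iff.rfl) hsym h hu hc hd' n1 n2 q f1 f2
    · exact step_exc hs hm he (fun a b => Iff.rfl) hsym (kc := G.Adj u d) (kd := G.Adj u c) (k := k)
          ⟨h.1, h.2.1, h.2.2.1, fun a b => (h.2.2.2 a b).trans spl_comm⟩ hu hd' hc n2 n1 q f2 f1

end K24Paper

namespace K24Paper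
open SimpleGraph

/-- Every vertex has a neighbour outside any three given vertices. -/
def Min4 {V : Type*} (G : SimpleGraph V) : Prop :=
  ∀ t x y z, ∃ b, G.Adj t b ∧ b ≠ x ∧ b ≠ y ∧ b ≠ z

lemma min4_or_deg3 {V : Type*} [Finite V] {G : SimpleGraph V} (hc : 3 < Nat.card V) (hs : Sep3 G) :
    Min4 G ∨ ∃ w a b c, Deg3 G w a b c := by
  by_contra hcon
  push Not at hcon
  obtain ⟨h1, h2⟩ := hcon
  unfold Min4 at h1
  push Not at h1
  obtain ⟨t, x, y, z, h⟩ := h1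
  apply h2 t x y z
  obtain ⟨b1, a1, n1, m1⟩ := exists_nbr_ne hc hs t x y
  obtain ⟨b2, a2, n2, m2⟩ := exists_nbr_ne hc hs t x z
  obtain ⟨b3, a3, n3, m3⟩ := exists_nbr_ne hc hs t y z
  have h1 := h b1 a1
  have h2 := h b2 a2
  have h3 := h b3 a3
  unfold Deg3
  grind

lemma minor_of_common {V : Type*} {G : SimpleGraph V} {x y a b c d : V} (hxy : x ≠ y)
    (h1 : a ≠ b) (h2 : a ≠ c) (h3 : a ≠ d) (h4 : b ≠ c) (h5 : b ≠ d) (h6 : c ≠ d)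
    (xa : G.Adj x a) (xb : G.Adj x b) (xc : G.Adj x c) (xd : G.Adj x d)
    (ya : G.Adj y a) (yb : G.Adj y b) (yc : G.Adj y c) (yd : G.Adj y d) : IsMinor K24 G := by
  have hx : ∀ i, G.Adj (![a, b, c, d] i) x := by
    intro i
    fin_cases i
    exacts [xa.symm, xb.symm, xc.symm, xd.symm]
  have hy : ∀ i, G.Adj (![a, b, c, d] i) y := by
    intro i
    fin_cases i
    exacts [ya.symm, yb.symm, yc.symm, yd.symm]
  refine minor_of_std (ConnSet.single x) (ConnSet.single y) ?_ ![a, b, c, d]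
    (inj4 h1 h2 h3 h4 h5 h6) (fun i => ?_) (fun i => ?_) (fun i => ⟨x, rfl, hx i⟩)
    (fun i => ⟨y, rfl, hy i⟩)
  · rintro _ rfl
    exact hxy
  · exact (hx i).ne
  · exact (hy i).ne

lemma exhaust {V : Type*} [Finite V] (l : List V) (hl : l.Nodup) (hc : Nat.card V = l.length)
    (x : V) : x ∈ l := by
  classical
  by_contra hx
  have : Fintype V := Fintype.ofFinite V
  have h1 : (x :: l).Nodup := List.nodup_cons.2 ⟨hx, hl⟩
  have h2 := h1.length_le_card
  rw [Nat.card_eq_fintype_card] at hc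
  simp at h2
  omega

lemma exists_out {V : Type*} [Finite V] (l : List V) (hc : l.length < Nat.card V) :
    ∃ x, x ∉ l := by
  classical
  by_contra hx
  push Not at hx
  have : Fintype V := Fintype.ofFinite V
  rw [Nat.card_eq_fintype_card] at hc
  have h2 : (Finset.univ : Finset V) ⊆ l.toFinset := fun x _ => List.mem_toFinset.2 (hx x)
  have h3 := Finset.card_le_card h2
  have h4 := List.toFinset_card_le l
  rw [Finset.card_univ] at h3
  omega

lemma four_nbrs {V : Type*} {G : SimpleGraph V} (h : Min4 G) (t : V) :
    ∃ a b c d, a ≠ b ∧ a ≠ c ∧ a ≠ d ∧ b ≠ c ∧ b ≠ d ∧ c ≠ d ∧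
      G.Adj t a ∧ G.Adj t b ∧ G.Adj t c ∧ G.Adj t d := by
  obtain ⟨a, ha, -⟩ := h t t t t
  obtain ⟨b, hb, b1, -⟩ := h t a a a
  obtain ⟨c, hc, c1, c2, -⟩ := h t a b b
  obtain ⟨d, hd, d1, d2, d3⟩ := h t a b c
  exact ⟨a, b, c, d, b1.symm, c1.symm, d1.symm, c2.symm, d2.symm, d3.symm, ha, hb, hc, hd⟩

lemma good_K5 {V : Type*} [Finite V] {G : SimpleGraph V} (hc : Nat.card V = 5) (h : Min4 G) :
    Good G := by
  have hcomp : ∀ x y, G.Adj x y ↔ x ≠ y := by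
    intro x y
    refine ⟨fun h => h.ne, fun hxy => ?_⟩
    obtain ⟨a, b, c, d, h1, h2, h3, h4, h5, h6, xa, xb, xc, xd⟩ := four_nbrs h x
    have := exhaust [x, a, b, c, d] (by
      simp [h1, h2, h3, h4, h5, h6, xa.ne, xb.ne, xc.ne, xd.ne]) (by simpa using hc) y
    simp at this
    rcases this with rfl | rfl | rfl | rfl | rfl
    · exact absurd rfl hxy
    all_goals assumption
  have e : V ≃ Fin 5 := Finite.equivFinOfCardEq hc
  refine Or.inr ⟨(5, 276707635146073636894), by decide, fun v => (e v).1, ?_⟩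
  refine ⟨fun a b hab => e.injective (Fin.ext hab), fun v => (e v).2, hc, fun a b => ?_⟩
  rw [hcomp, ← e.injective.ne_iff]
  show e a ≠ e b ↔ bitAdj 276707635146073636894 (e a).1 (e b).1
  unfold bitAdj
  generalize e a = i
  generalize e b = j
  revert i j
  decide

lemma min4_complete {V : Type*} [Finite V] {G : SimpleGraph V} (hc : 6 ≤ Nat.card V) (h : Min4 G)
    (hcomp : ∀ x y, x ≠ y → G.Adj x y) : IsMinor K24 G := by
  have : Nonempty V := (Nat.card_pos_iff.1 (by omega)).1
  obtain ⟨x⟩ := this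
  obtain ⟨a, b, c, d, h1, h2, h3, h4, h5, h6, xa, xb, xc, xd⟩ := four_nbrs h x
  obtain ⟨y, hy⟩ := exists_out [x, a, b, c, d] (by simp; omega)
  simp only [List.mem_cons, not_or, List.not_mem_nil, not_false_eq_true, and_true] at hy
  obtain ⟨y1, y2, y3, y4, y5⟩ := hy
  exact minor_of_common (Ne.symm y1) h1 h2 h3 h4 h5 h6 xa xb xc xd (hcomp _ _ y2) (hcomp _ _ y3)
    (hcomp _ _ y4) (hcomp _ _ y5)

lemma min4_six {V : Type*} [Finite V] {G : SimpleGraph V} (hc : Nat.card V = 6) (h : Min4 G) :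
    IsMinor K24 G := by
  by_cases hcomp : ∀ x y, x ≠ y → G.Adj x y
  · exact min4_complete hc.ge h hcomp
  push Not at hcomp
  obtain ⟨x, y, hxy, hn⟩ := hcomp
  obtain ⟨a, b, c, d, h1, h2, h3, h4, h5, h6, xa, xb, xc, xd⟩ := four_nbrs h x
  have ya : y ≠ a := fun e => hn (e ▸ xa)
  have yb : y ≠ b := fun e => hn (e ▸ xb)
  have yc : y ≠ c := fun e => hn (e ▸ xc)
  have yd : y ≠ d := fun e => hn (e ▸ xd)
  have hn' : ¬ G.Adj y x := fun e => hn e.symm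
  have hex : ∀ t, t = x ∨ t = y ∨ t = a ∨ t = b ∨ t = c ∨ t = d := by
    intro t
    have := exhaust [x, y, a, b, c, d] (by
      simp [hxy, ya, yb, yc, yd, h1, h2, h3, h4, h5, h6, xa.ne, xb.ne, xc.ne, xd.ne])
      (by simpa using hc) t
    simpa using this
  have key : ∀ p q r m, G.Adj y m → m ≠ p → m ≠ q → m ≠ r → m ≠ x ∧ m ≠ y :=
    fun p q r m hm _ _ _ => ⟨fun e => hn' (e ▸ hm), hm.ne'⟩
  obtain ⟨m1, e1, f1⟩ := h y b c d
  obtain ⟨m2, e2, f2⟩ := h y a c d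
  obtain ⟨m3, e3, f3⟩ := h y a b d
  obtain ⟨m4, e4, f4⟩ := h y a b c
  have k1 := key _ _ _ _ e1 f1.1 f1.2.1 f1.2.2
  have k2 := key _ _ _ _ e2 f2.1 f2.2.1 f2.2.2
  have k3 := key _ _ _ _ e3 f3.1 f3.2.1 f3.2.2
  have k4 := key _ _ _ _ e4 f4.1 f4.2.1 f4.2.2
  have r1 : m1 = a := by have := hex m1; tauto
  have r2 : m2 = b := by have := hex m2; tauto
  have r3 : m3 = c := by have := hex m3; tauto
  have r4 : m4 = d := by have := hex m4; tauto
  subst r1 r2 r3 r4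
  exact minor_of_common hxy h1 h2 h3 h4 h5 h6 xa xb xc xd e1 e2 e3 e4

/-- The order seven configuration with `y` not adjacent to `d`. -/
lemma min4_seven_aux {V : Type*} {G : SimpleGraph V} (h : Min4 G) {x y a b c d e : V}
    (hxy : x ≠ y) (hn : ¬ G.Adj x y) (h1 : a ≠ b) (h2 : a ≠ c) (h3 : a ≠ d) (h4 : b ≠ c)
    (h5 : b ≠ d) (h6 : c ≠ d) (xa : G.Adj x a) (xb : G.Adj x b) (xc : G.Adj x c) (xd : G.Adj x d)
    (hea : e ≠ a) (heb : e ≠ b) (hec : e ≠ c) (hed : e ≠ d)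
    (hey : e ≠ y) (hex' : e ≠ x)
    (hex : ∀ t, t = x ∨ t = y ∨ t = a ∨ t = b ∨ t = c ∨ t = d ∨ t = e)
    (hyd : ¬ G.Adj y d) : IsMinor K24 G := by
  have hn' : ¬ G.Adj y x := fun e => hn e.symm
  have key : ∀ p q r, ∃ m, G.Adj y m ∧ m ≠ p ∧ m ≠ q ∧ m ≠ r ∧ m ≠ x ∧ m ≠ y ∧ m ≠ d := by
    intro p q r
    obtain ⟨m, hm, q1, q2, q3⟩ := h y p q r
    exact ⟨m, hm, q1, q2, q3, fun e => hn' (e ▸ hm), hm.ne', fun e => hyd (e ▸ hm)⟩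
  have ya : G.Adj y a := by
    obtain ⟨m, hm, q⟩ := key b c e
    have := hex m
    have : m = a := by tauto
    rwa [this] at hm
  have yb : G.Adj y b := by
    obtain ⟨m, hm, q⟩ := key a c e
    have := hex m
    have : m = b := by tauto
    rwa [this] at hm
  have yc : G.Adj y c := by
    obtain ⟨m, hm, q⟩ := key a b e
    have := hex m
    have : m = c := by tauto
    rwa [this] at hm
  have ye : G.Adj y e := by
    obtain ⟨m, hm, q⟩ := key a b c
    have := hex m
    have : m = e := by tauto
    rwa [this] at hm
  by_cases hxe : G.Adj x e
  · exact minor_of_common hxy h1 h2 hea.symm h4 heb.symm hec.symm xa xb xc hxe ya yb yc ye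
  by_cases hde : G.Adj d e
  · have hA : ∀ i, G.Adj (![a, b, c, d] i) x := by
      intro i
      fin_cases i
      exacts [xa.symm, xb.symm, xc.symm, xd.symm]
    have hyd' : y ≠ d := fun e => hn (e ▸ xd)
    refine minor_of_std (ConnSet.single x) (ConnSet.pair ye) ?_ ![a, b, c, d]
      (inj4 h1 h2 h3 h4 h5 h6) (fun i => (hA i).ne) ?_ (fun i => ⟨x, rfl, hA i⟩) ?_
    · rintro _ rfl
      simp [hxy, hex'.symm]
    · intro i
      fin_cases i <;> simp [ya.ne', yb.ne', yc.ne', hyd'.symm, hea.symm, heb.symm, hec.symm, hed.symm]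
    · intro i
      fin_cases i
      · exact ⟨y, by simp, ya.symm⟩
      · exact ⟨y, by simp, yb.symm⟩
      · exact ⟨y, by simp, yc.symm⟩
      · exact ⟨e, by simp, hde⟩
  · have hde' : ¬ G.Adj e d := fun q => hde q.symm
    have hdy : ¬ G.Adj d y := fun q => hyd q.symm
    have hxe' : ¬ G.Adj e x := fun q => hxe q.symm
    have keyd : ∀ q, ∃ m, G.Adj d m ∧ m ≠ q ∧ m ≠ x ∧ m ≠ c ∧ m ≠ y ∧ m ≠ d ∧ m ≠ e := by
      intro q
      obtain ⟨m, hm, q1, q2, q3⟩ := h d q x c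
      exact ⟨m, hm, q1, q2, q3, fun e => hdy (e ▸ hm), hm.ne', fun e => hde (e ▸ hm)⟩
    have keye : ∀ q, ∃ m, G.Adj e m ∧ m ≠ q ∧ m ≠ y ∧ m ≠ c ∧ m ≠ x ∧ m ≠ d ∧ m ≠ e := by
      intro q
      obtain ⟨m, hm, q1, q2, q3⟩ := h e q y c
      exact ⟨m, hm, q1, q2, q3, fun e => hxe' (e ▸ hm), fun e => hde' (e ▸ hm), hm.ne'⟩
    have da : G.Adj d a := by
      obtain ⟨m, hm, q⟩ := keyd b
      have := hex m
      have : m = a := by tauto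
      rwa [this] at hm
    have db : G.Adj d b := by
      obtain ⟨m, hm, q⟩ := keyd a
      have := hex m
      have : m = b := by tauto
      rwa [this] at hm
    have ea : G.Adj e a := by
      obtain ⟨m, hm, q⟩ := keye b
      have := hex m
      have : m = a := by tauto
      rwa [this] at hm
    have eb : G.Adj e b := by
      obtain ⟨m, hm, q⟩ := keye a
      have := hex m
      have : m = b := by tauto
      rwa [this] at hm
    exact minor_of_common h1 xd.ne hxy hex'.symm (fun e => hn (e ▸ xd)) hed.symm hey.symm
      xa.symm da.symm ya.symm ea.symm xb.symm db.symm yb.symm eb.symm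

lemma min4_seven {V : Type*} [Finite V] {G : SimpleGraph V} (hc : Nat.card V = 7) (h : Min4 G) :
    IsMinor K24 G := by
  by_cases hcomp : ∀ x y, x ≠ y → G.Adj x y
  · exact min4_complete (by omega) h hcomp
  push Not at hcomp
  obtain ⟨x, y, hxy, hn⟩ := hcomp
  obtain ⟨a, b, c, d, h1, h2, h3, h4, h5, h6, xa, xb, xc, xd⟩ := four_nbrs h x
  have ya : y ≠ a := fun e => hn (e ▸ xa)
  have yb : y ≠ b := fun e => hn (e ▸ xb)
  have yc : y ≠ c := fun e => hn (e ▸ xc)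
  have yd : y ≠ d := fun e => hn (e ▸ xd)
  obtain ⟨e, he⟩ := exists_out [x, y, a, b, c, d] (by simp; omega)
  simp only [List.mem_cons, not_or, List.not_mem_nil, not_false_eq_true, and_true] at he
  obtain ⟨ex, ey, ea, eb, ec, ed⟩ := he
  have hex : ∀ t, t = x ∨ t = y ∨ t = a ∨ t = b ∨ t = c ∨ t = d ∨ t = e := by
    intro t
    have := exhaust [x, y, a, b, c, d, e] (by
      simp [hxy, ya, yb, yc, yd, h1, h2, h3, h4, h5, h6, xa.ne, xb.ne, xc.ne, xd.ne,
        Ne.symm ex, Ne.symm ey, Ne.symm ea, Ne.symm eb, Ne.symm ec, Ne.symm ed])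
      (by simpa using hc) t
    simpa using this
  by_cases qa : G.Adj y a
  · by_cases qb : G.Adj y b
    · by_cases qc : G.Adj y c
      · by_cases qd : G.Adj y d
        · exact minor_of_common hxy h1 h2 h3 h4 h5 h6 xa xb xc xd qa qb qc qd
        · exact min4_seven_aux h hxy hn h1 h2 h3 h4 h5 h6 xa xb xc xd ea eb ec ed ey ex hex qd
      · exact min4_seven_aux h hxy hn h1 h3 h2 h5 h4 h6.symm xa xb xd xc ea eb ed ec ey ex
          (fun t => by have := hex t; tauto) qc
    · exact min4_seven_aux h hxy hn h3 h2 h1 h6.symm h5.symm h4.symm xa xd xc xb ea ed ec eb ey ex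
          (fun t => by have := hex t; tauto) qb
  · exact min4_seven_aux h hxy hn h5.symm h6.symm h3.symm h4 h1.symm h2.symm xd xb xc xa ed eb ec ea
      ey ex (fun t => by have := hex t; tauto) qa

/-- A vertex of degree three of the contraction is a common neighbour. -/
lemma common_of_three {V : Type*} {G : SimpleGraph V} (h : Min4 G) {w u t a b c : V}
    (hwu : G.Adj w u) (htw : t ≠ w) (htu : t ≠ u)
    (hn : ∀ x (hx : x ≠ w), (contr G w u).Adj ⟨t, htw⟩ ⟨x, hx⟩ → x = a ∨ x = b ∨ x = c) :
    G.Adj w t ∧ G.Adj u t := by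
  have hw : G.Adj t w := by
    obtain ⟨m, hm, q1, q2, q3⟩ := h t a b c
    by_cases hmw : m = w
    · rwa [hmw] at hm
    · have := hn m hmw (contr_adj_of htw hmw hm)
      tauto
  have hu := hn u hwu.ne' ((contr_adj_u hwu htw htu).2 (Or.inr hw.symm)).symm
  have key : ∀ b c, (∀ x (hx : x ≠ w), (contr G w u).Adj ⟨t, htw⟩ ⟨x, hx⟩ → x = u ∨ x = b ∨ x = c) →
      G.Adj t u := by
    intro b c hn
    obtain ⟨m, hm, q1, q2, q3⟩ := h t w b c
    have := hn m q1 (contr_adj_of htw q1 hm)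
    have : m = u := by tauto
    rwa [this] at hm
  refine ⟨hw.symm, ?_⟩
  rcases hu with rfl | rfl | rfl
  · exact (key b c hn).symm
  · exact (key a c (fun x hx q => by have := hn x hx q; tauto)).symm
  · exact (key a b (fun x hx q => by have := hn x hx q; tauto)).symm

lemma common_of_lab {V : Type*} [Finite V] {G : SimpleGraph V} (h : Min4 G) {w u : V} {N : ℕ}
    {f : ℕ → ℕ → Prop} {l : {x : V // x ≠ w} → ℕ}
    (hwu : G.Adj w u) (hl : LabBy (contr G w u) N f l) {i j1 j2 j3 : ℕ} (hi : i < N)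
    (hiu : i ≠ l ⟨u, hwu.ne'⟩) (h1 : j1 < N) (h2 : j2 < N) (h3 : j3 < N)
    (hf : ∀ j, j < N → f i j → j = j1 ∨ j = j2 ∨ j = j3) :
    ∃ t, ∃ ht : t ≠ w, l ⟨t, ht⟩ = i ∧ G.Adj w t ∧ G.Adj u t := by
  obtain ⟨⟨t, ht⟩, rfl⟩ := hl.surj i hi
  obtain ⟨⟨a, ha⟩, rfl⟩ := hl.surj j1 h1
  obtain ⟨⟨b, hb⟩, rfl⟩ := hl.surj j2 h2
  obtain ⟨⟨c, hc⟩, rfl⟩ := hl.surj j3 h3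
  refine ⟨t, ht, rfl, common_of_three h hwu ht (a := a) (b := b) (c := c) ?_ ?_⟩
  · rintro rfl
    exact hiu rfl
  · intro x hx hadj
    have := hf _ (hl.2.1 ⟨x, hx⟩) ((hl.2.2.2 _ _).1 hadj)
    simpa [hl.1.eq_iff] using this

lemma min4_far {V : Type*} [Finite V] {G : SimpleGraph V} (h : Min4 G) {w u : V} {N : ℕ}
    {f : ℕ → ℕ → Prop} {l : {x : V // x ≠ w} → ℕ}
    (hwu : G.Adj w u) (hl : LabBy (contr G w u) N f l) {i j1 j2 j3 : ℕ} (hi : i < N)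
    (hiu : i ≠ l ⟨u, hwu.ne'⟩) (h1 : j1 < N) (h2 : j2 < N) (h3 : j3 < N)
    (hf : ∀ j, j < N → f i j → j = j1 ∨ j = j2 ∨ j = j3)
    (hn : ¬ f (l ⟨u, hwu.ne'⟩) i) : False := by
  obtain ⟨t, ht, rfl, -, h5⟩ := common_of_lab h hwu hl hi hiu h1 h2 h3 hf
  exact hn ((hl.2.2.2 _ _).1 (contr_adj_of hwu.ne' ht h5))

lemma gAdj_three {N r s p t j : ℕ} (hP : GP N r s p) (h1 : 1 ≤ t) (h2 : t + 2 ≤ N)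
    (h3 : r + s + 2 = N ∨ t ≠ s) (hj : j < N) (h : gAdj N r s p t j) :
    j = t - 1 ∨ j = t + 1 ∨ j = if t ≤ s then N - 1 else 0 := by
  unfold GP at hP
  unfold gAdj gh at h
  split_ifs <;> omega

lemma min4_fam {V : Type*} [Finite V] {G : SimpleGraph V} (h : Min4 G) {w u : V} {N r s p : ℕ}
    (hN : 7 ≤ N) {l : {x : V // x ≠ w} → ℕ} (hP : GP N r s p)
    (hwu : G.Adj w u) (hl : LabBy (contr G w u) N (gAdj N r s p) l) : IsMinor K24 G := by
  obtain ⟨τ, hτ⟩ : ∃ τ : ℕ → ℕ, ∀ j, τ j = if r + s + 1 = N ∧ s ≤ j then j + 1 else j :=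
    ⟨_, fun j => rfl⟩
  have hrs : r + s + 2 = N ∨ (r + s + 1 = N ∧ 2 ≤ s) := by
    unfold GP at hP
    omega
  have ht : ∀ j, 1 ≤ j → j ≤ 4 → 1 ≤ τ j ∧ τ j + 2 ≤ N ∧ (r + s + 2 = N ∨ τ j ≠ s) := by
    intro j h1 h2
    rw [hτ]
    split_ifs <;> omega
  have hcm : ∀ j, 1 ≤ j → j ≤ 4 → τ j ≠ l ⟨u, hwu.ne'⟩ →
      ∃ t, ∃ ht : t ≠ w, l ⟨t, ht⟩ = τ j ∧ G.Adj w t ∧ G.Adj u t := by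
    intro j h1 h2 hne
    obtain ⟨q1, q2, q3⟩ := ht j h1 h2
    exact common_of_lab h hwu hl (by omega) hne (j1 := τ j - 1) (j2 := τ j + 1)
      (j3 := if τ j ≤ s then N - 1 else 0) (by omega) (by omega) (by split_ifs <;> omega)
      (fun i hi => gAdj_three hP q1 q2 q3 hi)
  have hv := hl.2.1 ⟨u, hwu.ne'⟩
  have hfar : ∀ j, 1 ≤ j → j ≤ 4 → (l ⟨u, hwu.ne'⟩ + 1 < τ j ∨ τ j + 1 < l ⟨u, hwu.ne'⟩) →
      1 ≤ l ⟨u, hwu.ne'⟩ → l ⟨u, hwu.ne'⟩ + 2 ≤ N → False := by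
    intro j h1 h2 h3 h4 h5
    obtain ⟨q1, q2, q3⟩ := ht j h1 h2
    refine min4_far h hwu hl (i := τ j) (j1 := τ j - 1) (j2 := τ j + 1)
      (j3 := if τ j ≤ s then N - 1 else 0) (by omega) (by omega) (by omega) (by omega)
      (by split_ifs <;> omega) (fun i hi => gAdj_three hP q1 q2 q3 hi) ?_
    unfold gAdj gh
    omega
  have t1 := hτ 1
  have t2 := hτ 2
  have t3 := hτ 3
  have t4 := hτ 4
  obtain ⟨a1, b1, -⟩ := ht 1 (by omega) (by omega)
  obtain ⟨a2, b2, -⟩ := ht 2 (by omega) (by omega)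
  obtain ⟨a3, b3, -⟩ := ht 3 (by omega) (by omega)
  obtain ⟨a4, b4, -⟩ := ht 4 (by omega) (by omega)
  have o12 : τ 1 < τ 2 := by
    rw [t1, t2]
    split_ifs <;> omega
  have o23 : τ 2 < τ 3 := by
    rw [t2, t3]
    split_ifs <;> omega
  have o34 : τ 3 < τ 4 := by
    rw [t3, t4]
    split_ifs <;> omega
  by_cases hhub : 1 ≤ l ⟨u, hwu.ne'⟩ ∧ l ⟨u, hwu.ne'⟩ + 2 ≤ N
  · exfalso
    by_cases q : τ 1 + 1 < l ⟨u, hwu.ne'⟩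
    · exact hfar 1 (by omega) (by omega) (Or.inr q) hhub.1 hhub.2
    · exact hfar 4 (by omega) (by omega) (Or.inl (by omega)) hhub.1 hhub.2
  · obtain ⟨x1, y1, e1, c1, d1⟩ := hcm 1 (by omega) (by omega) (by omega)
    obtain ⟨x2, y2, e2, c2, d2⟩ := hcm 2 (by omega) (by omega) (by omega)
    obtain ⟨x3, y3, e3, c3, d3⟩ := hcm 3 (by omega) (by omega) (by omega)
    obtain ⟨x4, y4, e4, c4, d4⟩ := hcm 4 (by omega) (by omega) (by omega)
    refine minor_of_common hwu.ne ?_ ?_ ?_ ?_ ?_ ?_ c1 c2 c3 c4 d1 d2 d3 d4 <;>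
    · rintro rfl
      omega

lemma exc_far : ∀ e ∈ excs, 7 ≤ e.1 → ∀ v ∈ List.range e.1, ∃ i ∈ List.range e.1, i ≠ v ∧
    ¬ (e.2.testBit (16 * v + i) = true) ∧ ∃ a ∈ List.range e.1, ∃ b ∈ List.range e.1,
      ∃ c ∈ List.range e.1, ∀ j ∈ List.range e.1,
        e.2.testBit (16 * i + j) = true → j = a ∨ j = b ∨ j = c := by
  decide +kernel

lemma min4_exc {V : Type*} [Finite V] {G : SimpleGraph V} (h : Min4 G) {w u : V} {e : ℕ × ℕ}
    (he : e ∈ excs) (hN : 7 ≤ e.1) {l : {x : V // x ≠ w} → ℕ}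
    (hwu : G.Adj w u) (hl : LabBy (contr G w u) e.1 (bitAdj e.2) l) : False := by
  obtain ⟨i, hi, hiv, hn, a, ha, b, hb, c, hc, hf⟩ := exc_far e he hN _
    (List.mem_range.2 (hl.2.1 ⟨u, hwu.ne'⟩))
  rw [List.mem_range] at hi ha hb hc
  exact min4_far h hwu hl hi hiv ha hb hc (fun j hj => hf j (List.mem_range.2 hj)) hn

lemma card_del {V : Type*} [Finite V] {N : ℕ} (hcard : Nat.card V = N + 1) (w : V) :
    Nat.card {t : V // t ≠ w} = N := by
  have h1 : ({w}ᶜ : Set V).ncard = N := by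
    rw [Set.ncard_compl, Set.ncard_singleton]
    omega
  rw [← h1]
  rfl

universe u

lemma min4_step {V : Type u} [Finite V] {G : SimpleGraph V} {N : ℕ} (IH : IHyp.{u} N)
    (hN : 4 ≤ N) (hcard : Nat.card V = N + 1) (hs : Sep3 G) (hm : ¬ IsMinor K24 G)
    (h : Min4 G) : Good G := by
  by_cases h5 : N = 4
  · exact good_K5 (by omega) h
  by_cases h6 : N = 5
  · exact absurd (min4_six (by omega) h) hm
  by_cases h7 : N = 6
  · exact absurd (min4_seven (by omega) h) hm
  obtain ⟨w, u, hwu, hs'⟩ := exists_contractible (by omega) hs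
  rcases IH _ (contr G w u) (card_del hcard w) hs' (fun h => hm (isMinor_of_contr hwu h)) with
    ⟨N', r, s, p, l, hP, hl⟩ | ⟨e, he, l, hl⟩
  · have hN' : N' = N := hl.2.2.1.symm.trans (card_del hcard w)
    exact absurd (min4_fam h (by omega) hP hwu hl) hm
  · have hN' : e.1 = N := hl.2.2.1.symm.trans (card_del hcard w)
    exact (min4_exc h he (by omega) hwu hl).elim

lemma good_four {V : Type*} [Finite V] {G : SimpleGraph V} (hc : Nat.card V = 4) (hs : Sep3 G) :
    Good G := by
  have hcomp : ∀ x y, G.Adj x y ↔ x ≠ y := by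
    intro x y
    refine ⟨fun h => h.ne, fun hxy => ?_⟩
    obtain ⟨a, xa, -, -⟩ := exists_nbr_ne (by omega) hs x x x
    obtain ⟨b, xb, ba, -⟩ := exists_nbr_ne (by omega) hs x a a
    obtain ⟨c, xc, ca, cb⟩ := exists_nbr_ne (by omega) hs x a b
    have := exhaust [x, a, b, c] (by
      simp [xa.ne, xb.ne, xc.ne, ba.symm, ca.symm, cb.symm]) (by simpa using hc) y
    simp at this
    rcases this with rfl | rfl | rfl | rfl
    · exact absurd rfl hxy
    all_goals assumption
  have e : V ≃ Fin 4 := Finite.equivFinOfCardEq hc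
  refine Or.inl ⟨4, 1, 1, 1, fun v => (e v).1, Or.inl ⟨rfl, le_rfl, Or.inl ⟨rfl, rfl⟩⟩, ?_⟩
  refine ⟨fun a b hab => e.injective (Fin.ext hab), fun v => (e v).2, hc, fun a b => ?_⟩
  rw [hcomp, ← e.injective.ne_iff]
  show e a ≠ e b ↔ gAdj 4 1 1 1 (e a).1 (e b).1
  unfold gAdj gh
  generalize e a = i
  generalize e b = j
  have := i.2
  have := j.2
  rw [ne_eq, Fin.ext_iff]
  omega

/-- The forward direction. -/
theorem forward : ∀ N, 4 ≤ N → IHyp.{u} N := by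
  intro N hN
  induction N, hN using Nat.le_induction with
  | base =>
    intro W _ H hc hs _
    exact good_four hc hs
  | succ N hN ih =>
    intro W _ H hc hs hm
    rcases min4_or_deg3 (by omega) hs with h | ⟨w, a, b, c, h⟩
    · exact min4_step ih hN hc hs hm h
    · exact deg3_step ih hN hc hs hm h

end K24Paper

namespace K24Paper
open SimpleGraph

/-! ### The graphs of the theorem have no `K_{2,4}` minor -/

lemma connSet_iUnion {V ι : Type*} {G : SimpleGraph V} [Nonempty ι] {R : Set V} (hR : R.Nonempty)
    (X : ι → Set V) (h : ∀ i, ConnSet G (R ∪ X i)) : ConnSet G (R ∪ ⋃ i, X i) := by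
  have key : ∀ A : Set V, (∀ a ∈ A, ∀ b ∈ R ∪ ⋃ i, X i, G.Adj a b → b ∈ A) → ∀ i,
      (∃ a ∈ A, a ∈ R ∪ X i) → R ∪ X i ⊆ A := by
    rintro A hcl i ⟨a, ha, ha'⟩ y hy
    have := (h i).2 (A ∩ (R ∪ X i)) Set.inter_subset_right ⟨a, ha, ha'⟩ (by
      intro c hc b hb hcb
      refine ⟨hcl c hc.1 b ?_ hcb, hb⟩
      rcases hb with hb | hb
      · exact Or.inl hb
      · exact Or.inr (Set.mem_iUnion.2 ⟨i, hb⟩))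
    exact (this hy).1
  obtain ⟨r, hr⟩ := hR
  refine ⟨⟨r, Or.inl hr⟩, fun A hA hne hcl => ?_⟩
  have hrA : r ∈ A := by
    obtain ⟨a, ha⟩ := hne
    rcases hA ha with h1 | h1
    · obtain ⟨i⟩ := (inferInstance : Nonempty ι)
      exact key A hcl i ⟨a, ha, Or.inl h1⟩ (Or.inl hr)
    · obtain ⟨i, hi⟩ := Set.mem_iUnion.1 h1
      exact key A hcl i ⟨a, ha, Or.inr hi⟩ (Or.inl hr)
  rintro y (hy | hy)
  · obtain ⟨i⟩ := (inferInstance : Nonempty ι)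
    exact key A hcl i ⟨r, hrA, Or.inl hr⟩ (Or.inl hy)
  · obtain ⟨i, hi⟩ := Set.mem_iUnion.1 hy
    exact key A hcl i ⟨r, hrA, Or.inl hr⟩ (Or.inr hi)

/-- Shrinking a branch set to a single vertex. -/
lemma shrink {V : Type*} {G : SimpleGraph V} {R B T : Set V} (hR : ConnSet G R)
    (hB : ConnSet G B) (hTB : ∃ t ∈ T, t ∈ B) (hRB : ∃ x ∈ R, ∃ b ∈ B, G.Adj x b) :
    ∃ X s, X ⊆ B ∧ s ∈ B ∧ s ∉ X ∧ s ∈ T ∧ ConnSet G (R ∪ X) ∧ ∃ x ∈ R ∪ X, G.Adj s x := by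
  let ι := {Y : Set V // Y ⊆ B ∧ (∀ y ∈ Y, y ∉ T) ∧ ConnSet G (R ∪ Y)}
  have hι : Nonempty ι := ⟨∅, Set.empty_subset _, fun _ h => h.elim, by simpa using hR⟩
  let X : Set V := ⋃ i : ι, i.1
  have hXB : X ⊆ B := Set.iUnion_subset fun i => i.2.1
  have hXT : ∀ y ∈ X, y ∉ T := by
    intro y hy
    obtain ⟨i, hi⟩ := Set.mem_iUnion.1 hy
    exact i.2.2.1 y hi
  have hX : ConnSet G (R ∪ X) := connSet_iUnion hR.1 (fun i : ι => i.1) fun i => i.2.2.2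
  by_cases hcon : ∃ s ∈ B, s ∈ T ∧ ∃ x ∈ R ∪ X, G.Adj s x
  · obtain ⟨s, h1, h2, h3⟩ := hcon
    exact ⟨X, s, hXB, h1, fun h => hXT s h h2, h2, hX, h3⟩
  exfalso
  have hext : ∀ b ∈ B, ∀ x ∈ R ∪ X, G.Adj b x → b ∈ X := by
    intro b hb x hx hbx
    have hbT : b ∉ T := fun h => hcon ⟨b, hb, h, x, hx, hbx⟩
    refine Set.mem_iUnion.2 ⟨⟨insert b X, ?_, ?_, ?_⟩, Or.inl rfl⟩
    · rintro y (rfl | hy)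
      · exact hb
      · exact hXB hy
    · rintro y (rfl | hy)
      · exact hbT
      · exact hXT y hy
    · rw [Set.union_insert]
      exact hX.insert hx hbx
  obtain ⟨x, hx, b, hb, hxb⟩ := hRB
  have h1 := hB.2 X hXB ⟨b, hext b hb x (Or.inl hx) hxb.symm⟩
    (fun a ha c hc hac => hext c hc a (Or.inr ha) hac.symm)
  obtain ⟨t, ht, ht'⟩ := hTB
  exact hXT t (h1 ht') ht

lemma std_of_minor {V : Type*} {G : SimpleGraph V} (h : IsMinor K24 G) :
    ∃ (R1 R2 : Set V) (s : Fin 4 → V), ConnSet G R1 ∧ ConnSet G R2 ∧ (∀ x ∈ R1, x ∉ R2) ∧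
      Function.Injective s ∧ (∀ i, s i ∉ R1) ∧ (∀ i, s i ∉ R2) ∧
      (∀ i, ∃ x ∈ R1, G.Adj (s i) x) ∧ (∀ i, ∃ x ∈ R2, G.Adj (s i) x) := by
  rw [isMinor_iff] at h
  obtain ⟨B, hc, hd, ha⟩ := h
  have hd' : ∀ w₁ w₂, w₁ ≠ w₂ → ∀ x, x ∈ B w₁ → x ∉ B w₂ := fun w₁ w₂ hw x h1 h2 =>
    Set.disjoint_left.1 (hd w₁ w₂ hw) h1 h2
  have key : ∀ i : Fin 4, ∃ X s, X ⊆ B (Sum.inr i) ∧ s ∈ B (Sum.inr i) ∧ s ∉ X ∧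
      s ∈ {t | ∃ x ∈ B (Sum.inl 1), G.Adj t x} ∧ ConnSet G (B (Sum.inl 0) ∪ X) ∧
      ∃ x ∈ B (Sum.inl 0) ∪ X, G.Adj s x := by
    intro i
    apply shrink (hc _) (hc _)
    · obtain ⟨x, hx, t, ht, hxt⟩ := ha (Sum.inl 1) (Sum.inr i) (by simp [K24])
      exact ⟨t, ⟨x, hx, hxt.symm⟩, ht⟩
    · exact ha (Sum.inl 0) (Sum.inr i) (by simp [K24])
  choose X s hXB hsB hsX hsT hX hsR using key
  refine ⟨B (Sum.inl 0) ∪ ⋃ i, X i, B (Sum.inl 1), s, connSet_iUnion (hc _).1 X hX, hc _,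
    ?_, ?_, ?_, ?_, ?_, fun i => hsT i⟩
  · rintro x (hx | hx)
    · exact hd' _ _ (by simp) x hx
    · obtain ⟨i, hi⟩ := Set.mem_iUnion.1 hx
      exact hd' _ _ (by simp) x (hXB i hi)
  · intro i j hij
    by_contra hne
    exact hd' (Sum.inr i) (Sum.inr j) (by simpa using hne) _ (hsB i) (hij ▸ hsB j)
  · rintro i (hx | hx)
    · exact hd' _ _ (by simp) _ hx (hsB i)
    · obtain ⟨j, hj⟩ := Set.mem_iUnion.1 hx
      by_cases hij : j = i
      · subst hij
        exact hsX j hj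
      · exact hd' (Sum.inr j) (Sum.inr i) (by simpa using hij) _ (hXB j hj) (hsB i)
  · intro i
    exact hd' _ _ (by simp) _ (hsB i)
  · intro i
    obtain ⟨x, hx, hadj⟩ := hsR i
    refine ⟨x, ?_, hadj⟩
    rcases hx with hx | hx
    · exact Or.inl hx
    · exact Or.inr (Set.mem_iUnion.2 ⟨i, hx⟩)

lemma ConnSet.map {V : Type*} {G : SimpleGraph V} {R : Set V} (h : ConnSet G R) (l : V ↪ ℕ) :
    ConnSet (G.map l) (l '' R) := by
  refine ⟨h.1.image _, fun A hA hne hcl => ?_⟩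
  have h1 := h.2 (l ⁻¹' A ∩ R) Set.inter_subset_right (by
    obtain ⟨a, ha⟩ := hne
    obtain ⟨r, hr, rfl⟩ := hA ha
    exact ⟨r, ha, hr⟩) (fun a ha b hb hab =>
      ⟨hcl _ ha.1 _ ⟨b, hb, rfl⟩ ((SimpleGraph.map_adj_apply).2 hab), hb⟩)
  rintro _ ⟨y, hy, rfl⟩
  exact (h1 hy).1

/-- A standard minor of a labelled graph. -/
def StdN (N : ℕ) (f : ℕ → ℕ → Prop) (H : SimpleGraph ℕ) (R1 R2 : Set ℕ) (s : Fin 4 → ℕ) : Prop :=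
  (∀ a b, H.Adj a b → f a b) ∧ (∀ x ∈ R1, x < N) ∧ (∀ x ∈ R2, x < N) ∧ (∀ i, s i < N) ∧
    ConnSet H R1 ∧ ConnSet H R2 ∧ (∀ x ∈ R1, x ∉ R2) ∧
      Function.Injective s ∧ (∀ i, s i ∉ R1) ∧ (∀ i, s i ∉ R2) ∧
      (∀ i, ∃ x ∈ R1, H.Adj (s i) x) ∧ (∀ i, ∃ x ∈ R2, H.Adj (s i) x)

lemma StdN.swap {N : ℕ} {f : ℕ → ℕ → Prop} {H : SimpleGraph ℕ} {R1 R2 : Set ℕ} {s : Fin 4 → ℕ}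
    (h : StdN N f H R1 R2 s) : StdN N f H R2 R1 s := by
  obtain ⟨h1, h2, h3, h4, h5, h6, h7, h8, h9, h10, h11, h12⟩ := h
  exact ⟨h1, h3, h2, h4, h6, h5, fun x hx hx' => h7 x hx' hx, h8, h10, h9, h12, h11⟩

lemma LabBy.std {V : Type*} {G : SimpleGraph V} {N : ℕ} {f : ℕ → ℕ → Prop} {l : V → ℕ}
    (h : LabBy G N f l) (hm : IsMinor K24 G) : ∃ H R1 R2 s, StdN N f H R1 R2 s := by
  obtain ⟨R1, R2, s, h1, h2, h3, h4, h5, h6, h7, h8⟩ := std_of_minor hm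
  obtain ⟨hinj, hlt, hcard, hadj⟩ := h
  let e : V ↪ ℕ := ⟨l, hinj⟩
  refine ⟨G.map e, e '' R1, e '' R2, fun i => e (s i), ?_, ?_, ?_, fun i => hlt _, h1.map e,
    h2.map e, ?_, e.injective.comp h4, ?_, ?_, ?_, ?_⟩
  · rintro a b hab
    rw [SimpleGraph.map_adj] at hab
    obtain ⟨u, v, huv, rfl, rfl⟩ := hab
    exact (hadj u v).1 huv
  · rintro _ ⟨x, -, rfl⟩
    exact hlt x
  · rintro _ ⟨x, -, rfl⟩
    exact hlt x
  · rintro _ ⟨x, hx, rfl⟩ ⟨y, hy, hxy⟩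
    have := e.injective hxy
    subst this
    exact h3 y hx hy
  · rintro i ⟨y, hy, hxy⟩
    have := e.injective hxy
    exact h5 i (this ▸ hy)
  · rintro i ⟨y, hy, hxy⟩
    have := e.injective hxy
    exact h6 i (this ▸ hy)
  · intro i
    obtain ⟨x, hx, hix⟩ := h7 i
    exact ⟨e x, ⟨x, hx, rfl⟩, (SimpleGraph.map_adj_apply).2 hix⟩
  · intro i
    obtain ⟨x, hx, hix⟩ := h8 i
    exact ⟨e x, ⟨x, hx, rfl⟩, (SimpleGraph.map_adj_apply).2 hix⟩

lemma sort4 {s : Fin 4 → ℕ} (hs : Function.Injective s) {P : ℕ → Prop} (hP : ∀ i, P (s i)) :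
    ∃ a b c d, a < b ∧ b < c ∧ c < d ∧ P a ∧ P b ∧ P c ∧ P d := by
  let F := Finset.univ.image s
  have hF : F.card = 4 := by
    rw [Finset.card_image_of_injective _ hs]
    rfl
  let o := F.orderEmbOfFin hF
  have ho : ∀ i, P (o i) := by
    intro i
    obtain ⟨j, -, hj⟩ := Finset.mem_image.1 (F.orderEmbOfFin_mem hF i)
    exact hj ▸ hP j
  exact ⟨o 0, o 1, o 2, o 3, o.strictMono (by decide), o.strictMono (by decide),
    o.strictMono (by decide), ho 0, ho 1, ho 2, ho 3⟩

/-! #### The family -/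

lemma gAdj_inner {N r s p a b : ℕ} (h : gAdj N r s p a b) (ha : a ≠ 0) (ha' : a + 1 ≠ N)
    (hb : b ≠ 0) (hb' : b + 1 ≠ N) : b = a + 1 ∨ a = b + 1 := by
  unfold gAdj gh at h
  omega

lemma hubfree_conv {N r s p : ℕ} {H : SimpleGraph ℕ} (hH : ∀ a b, H.Adj a b → gAdj N r s p a b)
    {R : Set ℕ} (hR : ConnSet H R) (h0 : 0 ∉ R) (hN : ∀ x ∈ R, x + 1 ≠ N) {a b c : ℕ}
    (ha : a ∈ R) (hc : c ∈ R) (hab : a < b) (hbc : b < c) : b ∈ R := by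
  by_contra hb
  have := hR.2 {x | x ∈ R ∧ x < b} (fun x hx => hx.1) ⟨a, ha, hab⟩ (by
    rintro x ⟨hx, hxb⟩ y hy hxy
    refine ⟨hy, ?_⟩
    have := gAdj_inner (hH _ _ hxy) (fun e => h0 (e ▸ hx)) (hN x hx) (fun e => h0 (e ▸ hy)) (hN y hy)
    have : y ≠ b := fun e => hb (e ▸ hy)
    omega) hc
  exact absurd this.2 (by omega)

lemma hubfree_nbrs {N r s p : ℕ} {H : SimpleGraph ℕ} (hH : ∀ a b, H.Adj a b → gAdj N r s p a b)
    {R : Set ℕ} (hR : ConnSet H R) (h0 : 0 ∉ R) (hN : ∀ x ∈ R, x + 1 ≠ N) {a b c d : ℕ}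
    (hab : a < b) (hbc : b < c) (hcd : c < d) (hd : d < N)
    (h : ∀ t, t = a ∨ t = b ∨ t = c ∨ t = d → t ∉ R ∧ ∃ x ∈ R, H.Adj t x) :
    a = 0 ∧ d + 1 = N ∧ b + 1 ∈ R := by
  have key : ∀ t, t = a ∨ t = b ∨ t = c ∨ t = d → t ∉ R ∧
      (t = 0 ∨ t + 1 = N ∨ t + 1 ∈ R ∨ ∃ y ∈ R, y + 1 = t) := by
    intro t ht
    obtain ⟨h1, x, hx, htx⟩ := h t ht
    refine ⟨h1, ?_⟩
    by_cases e1 : t = 0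
    · exact Or.inl e1
    by_cases e2 : t + 1 = N
    · exact Or.inr (Or.inl e2)
    rcases gAdj_inner (hH _ _ htx) e1 e2 (fun e => h0 (e ▸ hx)) (hN x hx) with e | e
    · exact Or.inr (Or.inr (Or.inl (e ▸ hx)))
    · exact Or.inr (Or.inr (Or.inr ⟨x, hx, e.symm⟩))
  -- no vertex outside lies strictly between two vertices of the set
  have conv : ∀ x y z, x ∈ R → z ∈ R → y ∉ R → ¬ (x < y ∧ y < z) := fun x y z hx hz hy hh =>
    hy (hubfree_conv hH hR h0 hN hx hz hh.1 hh.2)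
  have two : ∀ t t', t < t' → t ∉ R → t' ∉ R → (t + 1 ∈ R ∨ ∃ y ∈ R, y + 1 = t) →
      (t' + 1 ∈ R ∨ ∃ y ∈ R, y + 1 = t') → t + 1 ∈ R ∧ t' + 1 ∉ R := by
    intro t t' htt ht ht' h1 h2
    have n1 : t' ≠ t + 1 ∨ t + 1 ∉ R := by
      by_contra hcon
      push Not at hcon
      exact ht' (hcon.1 ▸ hcon.2)
    constructor
    · rcases h1 with h1 | ⟨y, hy, rfl⟩
      · exact h1
      · exfalso
        rcases h2 with h2 | ⟨z, hz, rfl⟩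
        · exact conv _ _ _ hy h2 ht (by omega)
        · by_cases e : z = y + 1
          · exact ht (e ▸ hz)
          · exact conv _ _ _ hy hz ht (by omega)
    · intro h3
      rcases h1 with h1 | ⟨y, hy, rfl⟩
      · have : t' ≠ t + 1 := by
          rintro rfl
          exact ht' h1
        exact conv _ _ _ h1 h3 ht' (by omega)
      · exact conv _ _ _ hy h3 ht' (by omega)
  obtain ⟨ka, ka'⟩ := key a (by simp)
  obtain ⟨kb, kb'⟩ := key b (by simp)
  obtain ⟨kc, kc'⟩ := key c (by simp)
  obtain ⟨kd, kd'⟩ := key d (by simp)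
  have kb'' := (kb'.resolve_left (by omega)).resolve_left (by omega)
  have kc'' := (kc'.resolve_left (by omega)).resolve_left (by omega)
  have tbc := two b c hbc kb kc kb'' kc''
  refine ⟨?_, ?_, tbc.1⟩
  · by_contra e
    have ka'' := (ka'.resolve_left e).resolve_left (by omega)
    exact (two a b hab ka kb ka'' kb'').2 tbc.1
  · by_contra e
    have kd'' := (kd'.resolve_left (by omega)).resolve_left e
    exact tbc.2 (two c d hcd kc kd kc'' kd'').1

lemma gAdj_case {N r s p a b : ℕ} (h : gAdj N r s p a b) :
    b = a + 1 ∨ a = b + 1 ∨ a + 1 = N ∨ b + 1 = N ∨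
      (a = 0 ∧ N ≤ b + r + 1) ∨ (b = 0 ∧ N ≤ a + r + 1) := by
  unfold gAdj gh at h
  omega

lemma reach_low {N r s p : ℕ} {H : SimpleGraph ℕ} (hH : ∀ a b, H.Adj a b → gAdj N r s p a b)
    {R : Set ℕ} (hR : ConnSet H R) (h0 : 0 ∈ R) (hN : ∀ x ∈ R, x + 1 ≠ N) {a m b : ℕ}
    (h1 : 1 ≤ a) (ham : a < m) (hmb : m < b) (hb : b + 1 ≤ N) (ha' : a ∉ R) (hb' : b ∉ R)
    (hm : ∃ x ∈ R, H.Adj m x) : ∃ i, a < i ∧ i < b ∧ N ≤ i + r + 1 := by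
  by_contra hcon
  push Not at hcon
  have step : ∀ y ∈ R, ∀ t, a < t → t < b → H.Adj t y → a < y ∧ y < b := by
    intro y hy t h2 h3 hty
    have h4 := gAdj_case (hH _ _ hty)
    have h5 : y ≠ a := fun e => ha' (e ▸ hy)
    have h6 : y ≠ b := fun e => hb' (e ▸ hy)
    have h7 := hN y hy
    have h8 := hcon t h2 h3
    omega
  obtain ⟨x, hx, hmx⟩ := hm
  have := hR.2 {y | y ∈ R ∧ a < y ∧ y < b} (fun y hy => hy.1) ⟨x, hx, step x hx m ham hmb hmx⟩
    (fun t ht y hy hty => ⟨hy, step y hy t ht.2.1 ht.2.2 hty⟩) h0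
  exact absurd this.2.1 (by omega)

lemma gAdj_case2 {N r s p a b : ℕ} (h : gAdj N r s p a b) :
    b = a + 1 ∨ a = b + 1 ∨ a = 0 ∨ b = 0 ∨
      (a + 1 = N ∧ b ≤ s) ∨ (b + 1 = N ∧ a ≤ s) := by
  unfold gAdj gh at h
  omega

lemma reach_high {N r s p : ℕ} {H : SimpleGraph ℕ} (hH : ∀ a b, H.Adj a b → gAdj N r s p a b)
    {R : Set ℕ} (hR : ConnSet H R) (h0 : N - 1 ∈ R) (hN : 0 ∉ R) {a m b : ℕ}
    (ham : a < m) (hmb : m < b) (hb : b + 2 ≤ N) (ha' : a ∉ R) (hb' : b ∉ R)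
    (hm : ∃ x ∈ R, H.Adj m x) : ∃ i, a < i ∧ i < b ∧ i ≤ s ∧ (i = m ∨ i ∈ R) := by
  by_contra hcon
  push Not at hcon
  have step : ∀ y ∈ R, ∀ t, a < t → t < b → (t = m ∨ t ∈ R) → H.Adj t y → a < y ∧ y < b := by
    intro y hy t h2 h3 h9 hty
    have h4 := gAdj_case2 (hH _ _ hty)
    have h5 : y ≠ a := fun e => ha' (e ▸ hy)
    have h6 : y ≠ b := fun e => hb' (e ▸ hy)
    have h7 : y ≠ 0 := fun e => hN (e ▸ hy)
    have h8 : ¬ t ≤ s := fun e => by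
      have := hcon t h2 h3 e
      tauto
    omega
  obtain ⟨x, hx, hmx⟩ := hm
  have := hR.2 {y | y ∈ R ∧ a < y ∧ y < b} (fun y hy => hy.1)
    ⟨x, hx, step x hx m ham hmb (Or.inl rfl) hmx⟩
    (fun t ht y hy hty => ⟨hy, step y hy t ht.2.1 ht.2.2 (Or.inr ht.1) hty⟩) h0
  exact absurd this.2.2 (by omega)

lemma fam_hubs {N r s p : ℕ} (hrs : r + s + 1 ≤ N) {H : SimpleGraph ℕ} {R1 R2 : Set ℕ}
    {σ : Fin 4 → ℕ} (h : StdN N (gAdj N r s p) H R1 R2 σ) (h0 : 0 ∈ R1) (hN : N - 1 ∈ R2) :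
    False := by
  obtain ⟨hH, l1, l2, ls, c1, c2, hd, hinj, n1, n2, a1, a2⟩ := h
  have hlt : ∀ i, σ i < N ∧ σ i ∉ R1 ∧ σ i ∉ R2 ∧ (∃ x ∈ R1, H.Adj (σ i) x) ∧
      ∃ x ∈ R2, H.Adj (σ i) x := fun i => ⟨ls i, n1 i, n2 i, a1 i, a2 i⟩
  obtain ⟨a, b, c, d, hab, hbc, hcd, ⟨-, xa, xa', -⟩, ⟨-, xb, xb', yb, -⟩, ⟨-, xc, xc', -, yc⟩,
    ⟨dN, xd, xd', -⟩⟩ := sort4 hinj (P := fun t => t < N ∧ t ∉ R1 ∧ t ∉ R2 ∧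
      (∃ x ∈ R1, H.Adj t x) ∧ ∃ x ∈ R2, H.Adj t x) hlt
  have ha0 : a ≠ 0 := fun e => xa (e ▸ h0)
  have hdN : d ≠ N - 1 := fun e => xd' (e ▸ hN)
  obtain ⟨j, j1, j2, j3, j4⟩ := reach_high hH c2 hN (hd 0 h0) hbc hcd (by omega) xb' xd' yc
  have hj : j ∉ R1 := by
    rcases j4 with rfl | j4
    · exact xc
    · exact fun hh => hd j hh j4
  obtain ⟨i, i1, i2, i3⟩ := reach_low hH c1 h0 (fun x hx e => hd x hx (by
    have : x = N - 1 := by omega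
    exact this ▸ hN)) (by omega) hab j1 (by omega) xa hj yb
  omega

lemma fam_free {N r s p : ℕ} {H : SimpleGraph ℕ} {R1 R2 : Set ℕ}
    {σ : Fin 4 → ℕ} (h : StdN N (gAdj N r s p) H R1 R2 σ) (h0 : 0 ∉ R1) (hN : N - 1 ∉ R1) :
    False := by
  obtain ⟨hH, l1, l2, ls, c1, c2, hd, hinj, n1, n2, a1, a2⟩ := h
  have hlt : ∀ i, σ i < N ∧ σ i ∉ R1 ∧ σ i ∉ R2 ∧ (∃ x ∈ R1, H.Adj (σ i) x) ∧
      ∃ x ∈ R2, H.Adj (σ i) x := fun i => ⟨ls i, n1 i, n2 i, a1 i, a2 i⟩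
  obtain ⟨a, b, c, d, hab, hbc, hcd, ⟨aN, xa, xa', ya, ya'⟩, ⟨bN, xb, xb', yb, yb'⟩,
    ⟨cN, xc, xc', yc, yc'⟩, ⟨dN, xd, xd', yd, yd'⟩⟩ := sort4 hinj (P := fun t => t < N ∧ t ∉ R1 ∧
      t ∉ R2 ∧ (∃ x ∈ R1, H.Adj t x) ∧ ∃ x ∈ R2, H.Adj t x) hlt
  have e1 := hubfree_nbrs hH c1 h0 (fun x hx e => hN (by
    have : x = N - 1 := by omega
    exact this ▸ hx)) hab hbc hcd dN (by
      rintro t (rfl | rfl | rfl | rfl)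
      exacts [⟨xa, ya⟩, ⟨xb, yb⟩, ⟨xc, yc⟩, ⟨xd, yd⟩])
  have e2 := hubfree_nbrs hH c2 (fun h => xa' (e1.1 ▸ h)) (fun x hx e => xd' (by
    have : d = x := by omega
    exact this ▸ hx)) hab hbc hcd dN (by
      rintro t (rfl | rfl | rfl | rfl)
      exacts [⟨xa', ya'⟩, ⟨xb', yb'⟩, ⟨xc', yc'⟩, ⟨xd', yd'⟩])
  exact hd _ e1.2.2 e2.2.2

lemma fam_no_minor {V : Type*} {G : SimpleGraph V} {N r s p : ℕ} {l : V → ℕ} (hP : GP N r s p)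
    (hl : LabBy G N (gAdj N r s p) l) : ¬ IsMinor K24 G := by
  intro hm
  obtain ⟨H, R1, R2, σ, h⟩ := hl.std hm
  have hrs : r + s + 1 ≤ N := by
    unfold GP at hP
    omega
  have f1 := fam_free h
  have f2 := fam_free h.swap
  have d := h.2.2.2.2.2.2.1
  by_cases z1 : 0 ∈ R1
  · have y2 : N - 1 ∈ R2 := by
      by_contra hh
      exact f2 (d 0 z1) hh
    exact fam_hubs hrs h z1 y2
  · have y1 : N - 1 ∈ R1 := by
      by_contra hh
      exact f1 z1 hh
    have z2 : 0 ∈ R2 := by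
      by_contra hh
      exact f2 hh (d _ y1)
    exact fam_hubs hrs h.swap z2 y1

/-! #### The exceptional graphs -/

/-- Equal or adjacent. -/
def eqAdj (M a b : ℕ) : Bool := Nat.beq a b || tb M a b

/-- The common neighbours outside of two small connected sets. -/
def outB (M a b c d e t : ℕ) : Bool :=
  (tb M t a || tb M t b) && (tb M t c || tb M t d || tb M t e) &&
    !(Nat.beq t a || Nat.beq t b || Nat.beq t c || Nat.beq t d || Nat.beq t e)

/-- No standard minor. -/
def noStd (n M : ℕ) : Bool :=
  let L := List.range n
  L.all fun a => L.all fun b => !(eqAdj M a b) || L.all fun c => L.all fun d => !(eqAdj M c d) ||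
    L.all fun e => !(eqAdj M d e) ||
      [a, b].any (fun x => Nat.beq x c || Nat.beq x d || Nat.beq x e) || Nat.ble (L.filter (outB M a b c d e)).length 3

lemma noStd_ok : (excs.all fun e => noStd e.1 e.2) = true := by
  decide +kernel

lemma conn2 {H : SimpleGraph ℕ} {R : Set ℕ} (h : ConnSet H R) (hf : R.Finite) (hc : R.ncard ≤ 2) :
    ∃ a b, R = {a, b} ∧ (a = b ∨ H.Adj a b) := by
  have hpos : 0 < R.ncard := (Set.ncard_pos hf).2 h.1
  obtain hc | hc : R.ncard = 1 ∨ R.ncard = 2 := by omega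
  · obtain ⟨a, rfl⟩ := Set.ncard_eq_one.1 hc
    exact ⟨a, a, by simp, Or.inl rfl⟩
  · obtain ⟨a, b, hab, rfl⟩ := Set.ncard_eq_two.1 hc
    refine ⟨a, b, rfl, Or.inr ?_⟩
    by_contra hn
    have := h.2 {a} (by simp) ⟨a, rfl⟩ (by
      rintro x rfl y (rfl | rfl) hxy
      · rfl
      · exact absurd hxy hn) (Or.inr rfl : b ∈ ({a, b} : Set ℕ))
    exact hab this.symm

lemma conn3 {H : SimpleGraph ℕ} {R : Set ℕ} (h : ConnSet H R) (hf : R.Finite) (hc : R.ncard ≤ 3) :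
    ∃ a b c, R = {a, b, c} ∧ (a = b ∨ H.Adj a b) ∧ (b = c ∨ H.Adj b c) := by
  by_cases h2 : R.ncard ≤ 2
  · obtain ⟨a, b, rfl, hab⟩ := conn2 h hf h2
    exact ⟨a, b, b, by simp, hab, Or.inl rfl⟩
  obtain ⟨a, b, c, hab, hac, hbc, rfl⟩ := Set.ncard_eq_three.1 (by omega : R.ncard = 3)
  have key : ∀ x y z, ({a, b, c} : Set ℕ) = {x, y, z} → x ≠ y → H.Adj x y ∨ H.Adj x z := by
    intro x y z he hxy
    rw [he] at h
    by_contra hn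
    push Not at hn
    have := h.2 {x} (by simp) ⟨x, rfl⟩ (by
      rintro u rfl v (rfl | rfl | rfl) huv
      · rfl
      · exact absurd huv hn.1
      · exact absurd huv hn.2) (Or.inr (Or.inl rfl) : y ∈ ({x, y, z} : Set ℕ))
    exact hxy this.symm
  have e1 : ({a, b, c} : Set ℕ) = {b, a, c} := by ext; simp; tauto
  have e2 : ({a, b, c} : Set ℕ) = {c, a, b} := by ext; simp; tauto
  have e3 : ({a, b, c} : Set ℕ) = {a, c, b} := by ext; simp; tauto
  have k1 := key a b c rfl hab
  have k2 := key b a c e1 hab.symm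
  have k3 := key c a b e2 hac.symm
  by_cases f1 : H.Adj a b
  · by_cases f2 : H.Adj b c
    · exact ⟨a, b, c, rfl, Or.inr f1, Or.inr f2⟩
    · have : H.Adj c a := k3.resolve_right fun h => f2 h.symm
      exact ⟨b, a, c, e1, Or.inr f1.symm, Or.inr this.symm⟩
  · have g1 : H.Adj a c := k1.resolve_left f1
    have g2 : H.Adj b c := k2.resolve_left fun h => f1 h.symm
    exact ⟨a, c, b, e3, Or.inr g1, Or.inr g2.symm⟩

lemma exc_std {e : ℕ × ℕ} (he : e ∈ excs) {H : SimpleGraph ℕ} {R1 R2 : Set ℕ}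
    {σ : Fin 4 → ℕ} (h : StdN e.1 (bitAdj e.2) H R1 R2 σ) (hle : R1.ncard ≤ R2.ncard) : False := by
  obtain ⟨hH, l1, l2, ls, c1, c2, hd, hinj, n1, n2, a1, a2⟩ := h
  have he8 : e.1 ≤ 8 := by
    have : ∀ e ∈ excs, e.1 ≤ 8 := by decide
    exact this e he
  have f1 : R1.Finite := (Set.finite_Iio e.1).subset l1
  have f2 : R2.Finite := (Set.finite_Iio e.1).subset l2
  have hp1 : 0 < R1.ncard := (Set.ncard_pos f1).2 c1.1
  have hcard : R1.ncard + R2.ncard + 4 ≤ e.1 := by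
    have q1 : (R1 ∪ R2).ncard = R1.ncard + R2.ncard :=
      Set.ncard_union_eq (Set.disjoint_left.2 hd) f1 f2
    have q2 : (Set.range σ).ncard = 4 := by
      rw [← Set.image_univ, Set.ncard_image_of_injective _ hinj, Set.ncard_univ]
      simp
    have q3 : (R1 ∪ R2 ∪ Set.range σ).ncard = (R1 ∪ R2).ncard + (Set.range σ).ncard := by
      apply Set.ncard_union_eq _ (f1.union f2) (Set.finite_range σ)
      rw [Set.disjoint_left]
      rintro x hx ⟨i, rfl⟩
      rcases hx with hx | hx
      · exact n1 i hx
      · exact n2 i hx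
    have q4 : (R1 ∪ R2 ∪ Set.range σ).ncard ≤ (Set.Iio e.1).ncard := by
      apply Set.ncard_le_ncard _ (Set.finite_Iio _)
      rintro x ((hx | hx) | ⟨i, rfl⟩)
      · exact l1 x hx
      · exact l2 x hx
      · exact ls i
    have q5 : (Set.Iio e.1).ncard = e.1 := by
      rw [← Finset.coe_range, Set.ncard_coe_finset, Finset.card_range]
    omega
  obtain ⟨a, b, rfl, hab⟩ := conn2 c1 f1 (by omega)
  obtain ⟨c, d, f, rfl, hcd, hdf⟩ := conn3 c2 f2 (by omega)
  have hcheck := List.all_eq_true.1 noStd_ok e he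
  have tbH : ∀ x y, H.Adj x y → tb e.2 x y = true := fun x y hxy => by
    rw [tb_eq]
    exact hH x y hxy
  have eqA : ∀ x y, (x = y ∨ H.Adj x y) → eqAdj e.2 x y = true := by
    rintro x y (rfl | hxy)
    · simp [eqAdj]
    · simp [eqAdj, tbH x y hxy]
  have m : ∀ x, x < e.1 → x ∈ List.range e.1 := fun x hx => List.mem_range.2 hx
  unfold noStd at hcheck
  have k1 := List.all_eq_true.1 (List.all_eq_true.1 hcheck a (m a (l1 a (by simp)))) b
    (m b (l1 b (by simp)))
  rw [eqA a b hab, Bool.not_true, Bool.false_or] at k1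
  have k2 := List.all_eq_true.1 (List.all_eq_true.1 k1 c (m c (l2 c (by simp)))) d
    (m d (l2 d (by simp)))
  rw [eqA c d hcd, Bool.not_true, Bool.false_or] at k2
  have k3 := List.all_eq_true.1 k2 f (m f (l2 f (by simp)))
  have nb : ∀ x y, x ≠ y → Nat.beq x y = false := fun x y hxy => by
    rw [← Bool.not_eq_true, Nat.beq_eq]
    exact hxy
  have ha := hd a (by simp)
  have hb := hd b (by simp)
  simp only [Set.mem_insert_iff, Set.mem_singleton_iff, not_or] at ha hb
  have hdisj : [a, b].any (fun x => Nat.beq x c || Nat.beq x d || Nat.beq x f) = false := by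
    simp [nb _ _ ha.1, nb _ _ ha.2.1, nb _ _ ha.2.2, nb _ _ hb.1, nb _ _ hb.2.1, nb _ _ hb.2.2]
  rw [eqA d f hdf, hdisj, Bool.not_true, Bool.false_or, Bool.false_or, Nat.ble_eq] at k3
  have hsub : Finset.univ.image σ ⊆ ((List.range e.1).filter (outB e.2 a b c d f)).toFinset := by
    intro t ht
    obtain ⟨i, -, rfl⟩ := Finset.mem_image.1 ht
    rw [List.mem_toFinset, List.mem_filter]
    refine ⟨m _ (ls i), ?_⟩
    obtain ⟨x, hx, hxi⟩ := a1 i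
    obtain ⟨y, hy, hyi⟩ := a2 i
    have t1 := tbH _ _ hxi
    have t2 := tbH _ _ hyi
    have u1 := n1 i
    have u2 := n2 i
    simp only [Set.mem_insert_iff, Set.mem_singleton_iff, not_or] at hx hy u1 u2
    have v1 : (tb e.2 (σ i) a || tb e.2 (σ i) b) = true := by
      rcases hx with rfl | rfl <;> simp [t1]
    have v2 : (tb e.2 (σ i) c || tb e.2 (σ i) d || tb e.2 (σ i) f) = true := by
      rcases hy with rfl | rfl | rfl <;> simp [t2]
    unfold outB
    rw [v1, v2]
    simp [nb _ _ u1.1, nb _ _ u1.2, nb _ _ u2.1, nb _ _ u2.2.1, nb _ _ u2.2.2]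
  have h4 := Finset.card_le_card hsub
  rw [Finset.card_image_of_injective _ hinj, Finset.card_univ, Fintype.card_fin] at h4
  have h5 := List.toFinset_card_le ((List.range e.1).filter (outB e.2 a b c d f))
  omega

theorem backward {V : Type*} {G : SimpleGraph V} (h : Good G) : ¬ IsMinor K24 G := by
  rcases h with ⟨N, r, s, p, l, hP, hl⟩ | ⟨e, he, l, hl⟩
  · exact fam_no_minor hP hl
  · intro hm
    obtain ⟨H, R1, R2, σ, h⟩ := hl.std hm
    rcases le_total R1.ncard R2.ncard with hle | hle
    · exact exc_std he h hle
    · exact exc_std he h.swap hle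

end K24Paper

namespace K24Paper
open SimpleGraph

/-! ### Assembling the theorem -/

lemma labBy_iff {V : Type*} [Finite V] {G : SimpleGraph V} {n : ℕ} {f : ℕ → ℕ → Prop}
    {K : SimpleGraph (Fin n)} (hK : ∀ i j : Fin n, K.Adj i j ↔ f i.1 j.1) :
    (∃ l, LabBy G n f l) ↔ Nonempty (G ≃g K) := by
  constructor
  · rintro ⟨l, h1, h2, h3, h4⟩
    let g : V → Fin n := fun v => ⟨l v, h2 v⟩
    have hg : Function.Injective g := fun a b e => h1 (congrArg Fin.val e)
    have hb : Function.Bijective g :=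
      (Nat.bijective_iff_injective_and_card g).2 ⟨hg, by simpa using h3⟩
    refine ⟨⟨Equiv.ofBijective g hb, ?_⟩⟩
    intro a b
    exact (hK (g a) (g b)).trans (h4 a b).symm
  · rintro ⟨e⟩
    refine ⟨fun v => (e v).1, fun a b hab => e.injective (Fin.ext hab), fun v => (e v).2, ?_, ?_⟩
    · rw [Nat.card_congr e.toEquiv, Nat.card_fin]
    · intro a b
      exact e.map_adj_iff.symm.trans (hK _ _)

lemma gnrs_adj {n r s : ℕ} (hr : r + 3 ≤ n) (b : Bool) (i j : Fin n) :
    (Gnrs n r s b).Adj i j ↔ gAdj n r s b.toNat i.1 j.1 := by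
  have key : ∀ x y : ℕ, x < n → y < n → ((y = x + 1 ∨ (x = 0 ∧ n - 1 - r ≤ y ∧ y ≤ n - 2) ∨
      (y = n - 1 ∧ 1 ≤ x ∧ x ≤ s) ∨ (b = true ∧ x = 0 ∧ y = n - 1)) ↔ gh n r s b.toNat x y) := by
    intro x y hx hy
    unfold gh
    cases b <;> simp <;> omega
  unfold Gnrs gAdj
  rw [SimpleGraph.fromRel_adj, key _ _ i.2 j.2, key _ _ j.2 i.2, ne_eq, Fin.ext_iff]

lemma gparams_iff {n r s : ℕ} (b : Bool) : Gparams n r s b ↔ GP n r s b.toNat := by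
  unfold Gparams GP
  cases b <;> simp <;> omega

lemma inGtilde_iff {V : Type*} [Finite V] (G : SimpleGraph V) :
    InGtilde G ↔ ∃ N r s p l, GP N r s p ∧ LabBy G N (gAdj N r s p) l := by
  have hb : ∀ {n r s p}, GP n r s p → r + 3 ≤ n := by
    intro n r s p h
    unfold GP at h
    omega
  constructor
  · rintro ⟨n, r, s, b, hP, hiso⟩
    rw [gparams_iff] at hP
    obtain ⟨l, hl⟩ := (labBy_iff (gnrs_adj (hb hP) b)).2 hiso
    exact ⟨n, r, s, _, l, hP, hl⟩
  · rintro ⟨n, r, s, p, l, hP, hl⟩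
    have hp : p = (decide (p = 1)).toNat := by
      have : p = 0 ∨ p = 1 := by
        unfold GP at hP
        omega
      rcases this with rfl | rfl <;> rfl
    rw [hp] at hP hl
    exact ⟨n, r, s, _, (gparams_iff _).2 hP, (labBy_iff (gnrs_adj (hb hP) _)).1 ⟨l, hl⟩⟩

lemma adj_K5 (i j : Fin 5) : GK5.Adj i j ↔ bitAdj 276707635146073636894 i.1 j.1 := by
  simp only [GK5, completeGraph, SimpleGraph.top_adj, bitAdj]
  revert i j
  decide

lemma adj_K33 (i j : Fin 6) : K33.Adj i j ↔ bitAdj 8462609866481485548617784 i.1 j.1 := by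
  simp only [K33, SimpleGraph.fromRel_adj, bitAdj]
  revert i j
  decide

lemma adj_GA (i j : Fin 6) : GA.Adj i j ↔ bitAdj 8462609866481494138814520 i.1 j.1 := by
  simp only [GA, K33, AddEdge, SimpleGraph.sup_adj, SimpleGraph.fromRel_adj, bitAdj]
  revert i j
  decide

lemma adj_GAplus (i j : Fin 6) : GAplus.Adj i j ↔ bitAdj 27806013276125919639765048 i.1 j.1 := by
  simp only [GAplus, GA, K33, AddEdge, SimpleGraph.sup_adj, SimpleGraph.fromRel_adj, bitAdj]
  revert i j
  decide

lemma adj_GB (i j : Fin 7) : GB.Adj i j ↔ bitAdj 554605600283507761791030526072 i.1 j.1 := by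
  simp only [GB, SimpleGraph.fromRel_adj, bitAdj]
  revert i j
  decide +kernel

lemma adj_GBplus (i j : Fin 7) :
    GBplus.Adj i j ↔ bitAdj 3089984171992421901051618132088 i.1 j.1 := by
  simp only [GBplus, GB, AddEdge, SimpleGraph.sup_adj, SimpleGraph.fromRel_adj, bitAdj]
  revert i j
  decide +kernel

lemma adj_GD (i j : Fin 7) : GD.Adj i j ↔ bitAdj 554630988297576616566566748238 i.1 j.1 := by
  simp only [GD, SimpleGraph.fromRel_adj, bitAdj]
  revert i j
  decide +kernel

lemma adj_GCplus (i j : Fin 8) :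
    GCplus.Adj i j ↔ bitAdj 135001699059822577611621605409357894 i.1 j.1 := by
  simp only [GCplus, SimpleGraph.fromRel_adj, bitAdj]
  revert i j
  decide +kernel

lemma adj_GC (i j : Fin 8) :
    GC.Adj i j ↔ bitAdj 135001699059822430033165416105574470 i.1 j.1 := by
  simp only [GC, GCplus, SimpleGraph.deleteEdges_adj, SimpleGraph.fromRel_adj, bitAdj,
    Set.mem_singleton_iff]
  revert i j
  decide +kernel

lemma good_iff {V : Type*} [Finite V] (G : SimpleGraph V) : Good G ↔
      (InGtilde G ∨
       Nonempty (G ≃g GK5) ∨ Nonempty (G ≃g K33) ∨ Nonempty (G ≃g GA) ∨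
       Nonempty (G ≃g GAplus) ∨ Nonempty (G ≃g GB) ∨ Nonempty (G ≃g GBplus) ∨
       Nonempty (G ≃g GC) ∨ Nonempty (G ≃g GCplus) ∨ Nonempty (G ≃g GD)) := by
  unfold Good
  rw [inGtilde_iff, ← labBy_iff adj_K5, ← labBy_iff adj_K33, ← labBy_iff adj_GA,
    ← labBy_iff adj_GAplus, ← labBy_iff adj_GB, ← labBy_iff adj_GBplus, ← labBy_iff adj_GC,
    ← labBy_iff adj_GCplus, ← labBy_iff adj_GD]
  apply or_congr Iff.rfl
  simp only [excs, List.exists_mem_cons_iff, List.not_mem_nil, false_and, exists_false, or_false]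
  tauto

end K24Paper


namespace K24Paper

/-- Theorem 13, characterization of 3-connected
`K_{2,4}`-minor-free graphs: a 3-connected graph `G` is `K_{2,4}`-minor-free iff
`G ∈ 𝒢̃` or `G` is isomorphic to one of the nine small exceptions
`K₅, K_{3,3}, A, A⁺, B, B⁺, C, C⁺, D`. -/
theorem threeConnected_K24MinorFree_iff {V : Type*} [Fintype V] (G : SimpleGraph V)
    (hG : KConnected 3 G) :
    MinorFree K24 G ↔
      (InGtilde G ∨
       Nonempty (G ≃g GK5) ∨ Nonempty (G ≃g K33) ∨ Nonempty (G ≃g GA) ∨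
       Nonempty (G ≃g GAplus) ∨ Nonempty (G ≃g GB) ∨ Nonempty (G ≃g GBplus) ∨
       Nonempty (G ≃g GC) ∨ Nonempty (G ≃g GCplus) ∨ Nonempty (G ≃g GD)) := by
  rw [← good_iff]
  exact ⟨fun h => forward (Nat.card V) hG.1 V G rfl (sep3_of_kconn hG) h, fun h => backward h⟩

end K24Paper
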